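/- There exists a constant $c > 0$ such that for every integer $n \ge 2$ and every transitive subgroup $G$ of the symmetric group $\mathrm{Sym}(n)$, the minimal size $d(G)$ of a generating set of $G$ satisfies $d(G) \le c \cdot n / \sqrt{\log n}$. -/

import Mathlib

/-- The minimal size `d(G)` of a generating set of the group `G`. -/
noncomputable def minGenSize (G : Type*) [Group G] : ℕ :=
  sInf {k : ℕ | ∃ s : Finset G, s.card = k ∧ Subgroup.closure (s : Set G) = ⊤}

section GeneratorBounds

open Module
open scoped commutatorElement

theorem centralBinom_sq_mul_le (m : ℕ) : m.centralBinom ^ 2 * (2 * m + 1) ≤ 16 ^ m := by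
  induction m with
  | zero => simp
  | succ m ih =>
    have h := Nat.succ_mul_centralBinom_succ m
    have h2 : (m + 1) ^ 2 * ((m + 1).centralBinom ^ 2 * (2 * (m + 1) + 1))
        ≤ (m + 1) ^ 2 * 16 ^ (m + 1) := by
      calc (m + 1) ^ 2 * ((m + 1).centralBinom ^ 2 * (2 * (m + 1) + 1))
          = ((m + 1) * (m + 1).centralBinom) ^ 2 * (2 * m + 3) := by ring
        _ = (m.centralBinom ^ 2 * (2 * m + 1)) * (4 * ((2 * m + 1) * (2 * m + 3))) := by
            rw [h]; ring
        _ ≤ 16 ^ m * (4 * ((2 * m + 1) * (2 * m + 3))) := Nat.mul_le_mul_right _ ih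
        _ ≤ 16 ^ m * (16 * (m + 1) ^ 2) := Nat.mul_le_mul_left _ (by nlinarith)
        _ = _ := by ring
    exact Nat.le_of_mul_le_mul_left h2 (by positivity)

theorem choose_half_sq_mul_le (k : ℕ) : (k.choose (k / 2)) ^ 2 * (k + 1) ≤ 4 ^ k := by
  obtain ⟨m, rfl | rfl⟩ := Nat.even_or_odd' k
  · have := centralBinom_sq_mul_le m
    rw [Nat.centralBinom_eq_two_mul_choose] at this
    rw [Nat.mul_div_cancel_left _ two_pos, pow_mul]
    exact this
  · have := centralBinom_sq_mul_le (m + 1)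
    have h2 : (m + 1).centralBinom = 2 * (2 * m + 1).choose m := by
      rw [Nat.centralBinom_eq_two_mul_choose, show 2 * (m + 1) = 2 * m + 1 + 1 by ring,
        Nat.choose_succ_succ', Nat.choose_symm_half m]
      ring
    rw [h2] at this
    have h3 : (2 * m + 1) / 2 = m := by omega
    rw [h3, pow_add, pow_mul]
    have : 4 * (((2 * m + 1).choose m) ^ 2 * (2 * m + 1 + 1)) ≤ 4 * ((4 ^ 2) ^ m * 4 ^ 1) := by
      calc _ ≤ (2 * (2 * m + 1).choose m) ^ 2 * (2 * (m + 1) + 1) := by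
            nlinarith [sq_nonneg ((2 * m + 1).choose m)]
        _ ≤ _ := this
        _ = _ := by norm_num [pow_succ]; ring
    omega

open Finset in
theorem IsAntichain.card_mul_two_pow_le {p k : ℕ} (hp : 2 ≤ p) (A : Finset (Fin k → Fin p))
    (hA : IsAntichain (· ≤ ·) (A : Set (Fin k → Fin p))) :
    #A * 2 ^ k ≤ p ^ k * k.choose (k / 2) := by
  classical
  have : NeZero p := ⟨by omega⟩
  have hval1 : ((1 : Fin p) : ℕ) = 1 := by
    rw [Fin.val_one']; exact Nat.mod_eq_of_lt hp
  let c : (Fin k → Fin p) → Finset (Fin k) → (Fin k → Fin p) :=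
    fun u s i => if i ∈ s then u i + 1 else u i
  have key : ∀ u, #{s : Finset (Fin k) | c u s ∈ A} ≤ k.choose (k / 2) := by
    intro u
    let w : Finset (Fin k) := {i | (u i : ℕ) = p - 1}
    have hle : ∀ s t : Finset (Fin k), symmDiff s w ⊆ symmDiff t w → c u s ≤ c u t := by
      intro s t hst i
      have hi := @hst i
      simp only [Finset.mem_symmDiff] at hi
      have hmem : i ∈ w ↔ (u i : ℕ) = p - 1 := by simp [w]
      by_cases hw : i ∈ w
      · have hu : (u i : ℕ) = p - 1 := hmem.1 hw
        have hu1 : ((u i + 1 : Fin p) : ℕ) = 0 := by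
          rw [Fin.val_add, hval1, hu]
          have : p - 1 + 1 = p := by omega
          rw [this, Nat.mod_self]
        rw [Fin.le_def]
        simp only [c]
        by_cases h1 : i ∈ s <;> by_cases h2 : i ∈ t <;> simp_all
      · have hu : (u i : ℕ) ≠ p - 1 := fun h => hw (hmem.2 h)
        have hu1 : ((u i + 1 : Fin p) : ℕ) = u i + 1 := by
          rw [Fin.val_add, hval1]
          exact Nat.mod_eq_of_lt (by have := (u i).2; omega)
        rw [Fin.le_def]
        simp only [c]
        by_cases h1 : i ∈ s <;> by_cases h2 : i ∈ t <;> simp_all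
    have hinj : Function.Injective (fun s : Finset (Fin k) => symmDiff s w) :=
      fun s t h => symmDiff_left_injective w h
    have hcinj : Function.Injective (c u) := by
      intro s t hst
      ext i
      have := congrFun hst i
      have hne : u i + 1 ≠ u i := by
        intro h
        have h1 : (1 : Fin p) = 0 := by simpa using h
        have := congrArg Fin.val h1
        rw [hval1] at this
        simp at this
      by_cases h1 : i ∈ s <;> by_cases h2 : i ∈ t <;> simp [c, h1, h2, hne, hne.symm] at this ⊢
    rw [← Finset.card_image_of_injective _ hinj]
    have hanti : IsAntichain (· ⊆ ·)
        (((univ.filter (fun s : Finset (Fin k) => c u s ∈ A)).image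
          (fun s => symmDiff s w) : Finset (Finset (Fin k))) : Set (Finset (Fin k))) := by
      intro a ha b hb hab hsub
      simp only [coe_image, Set.mem_image, mem_coe, mem_filter, mem_univ, true_and] at ha hb
      obtain ⟨s, hs, rfl⟩ := ha
      obtain ⟨t, ht, rfl⟩ := hb
      have hst : s ≠ t := fun h => hab (by rw [h])
      exact hA hs ht (fun h => hst (hcinj h)) (hle s t hsub)
    simpa using hanti.sperner
  have hbij : ∀ s : Finset (Fin k), #{u : Fin k → Fin p | c u s ∈ A} = #A := by
    intro s
    let e : (Fin k → Fin p) ≃ (Fin k → Fin p) :=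
      Equiv.addRight (fun i => if i ∈ s then 1 else 0)
    have he : ∀ u, e u = c u s := by
      intro u; ext i; simp only [e, c, Equiv.coe_addRight, Pi.add_apply]; split_ifs <;> simp
    refine Finset.card_bij (fun u _ => e u) (fun u hu => by simpa [he] using hu)
      (fun _ _ _ _ h => e.injective h) (fun v hv => ⟨e.symm v, ?_, by simp⟩)
    simp [← he, hv]
  calc #A * 2 ^ k = ∑ s : Finset (Fin k), #{u : Fin k → Fin p | c u s ∈ A} := by
        simp [hbij, mul_comm]
    _ = ∑ u : Fin k → Fin p, #{s : Finset (Fin k) | c u s ∈ A} := by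
        simp only [Finset.card_filter]
        exact Finset.sum_comm
    _ ≤ ∑ u : Fin k → Fin p, k.choose (k / 2) := Finset.sum_le_sum fun u _ => key u
    _ = _ := by simp

theorem IsAntichain.card_sq_mul_le {p k : ℕ} (hp : 2 ≤ p) (A : Finset (Fin k → Fin p))
    (hA : IsAntichain (· ≤ ·) (A : Set (Fin k → Fin p))) :
    A.card ^ 2 * (k + 1) ≤ (p ^ k) ^ 2 := by
  have h1 := hA.card_mul_two_pow_le hp
  have h2 := choose_half_sq_mul_le k
  have h3 : 4 ^ k * (A.card ^ 2 * (k + 1)) ≤ 4 ^ k * (p ^ k) ^ 2 := by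
    calc 4 ^ k * (A.card ^ 2 * (k + 1)) = (A.card * 2 ^ k) ^ 2 * (k + 1) := by
          rw [show (4 : ℕ) = 2 ^ 2 by norm_num, ← pow_mul]; ring
      _ ≤ (p ^ k * k.choose (k / 2)) ^ 2 * (k + 1) := by gcongr
      _ = (p ^ k) ^ 2 * ((k.choose (k / 2)) ^ 2 * (k + 1)) := by ring
      _ ≤ (p ^ k) ^ 2 * 4 ^ k := by gcongr
      _ = _ := by ring
  exact Nat.le_of_mul_le_mul_left h3 (by positivity)

/-- A submodule of functions on a `P`-set which is stable under all translations. -/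
def TransInv (P : Type*) {Ω F : Type*} [Group P] [MulAction P Ω] [Field F]
    (M : Submodule F (Ω → F)) : Prop :=
  ∀ g : P, ∀ f ∈ M, (fun ω => f (g • ω)) ∈ M

/-- All the differences `g f - f` with `f ∈ M` lie in `N`. -/
def TransDiffLe (P : Type*) {Ω F : Type*} [Group P] [MulAction P Ω] [Field F]
    (M N : Submodule F (Ω → F)) : Prop :=
  ∀ g : P, ∀ f ∈ M, (fun ω => f (g • ω) - f ω) ∈ N

section Layers

variable {Ω F : Type*} [Field F]

/-- The difference operator `f ↦ f ∘ z - f`. -/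
def diffOp (F : Type*) [Field F] (z : Equiv.Perm Ω) : (Ω → F) →ₗ[F] (Ω → F) :=
  LinearMap.funLeft F F z - LinearMap.id

theorem diffOp_apply (z : Equiv.Perm Ω) (f : Ω → F) (ω : Ω) :
    diffOp F z f ω = f (z ω) - f ω := rfl

theorem diffOp_pow_prime_eq_zero {p : ℕ} [Fact p.Prime] [CharP F p] (z : Equiv.Perm Ω)
    (hz : z ^ p = 1) : (diffOp F z) ^ p = 0 := by
  have hinj : Function.Injective (algebraMap F (Module.End F (Ω → F))) ∨ IsEmpty Ω := by
    rcases isEmpty_or_nonempty Ω with h | h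
    · exact Or.inr h
    · exact Or.inl (FaithfulSMul.algebraMap_injective F _)
  rcases hinj with hinj | hE
  · have : CharP (Module.End F (Ω → F)) p := charP_of_injective_algebraMap hinj p
    have h1 : diffOp F z = LinearMap.funLeft F F z - 1 := rfl
    have hp : ∀ n : ℕ, (LinearMap.funLeft F F z : Module.End F (Ω → F)) ^ n
        = LinearMap.funLeft F F (z ^ n : Equiv.Perm Ω) := by
      intro n
      induction n with
      | zero => rfl
      | succ n ih => rw [pow_succ, ih, pow_succ']; rfl
    rw [h1, sub_pow_char_of_commute p (Commute.one_right _), one_pow, hp, hz]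
    ext f ω; simp
  · apply LinearMap.ext; intro f; ext ω; exact hE.elim ω

/-- The layers of a submodule with respect to the kernel filtration of `diffOp`. -/
def layer (z : Equiv.Perm Ω) (M : Submodule F (Ω → F)) (i : ℕ) :
    Submodule F (Quotient (Equiv.Perm.SameCycle.setoid z) → F) :=
  ((M ⊓ LinearMap.ker (diffOp F z ^ (i + 1))).map (diffOp F z ^ i)).comap
    (LinearMap.funLeft F F (Quotient.mk (Equiv.Perm.SameCycle.setoid z)))

theorem mem_layer {z : Equiv.Perm Ω} {M : Submodule F (Ω → F)} {i : ℕ}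
    {f : Quotient (Equiv.Perm.SameCycle.setoid z) → F} :
    f ∈ layer z M i ↔ ∃ m ∈ M, (diffOp F z ^ i) m = fun ω => f (Quotient.mk _ ω) := by
  constructor
  · rintro ⟨m, ⟨hm, -⟩, h⟩
    exact ⟨m, hm, h⟩
  · rintro ⟨m, hm, h⟩
    refine ⟨m, ⟨hm, ?_⟩, h⟩
    rw [SetLike.mem_coe, LinearMap.mem_ker, pow_succ', Module.End.mul_apply, h]
    ext ω
    rw [diffOp_apply, Pi.zero_apply, sub_eq_zero]
    congr 1
    apply Quotient.sound
    exact (Equiv.Perm.sameCycle_apply_left.2 (Equiv.Perm.SameCycle.refl _ _))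

theorem layer_mono {z : Equiv.Perm Ω} {M N : Submodule F (Ω → F)} (h : M ≤ N) (i : ℕ) :
    layer z M i ≤ layer z N i := by
  intro f hf
  rw [mem_layer] at hf ⊢
  obtain ⟨m, hm, e⟩ := hf
  exact ⟨m, h hm, e⟩

theorem layer_succ_le {z : Equiv.Perm Ω} {M N : Submodule F (Ω → F)}
    (h : ∀ f ∈ M, diffOp F z f ∈ N) (i : ℕ) : layer z M (i + 1) ≤ layer z N i := by
  intro f hf
  rw [mem_layer] at hf ⊢
  obtain ⟨m, hm, e⟩ := hf
  exact ⟨_, h m hm, by rw [← e, pow_succ, Module.End.mul_apply]⟩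

theorem layer_antitone {z : Equiv.Perm Ω} {M : Submodule F (Ω → F)}
    (h : ∀ f ∈ M, diffOp F z f ∈ M) : Antitone (layer z M) :=
  antitone_nat_of_succ_le fun i => layer_succ_le h i

theorem finrank_layer [Finite Ω] (z : Equiv.Perm Ω) (M : Submodule F (Ω → F)) (i : ℕ) :
    finrank F (layer z M i) + finrank F (M ⊓ LinearMap.ker (diffOp F z ^ i) : Submodule F _)
      = finrank F (M ⊓ LinearMap.ker (diffOp F z ^ (i + 1)) : Submodule F _) := by
  set A := M ⊓ LinearMap.ker (diffOp F z ^ (i + 1)) with hA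
  have hinj : Function.Injective (LinearMap.funLeft F F
      (Quotient.mk (Equiv.Perm.SameCycle.setoid z))) :=
    LinearMap.funLeft_injective_of_surjective _ _ _ Quotient.mk_surjective
  have h1 : (layer z M i).map (LinearMap.funLeft F F
      (Quotient.mk (Equiv.Perm.SameCycle.setoid z))) = A.map (diffOp F z ^ i) := by
    apply Submodule.map_comap_eq_self
    rintro _ ⟨m, ⟨-, hm⟩, rfl⟩
    rw [SetLike.mem_coe, LinearMap.mem_ker, pow_succ', Module.End.mul_apply] at hm
    have hz : ∀ ω, ((diffOp F z ^ i) m) (z ω) = ((diffOp F z ^ i) m) ω := fun ω => by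
      have := congrFun hm ω
      rwa [diffOp_apply, Pi.zero_apply, sub_eq_zero] at this
    generalize (diffOp F z ^ i) m = f at hz
    have hzn : ∀ (n : ℕ) ω, f ((z ^ n) ω) = f ω := by
      intro n
      induction n with
      | zero => simp
      | succ n ih => intro ω; rw [pow_succ, Equiv.Perm.mul_apply, ih, hz]
    refine ⟨Quotient.lift f ?_, ?_⟩
    · rintro a b ⟨j, hj⟩
      obtain ⟨n, rfl | rfl⟩ := j.eq_nat_or_neg
      · rw [← hj]; exact (hzn n a).symm
      · rw [← hj, ← hzn n ((z ^ (-(n : ℤ))) a)]; simp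
    · ext ω; rfl
  have h2 : finrank F (layer z M i) = finrank F (A.map (diffOp F z ^ i)) := by
    rw [← h1]
    exact (Submodule.equivMapOfInjective _ hinj _).finrank_eq
  rw [h2]
  have h3 := LinearMap.finrank_range_add_finrank_ker ((diffOp F z ^ i).domRestrict A)
  rw [LinearMap.range_domRestrict] at h3
  rw [← h3]
  congr 1
  have : (LinearMap.ker ((diffOp F z ^ i).domRestrict A)).map A.subtype
      = M ⊓ LinearMap.ker (diffOp F z ^ i) := by
    ext f
    simp only [Submodule.mem_map, LinearMap.mem_ker, LinearMap.domRestrict_apply,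
      Submodule.subtype_apply, Subtype.exists, exists_and_right, exists_eq_right, hA,
      Submodule.mem_inf]
    constructor
    · rintro ⟨⟨h, -⟩, h'⟩; exact ⟨h, h'⟩
    · rintro ⟨h, h'⟩
      exact ⟨⟨h, by rw [pow_succ', Module.End.mul_apply, h', map_zero]⟩, h'⟩
  rw [← this]
  exact (Submodule.equivMapOfInjective _ A.injective_subtype _).finrank_eq.symm

theorem sum_finrank_layer [Finite Ω] (z : Equiv.Perm Ω) (M : Submodule F (Ω → F)) (i : ℕ) :
    ∑ j ∈ Finset.range i, finrank F (layer z M j)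
      = finrank F (M ⊓ LinearMap.ker (diffOp F z ^ i) : Submodule F _) := by
  induction i with
  | zero =>
    have : LinearMap.ker (1 : Module.End F (Ω → F)) = ⊥ := LinearMap.ker_id
    rw [pow_zero, this, inf_bot_eq, finrank_bot, Finset.sum_range_zero]
  | succ i ih => rw [Finset.sum_range_succ, ih, ← finrank_layer, add_comm]

end Layers

theorem exists_perm_central_order_prime {p : ℕ} [hp : Fact p.Prime] {P Ω : Type*} [Group P]
    [MulAction P Ω] [Finite Ω] [MulAction.IsPretransitive P Ω] (hP : IsPGroup p P)
    (hΩ : 1 < Nat.card Ω) :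
    ∃ z : Equiv.Perm Ω, (∃ g : P, z = MulAction.toPerm g) ∧ z ^ p = 1 ∧
      (∀ (g : P) (ω : Ω), z (g • ω) = g • z ω) ∧
      ∀ (ω : Ω) (j : ℕ), 0 < j → j < p → (z ^ j) ω ≠ ω := by
  let R := (MulAction.toPermHom P Ω).range
  have hR : IsPGroup p R := hP.of_surjective _ (MulAction.toPermHom P Ω).rangeRestrict_surjective
  have hRfin : Finite R := inferInstance
  have : Nontrivial R := by
    have := (Nat.card_pos_iff.1 (by omega : 0 < Nat.card Ω)).1
    have : Nontrivial Ω := (Finite.one_lt_card_iff_nontrivial).1 hΩ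
    obtain ⟨a, b, hab⟩ := exists_pair_ne Ω
    obtain ⟨g, hg⟩ := MulAction.exists_smul_eq P a b
    refine ⟨1, ⟨MulAction.toPermHom P Ω g, ⟨g, rfl⟩⟩, fun h => hab ?_⟩
    have h2 := congrArg (fun x : R => (x : Equiv.Perm Ω) a) h
    simpa [hg] using h2
  have hc := hR.center_nontrivial
  have hcp : IsPGroup p (Subgroup.center R) := hR.to_subgroup _
  obtain ⟨n, hn0, hn⟩ := (hcp.nontrivial_iff_card).1 hc
  obtain ⟨y, hy⟩ := exists_prime_orderOf_dvd_card' (G := Subgroup.center R) p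
    (by rw [hn]; exact dvd_pow_self _ hn0.ne')
  obtain ⟨⟨z, ⟨g, hg⟩⟩, hyc⟩ := y
  have hord : orderOf z = p := by
    rw [← hy, ← Subgroup.orderOf_coe, ← Subgroup.orderOf_coe]
  have hcomm : ∀ (g : P) (ω : Ω), z (g • ω) = g • z ω := by
    intro h ω
    have := Subgroup.mem_center_iff.1 hyc ⟨MulAction.toPermHom P Ω h, ⟨h, rfl⟩⟩
    have h2 := congrArg (fun x : R => (x : Equiv.Perm Ω) ω) this
    simpa using h2.symm
  refine ⟨z, ⟨g, hg.symm⟩, by rw [← hord]; exact pow_orderOf_eq_one z, hcomm, ?_⟩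
  intro ω j hj hjp hfix
  have hcommj : ∀ (j : ℕ) (g : P) (ω : Ω), (z ^ j) (g • ω) = g • (z ^ j) ω := by
    intro j
    induction j with
    | zero => simp
    | succ j ih => intro g ω; rw [pow_succ, Equiv.Perm.mul_apply, hcomm, ih]; rfl
  have : z ^ j = 1 := by
    ext ω'
    obtain ⟨h, rfl⟩ := MulAction.exists_smul_eq P ω ω'
    rw [hcommj, hfix]; rfl
  have := orderOf_dvd_of_pow_eq_one this
  rw [hord] at this
  exact absurd (Nat.le_of_dvd hj this) (by omega)

theorem card_quotient_sameCycle {p : ℕ} [hp : Fact p.Prime] {Ω : Type*} [Finite Ω]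
    (z : Equiv.Perm Ω) (hz : z ^ p = 1)
    (hfree : ∀ (ω : Ω) (j : ℕ), 0 < j → j < p → (z ^ j) ω ≠ ω) :
    Nat.card Ω = p * Nat.card (Quotient (Equiv.Perm.SameCycle.setoid z)) := by
  classical
  have := Fintype.ofFinite Ω
  have hpp := hp.out.pos
  have hper : ∀ n : ℕ, z ^ n = z ^ (n % p) := fun n => by
    conv_lhs => rw [← Nat.div_add_mod n p, pow_add, pow_mul, hz, one_pow, one_mul]
  have hinj : ∀ ω (i j : Fin p), (z ^ (i : ℕ)) ω = (z ^ (j : ℕ)) ω → i ≤ j → i = j := by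
    intro ω i j h hij
    by_contra hne
    have hlt : (i : ℕ) < j := lt_of_le_of_ne hij fun h => hne (Fin.ext h)
    have h2 : (z ^ ((j : ℕ) - i)) ((z ^ (i : ℕ)) ω) = (z ^ (i : ℕ)) ω := by
      rw [← Equiv.Perm.mul_apply, ← pow_add, Nat.sub_add_cancel hlt.le, h]
    exact hfree _ _ (by omega) (by have := j.2; omega) h2
  let f : Quotient (Equiv.Perm.SameCycle.setoid z) × Fin p → Ω := fun x => (z ^ (x.2 : ℕ)) x.1.out
  have hmk : ∀ x, (Quotient.mk _ (f x) : Quotient (Equiv.Perm.SameCycle.setoid z)) = x.1 := by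
    rintro ⟨c, i⟩
    conv_rhs => rw [← Quotient.out_eq c]
    exact Quotient.sound (Equiv.Perm.sameCycle_pow_left.2 (Equiv.Perm.SameCycle.refl _ _))
  have hf : Function.Bijective f := by
    constructor
    · rintro ⟨c, i⟩ ⟨d, j⟩ h
      have hcd : c = d := (hmk (c, i)).symm.trans ((congrArg (Quotient.mk _) h).trans (hmk (d, j)))
      subst hcd
      have h' : (z ^ (i : ℕ)) c.out = (z ^ (j : ℕ)) c.out := h
      rcases le_total i j with hij | hij
      · rw [hinj _ _ _ h' hij]
      · rw [hinj _ _ _ h'.symm hij]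
    · intro ω
      have : Equiv.Perm.SameCycle z (Quotient.mk (Equiv.Perm.SameCycle.setoid z) ω).out ω :=
        Quotient.exact (s := Equiv.Perm.SameCycle.setoid z) (Quotient.out_eq _)
      obtain ⟨n, hn⟩ := this.exists_nat_pow_eq
      exact ⟨(_, ⟨n % p, Nat.mod_lt _ hpp⟩), by simp only [f]; rw [← hper, hn]⟩
  rw [← Nat.card_congr (Equiv.ofBijective f hf), Nat.card_prod, Nat.card_fin, mul_comm]

theorem exists_downset_family {p : ℕ} [hp : Fact p.Prime] {P : Type*} [Group P]
    (hP : IsPGroup p P) (k : ℕ) :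
    ∀ (Ω : Type*) [Finite Ω] [MulAction P Ω] [MulAction.IsPretransitive P Ω],
      Nat.card Ω = p ^ k →
      ∃ J : Submodule (ZMod p) (Ω → ZMod p) → Finset (Fin k → Fin p),
        (∀ M, TransInv P M → (J M).card = finrank (ZMod p) M) ∧
        (∀ M N, TransInv P M → TransInv P N → M ≤ N → J M ⊆ J N) ∧
        (∀ M N, TransInv P M → TransInv P N → TransDiffLe P M N →
          ∀ e ∈ J M, ∀ e' < e, e' ∈ J N) := by
  classical
  induction k with
  | zero =>
    intro Ω _ _ _ hΩ
    rw [pow_zero, Nat.card_eq_one_iff_unique] at hΩ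
    obtain ⟨h1, h2⟩ := hΩ
    refine ⟨fun M => if M = ⊥ then ∅ else Finset.univ, ?_, ?_, ?_⟩
    · intro M hM
      dsimp only
      split_ifs with h
      · rw [h]; simp
      · have hf : finrank (ZMod p) (Ω → ZMod p) = 1 := by
          have := Fintype.ofFinite Ω
          rw [Module.finrank_fintype_fun_eq_card]
          exact Fintype.card_eq_one_iff_nonempty_unique.2 ⟨⟨⟨h2.some⟩, fun a => Subsingleton.elim _ _⟩⟩
        have hle := Submodule.finrank_le M
        have hpos : 0 < finrank (ZMod p) M := by
          rw [Module.finrank_pos_iff]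
          exact Submodule.nontrivial_iff_ne_bot.2 h
        rw [hf] at hle
        rw [show finrank (ZMod p) M = 1 by omega]
        simp
    · intro M N _ _ h
      dsimp only
      split_ifs with h3 h4 h4
      · simp
      · simp
      · exact absurd (le_bot_iff.1 (h4 ▸ h)) h3
      · simp
    · intro M N _ _ _ e _ e' h
      exact absurd (Subsingleton.elim e' e) h.ne
  | succ k ih =>
    intro Ω _ _ _ hΩ
    have h1 : 1 < Nat.card Ω := by rw [hΩ]; exact Nat.one_lt_pow (by omega) hp.out.one_lt
    obtain ⟨z, ⟨g0, hg0⟩, hzp, hcomm, hfree⟩ := exists_perm_central_order_prime (p := p) (Ω := Ω) hP h1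
    have hcard := card_quotient_sameCycle z hzp hfree
    let Q := Quotient (Equiv.Perm.SameCycle.setoid z)
    have hcommz : ∀ (j : ℤ) (g : P) (ω : Ω), (z ^ j) (g • ω) = g • (z ^ j) ω := by
      intro j g ω
      have : Commute z (MulAction.toPerm g) := by
        ext ω; exact hcomm g ω
      exact congrArg (fun x : Equiv.Perm Ω => x ω) (this.zpow_left j).eq
    let act : MulAction P Q :=
      { smul := fun g => Quotient.map (fun ω => g • ω) (by
          rintro a b ⟨j, hj⟩
          exact ⟨j, by rw [hcommz, hj]⟩)
        one_smul := by rintro ⟨ω⟩; exact congrArg (Quotient.mk _) (one_smul P ω)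
        mul_smul := by rintro g h ⟨ω⟩; exact congrArg (Quotient.mk _) (mul_smul g h ω) }
    have hsmul : ∀ (g : P) (ω : Ω), (Quotient.mk _ (g • ω) : Q) = g • (Quotient.mk _ ω : Q) :=
      fun g ω => rfl
    have htr : MulAction.IsPretransitive P Q := by
      refine ⟨?_⟩
      rintro ⟨a⟩ ⟨b⟩
      obtain ⟨g, rfl⟩ := MulAction.exists_smul_eq P a b
      exact ⟨g, rfl⟩
    obtain ⟨J, hJ1, hJ2, hJ3⟩ := ih Q (by
      rw [hΩ, pow_succ'] at hcard
      exact (Nat.eq_of_mul_eq_mul_left hp.out.pos hcard).symm)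
    have hdiffcomm : ∀ (i : ℕ) (g : P) (f : Ω → ZMod p),
        (diffOp (ZMod p) z ^ i) (fun ω => f (g • ω)) = fun ω => (diffOp (ZMod p) z ^ i) f (g • ω) := by
      intro i
      induction i with
      | zero => intro g f; rfl
      | succ i ih =>
        intro g f
        rw [pow_succ, Module.End.mul_apply, Module.End.mul_apply, ← ih]
        congr 1
        ext ω
        simp only [diffOp_apply, hcomm]
    have hinv : ∀ M : Submodule (ZMod p) (Ω → ZMod p), TransInv P M → ∀ i, TransInv P (layer z M i) := by
      intro M hM i g f hf
      rw [mem_layer] at hf ⊢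
      obtain ⟨m, hm, e⟩ := hf
      refine ⟨_, hM g m hm, ?_⟩
      rw [hdiffcomm, e]
      rfl
    have hdiff : ∀ M N : Submodule (ZMod p) (Ω → ZMod p), TransDiffLe P M N →
        ∀ i, TransDiffLe P (layer z M i) (layer z N i) := by
      intro M N h i g f hf
      rw [mem_layer] at hf ⊢
      obtain ⟨m, hm, e⟩ := hf
      refine ⟨_, h g m hm, ?_⟩
      have : (fun ω => m (g • ω) - m ω) = (fun ω => m (g • ω)) - m := rfl
      rw [this, map_sub, hdiffcomm, e]
      rfl
    have hself : ∀ M : Submodule (ZMod p) (Ω → ZMod p), TransInv P M → TransDiffLe P M M :=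
      fun M hM g f hf => M.sub_mem (hM g f hf) hf
    have hz : ∀ M N : Submodule (ZMod p) (Ω → ZMod p), TransDiffLe P M N →
        ∀ f ∈ M, diffOp (ZMod p) z f ∈ N := by
      intro M N h f hf
      have := h g0 f hf
      convert this using 1
      ext ω
      rw [diffOp_apply, hg0]; rfl
    refine ⟨fun M => Finset.univ.filter fun e => Fin.tail e ∈ J (layer z M (e 0)), ?_, ?_, ?_⟩
    · intro M hM
      have e1 : (Finset.univ.filter fun e : Fin (k + 1) → Fin p => Fin.tail e ∈ J (layer z M (e 0))).card
          = ∑ i : Fin p, (J (layer z M i)).card := by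
        rw [← Finset.card_sigma]
        refine Finset.card_bij (fun e _ => ⟨e 0, Fin.tail e⟩) ?_ ?_ ?_
        · intro e he; simpa using he
        · intro e _ e' _ h
          simp only [Sigma.mk.injEq, heq_eq_eq] at h
          rw [← Fin.cons_self_tail e, ← Fin.cons_self_tail e', h.1, h.2]
        · rintro ⟨i, u⟩ h
          refine ⟨Fin.cons i u, by simpa using h, by simp⟩
      rw [e1]
      have e2 := sum_finrank_layer z M p
      rw [diffOp_pow_prime_eq_zero z hzp, LinearMap.ker_zero, inf_top_eq] at e2
      rw [← e2, Finset.sum_range]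
      exact Finset.sum_congr rfl fun i _ => hJ1 _ (hinv M hM i)
    · intro M N hM hN h e he
      simp only [Finset.mem_filter, Finset.mem_univ, true_and] at he ⊢
      exact hJ2 _ _ (hinv M hM _) (hinv N hN _) (layer_mono h _) he
    · intro M N hM hN h e he e' hlt
      simp only [Finset.mem_filter, Finset.mem_univ, true_and] at he ⊢
      have hle : e' ≤ e := hlt.le
      have htail : Fin.tail e' ≤ Fin.tail e := fun i => hle _
      rcases (hle 0).lt_or_eq with h0 | h0
      · have h4 : layer z M (e 0) ≤ layer z N (e' 0) :=
          (layer_antitone (hz _ _ (hself M hM)) (Nat.succ_le_of_lt h0)).trans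
            (layer_succ_le (hz _ _ h) _)
        have h5 := hJ2 _ _ (hinv M hM _) (hinv N hN _) h4 he
        rcases htail.lt_or_eq with h6 | h6
        · exact hJ3 _ _ (hinv N hN _) (hinv N hN _) (hdiff N N (hself N hN) _) _ h5 _ h6
        · rwa [h6]
      · have h6 : Fin.tail e' < Fin.tail e := by
          refine lt_of_le_of_ne htail fun h6 => hlt.ne ?_
          rw [← Fin.cons_self_tail e, ← Fin.cons_self_tail e', h0, h6]
        rw [h0]
        exact hJ3 _ _ (hinv M hM _) (hinv N hN _) (hdiff M N h _) _ he _ h6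

/-- A submodule which is invariant under a representation. -/
def InvSub {P F V : Type*} [Group P] [Field F] [AddCommGroup V] [Module F V]
    (ρ : Representation F P V) (W : Submodule F V) : Prop :=
  ∀ g, ∀ v ∈ W, ρ g v ∈ W

theorem InvSub.inf {P F V : Type*} [Group P] [Field F] [AddCommGroup V] [Module F V]
    {ρ : Representation F P V} {W W' : Submodule F V} (h : InvSub ρ W) (h' : InvSub ρ W') :
    InvSub ρ (W ⊓ W') := fun g v hv => ⟨h g v hv.1, h' g v hv.2⟩

theorem exists_invariant_functional {p : ℕ} [hp : Fact p.Prime] {P V : Type*} [Group P]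
    [Finite P] [AddCommGroup V] [Module (ZMod p) V] [Finite V] (hP : IsPGroup p P)
    (ρ : Representation (ZMod p) P V) {M W : Submodule (ZMod p) V} (hM : InvSub ρ M)
    (hW : InvSub ρ W) (hMW : ¬ M ≤ W) :
    ∃ φ : V →ₗ[ZMod p] ZMod p, (∃ m ∈ M, φ m ≠ 0) ∧ (∀ m ∈ M, m ∈ W → φ m = 0) ∧
      ∀ g, ∀ m ∈ M, φ (ρ g m) = φ m := by
  let A : Submodule (ZMod p) (Dual (ZMod p) M) := (W.comap M.subtype).dualAnnihilator
  have hA : A ≠ ⊥ := by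
    intro h
    have : W.comap M.subtype = ⊤ := by
      have h2 := congrArg Submodule.dualCoannihilator h
      rwa [Subspace.dualAnnihilator_dualCoannihilator_eq, Submodule.dualCoannihilator_bot] at h2
    exact hMW fun m hm => by
      have : (⟨m, hm⟩ : M) ∈ W.comap M.subtype := by rw [this]; trivial
      exact this
  have hAmem : ∀ f : Dual (ZMod p) M, f ∈ A ↔ ∀ m (hm : m ∈ M), m ∈ W → f ⟨m, hm⟩ = 0 := by
    intro f
    rw [Submodule.mem_dualAnnihilator]
    exact ⟨fun h m hm hw => h _ hw, fun h m hw => h m.1 m.2 hw⟩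
  let r : P → M →ₗ[ZMod p] M := fun g => (ρ g).restrict (hM g)
  have hr1 : r 1 = LinearMap.id := by
    ext m; simp [r]
  have hrm : ∀ g h, r (g * h) = (r g).comp (r h) := by
    intro g h; ext m; simp [r]
  let act : MulAction P A :=
    { smul := fun g f => ⟨f.1.comp (r g⁻¹), by
        rw [hAmem]
        intro m hm hw
        exact (hAmem _).1 f.2 _ (hM _ _ hm) (hW _ _ hw)⟩
      one_smul := fun f => by
        apply Subtype.ext
        change f.1.comp (r 1⁻¹) = f.1
        rw [inv_one, hr1, LinearMap.comp_id]
      mul_smul := fun g h f => by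
        apply Subtype.ext
        change f.1.comp (r (g * h)⁻¹) = (f.1.comp (r h⁻¹)).comp (r g⁻¹)
        rw [mul_inv_rev, hrm, LinearMap.comp_assoc] }
  have hact : ∀ (g : P) (f : A), (g • f).1 = f.1.comp (r g⁻¹) := fun _ _ => rfl
  have : Finite A := Module.finite_of_finite (ZMod p)
  have hdvd : p ∣ Nat.card A := by
    rw [Module.natCard_eq_pow_finrank (K := ZMod p), Nat.card_zmod]
    apply dvd_pow_self
    have := Submodule.nontrivial_iff_ne_bot.2 hA
    exact (Module.finrank_pos (R := ZMod p) (M := A)).ne'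
  obtain ⟨f, hf, hf0⟩ := hP.exists_fixed_point_of_prime_dvd_card_of_fixed_point A hdvd
    (a := 0) (by
      intro g
      apply Subtype.ext
      rw [hact]
      exact LinearMap.zero_comp _)
  obtain ⟨φ, hφ⟩ := LinearMap.exists_extend f.1
  have hφ' : ∀ m (hm : m ∈ M), φ m = f.1 ⟨m, hm⟩ := fun m hm => by rw [← hφ]; rfl
  refine ⟨φ, ?_, ?_, ?_⟩
  · by_contra! h
    apply hf0
    apply Subtype.ext
    ext ⟨m, hm⟩
    rw [← hφ' m hm, h m hm]
    rfl
  · intro m hm hw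
    rw [hφ' m hm]
    exact (hAmem _).1 f.2 m hm hw
  · intro g m hm
    rw [hφ' m hm, hφ' _ (hM g m hm)]
    have h1 := (hact g⁻¹ f).symm.trans (congrArg Subtype.val (hf g⁻¹))
    rw [inv_inv] at h1
    exact LinearMap.congr_fun h1 ⟨m, hm⟩

/-- The permutation representation on functions. -/
def permRep (p : ℕ) (P Ω : Type*) [Group P] [MulAction P Ω] :
    Representation (ZMod p) P (Ω → ZMod p) where
  toFun g := LinearMap.funLeft _ _ (fun ω => g⁻¹ • ω)
  map_one' := by ext; simp [LinearMap.funLeft_apply]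
  map_mul' g h := by
    apply LinearMap.ext; intro f; ext ω
    simp [LinearMap.funLeft_apply, mul_smul]

theorem permRep_apply (p : ℕ) {P Ω : Type*} [Group P] [MulAction P Ω] (g : P)
    (f : Ω → ZMod p) : permRep p P Ω g f = fun ω => f (g⁻¹ • ω) := rfl

theorem invSub_permRep_iff {p : ℕ} [Fact p.Prime] {P Ω : Type*} [Group P] [MulAction P Ω]
    {M : Submodule (ZMod p) (Ω → ZMod p)} : InvSub (permRep p P Ω) M ↔ TransInv P M := by
  constructor
  · intro h g f hf
    have := h g⁻¹ f hf
    rwa [permRep_apply, inv_inv] at this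
  · intro h g f hf
    exact h g⁻¹ f hf

theorem exists_generators_permRep {p : ℕ} [hp : Fact p.Prime] {P : Type*} [Group P] [Finite P]
    (hP : IsPGroup p P) {k : ℕ} {Ω : Type*} [Finite Ω] [MulAction P Ω]
    [MulAction.IsPretransitive P Ω] (hΩ : Nat.card Ω = p ^ k)
    {M : Submodule (ZMod p) (Ω → ZMod p)} (hM : InvSub (permRep p P Ω) M) :
    ∃ S : Finset (Ω → ZMod p), (∀ f ∈ S, f ∈ M) ∧ S.card ^ 2 * (k + 1) ≤ (p ^ k) ^ 2 ∧
      ∀ W, InvSub (permRep p P Ω) W → (∀ f ∈ S, f ∈ W) → M ≤ W := by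
  classical
  obtain ⟨J, hJ1, hJ2, hJ3⟩ := exists_downset_family hP k Ω hΩ
  have hMT := invSub_permRep_iff.1 hM
  let B : Set (Ω → ZMod p) := {r | ∃ g : P, ∃ f ∈ M, r = (fun ω => f (g • ω) - f ω)}
  let R : Submodule (ZMod p) (Ω → ZMod p) := Submodule.span _ B
  have hRM : R ≤ M := by
    apply Submodule.span_le.2
    rintro _ ⟨g, f, hf, rfl⟩
    exact M.sub_mem (hMT g f hf) hf
  have hMR : TransDiffLe P M R := fun g f hf => Submodule.subset_span ⟨g, f, hf, rfl⟩
  have hR : TransInv P R := by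
    intro g f hf
    have := R.add_mem (hMR g f (hRM hf)) hf
    convert this using 1
    ext ω; simp
  let A := J M \ J R
  have hA : IsAntichain (· ≤ ·) (A : Set (Fin k → Fin p)) := by
    intro e he e' he' hne hle
    have h1 := (Finset.mem_sdiff.1 (Finset.mem_coe.1 he')).1
    have h2 := (Finset.mem_sdiff.1 (Finset.mem_coe.1 he)).2
    exact h2 (hJ3 M R hMT hR hMR e' h1 e (lt_of_le_of_ne hle hne))
  have hAcard : A.card + finrank (ZMod p) R = finrank (ZMod p) M := by
    rw [← hJ1 _ hR, ← hJ1 _ hMT]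
    exact Finset.card_sdiff_add_card_eq_card (hJ2 _ _ hR hMT hRM)
  have hAb := hA.card_sq_mul_le hp.out.two_le
  -- a basis of a complement of `R` in `M`
  obtain ⟨C, hC⟩ := Submodule.exists_isCompl (R.comap M.subtype)
  have hCf : finrank (ZMod p) C = A.card := by
    have h1 := Submodule.finrank_add_eq_of_isCompl hC
    have h2 : finrank (ZMod p) (R.comap M.subtype) = finrank (ZMod p) R :=
      (Submodule.comapSubtypeEquivOfLe hRM).finrank_eq
    omega
  let b := Module.finBasis (ZMod p) C
  let S : Finset (Ω → ZMod p) := Finset.univ.image fun i => ((b i : M) : Ω → ZMod p)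
  have hScard : S.card ≤ A.card := by
    refine Finset.card_image_le.trans ?_
    rw [Finset.card_univ, Fintype.card_fin, hCf]
  refine ⟨S, ?_, le_trans (by gcongr) hAb, ?_⟩
  · intro f hf
    obtain ⟨i, -, rfl⟩ := Finset.mem_image.1 hf
    exact (b i : M).2
  intro W hW hSW
  by_contra hMW
  obtain ⟨φ, ⟨m0, hm0, hne⟩, hφW, hφinv⟩ := exists_invariant_functional hP _ hM hW hMW
  have hφR : R ≤ LinearMap.ker φ := by
    apply Submodule.span_le.2
    rintro _ ⟨g, f, hf, rfl⟩
    have h := hφinv g⁻¹ f hf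
    rw [permRep_apply, inv_inv] at h
    rw [SetLike.mem_coe, LinearMap.mem_ker]
    have h2 : (fun ω => f (g • ω) - f ω) = (fun ω => f (g • ω)) - f := rfl
    rw [h2, map_sub, h, sub_self]
  have hφC : ∀ x : C, φ ((x : M) : Ω → ZMod p) = 0 := by
    intro x
    have : φ ∘ₗ M.subtype ∘ₗ C.subtype = 0 := by
      apply b.ext
      intro i
      have hi : ((b i : M) : Ω → ZMod p) ∈ S := Finset.mem_image_of_mem _ (Finset.mem_univ i)
      exact hφW _ (b i : M).2 (hSW _ hi)
    exact LinearMap.congr_fun this x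
  apply hne
  have : (⟨m0, hm0⟩ : M) ∈ R.comap M.subtype ⊔ C := by rw [hC.sup_eq_top]; trivial
  obtain ⟨x, hx, y, hy, hxy⟩ := Submodule.mem_sup.1 this
  have h3 : m0 = (x : Ω → ZMod p) + y := (congrArg (M.subtype) hxy).symm
  rw [h3, map_add, hφC ⟨y, hy⟩, add_zero]
  exact hφR hx

theorem exists_cyclic_generator_permRep {p : ℕ} [hp : Fact p.Prime] {Q : Type*} [Group Q]
    [Finite Q] (hQ : ¬ p ∣ Nat.card Q) {U : Submodule (ZMod p) (Q → ZMod p)}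
    (hU : InvSub (permRep p Q Q) U) :
    ∃ e ∈ U, ∀ W, InvSub (permRep p Q Q) W → e ∈ W → U ≤ W := by
  classical
  have := Fintype.ofFinite Q
  let ρ := permRep p Q Q
  obtain ⟨π₀, hπ₀⟩ := LinearMap.exists_leftInverse_of_injective U.subtype U.ker_subtype
  have hπ₀' : ∀ u (hu : u ∈ U), π₀ u = ⟨u, hu⟩ := fun u hu => LinearMap.congr_fun hπ₀ ⟨u, hu⟩
  have hc : ((Nat.card Q : ℕ) : ZMod p) ≠ 0 := by
    rwa [Ne, ZMod.natCast_eq_zero_iff]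
  let π : (Q → ZMod p) →ₗ[ZMod p] (Q → ZMod p) :=
    ((Nat.card Q : ℕ) : ZMod p)⁻¹ • ∑ g : Q, (ρ g) ∘ₗ U.subtype ∘ₗ π₀ ∘ₗ (ρ g⁻¹)
  have hπ : ∀ f, π f = ((Nat.card Q : ℕ) : ZMod p)⁻¹ • ∑ g : Q, ρ g (π₀ (ρ g⁻¹ f) : Q → ZMod p) := by
    intro f; simp [π]
  have hinv : ∀ g f, ρ g (ρ g⁻¹ f) = f := fun g f => by
    rw [← Module.End.mul_apply, ← map_mul, mul_inv_cancel, map_one]; rfl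
  have hπU : ∀ f, π f ∈ U := by
    intro f
    rw [hπ]
    exact U.smul_mem _ (U.sum_mem fun g _ => hU g _ (π₀ _).2)
  have hπid : ∀ f ∈ U, π f = f := by
    intro f hf
    rw [hπ]
    have : ∀ g : Q, ρ g (π₀ (ρ g⁻¹ f) : Q → ZMod p) = f := by
      intro g
      rw [hπ₀' _ (hU _ _ hf)]
      exact hinv g f
    simp only [this, Finset.sum_const, Finset.card_univ]
    rw [← Nat.card_eq_fintype_card, ← Nat.cast_smul_eq_nsmul (ZMod p), smul_smul,
      inv_mul_cancel₀ hc, one_smul]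
  have hπeq : ∀ h f, π (ρ h f) = ρ h (π f) := by
    intro h f
    rw [hπ, hπ, map_smul, map_sum]
    congr 1
    refine Fintype.sum_equiv (Equiv.mulLeft h⁻¹) _ _ fun g => ?_
    rw [← Module.End.mul_apply (ρ h), ← map_mul, Equiv.coe_mulLeft, mul_inv_cancel_left,
      mul_inv_rev, inv_inv, map_mul, Module.End.mul_apply]
  refine ⟨π (Pi.single 1 1), hπU _, fun W hW he u hu => ?_⟩
  have hdec : u = ∑ h : Q, u h • ρ h (Pi.single 1 1) := by
    ext x
    have : ∀ h : Q, (ρ h (Pi.single 1 1)) x = if h = x then 1 else 0 := by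
      intro h
      change (Pi.single 1 1 : Q → ZMod p) (h⁻¹ • x) = _
      rw [Pi.single_apply, smul_eq_mul, inv_mul_eq_one]
    simp [this]
  rw [← hπid u hu, hdec, map_sum]
  refine W.sum_mem fun h _ => ?_
  rw [map_smul, hπeq]
  exact W.smul_mem _ (hW h _ he)

theorem exists_generators_of_map {p : ℕ} [hp : Fact p.Prime] {Q V Ω : Type*} [Group Q]
    [AddCommGroup V] [Module (ZMod p) V] [MulAction Q Ω] (ρ : Representation (ZMod p) Q V)
    {M : Submodule (ZMod p) V} (hM : InvSub ρ M) (Φ : V →ₗ[ZMod p] (Ω → ZMod p))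
    (hΦ : ∀ g, ∀ m ∈ M, Φ (ρ g m) = permRep p Q Ω g (Φ m)) (T : Finset (Ω → ZMod p))
    (hT : ∀ f ∈ T, f ∈ M.map Φ)
    (hgen : ∀ W, InvSub (permRep p Q Ω) W → (∀ f ∈ T, f ∈ W) → M.map Φ ≤ W) :
    ∃ S : Finset V, (∀ v ∈ S, v ∈ M) ∧ S.card ≤ T.card ∧
      ∀ W, InvSub ρ W → (∀ v ∈ S, v ∈ W) → (∀ m ∈ M, Φ m = 0 → m ∈ W) → M ≤ W := by
  classical
  choose! s hs using hT
  refine ⟨T.image s, ?_, Finset.card_image_le, ?_⟩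
  · intro v hv
    obtain ⟨f, hf, rfl⟩ := Finset.mem_image.1 hv
    exact (hs f hf).1
  · intro W hW hSW hker m hm
    have h1 := hgen ((W ⊓ M).map Φ) (by
      rintro g _ ⟨v, hv, rfl⟩
      exact ⟨_, (hW.inf hM) g v hv, hΦ g v hv.2⟩) (fun f hf =>
        ⟨s f, ⟨hSW _ (Finset.mem_image_of_mem _ hf), (hs f hf).1⟩, (hs f hf).2⟩)
    obtain ⟨w, hw, he⟩ := h1 ⟨m, hm, rfl⟩
    have : m - w ∈ W := hker _ (M.sub_mem hm hw.2) (by rw [map_sub, he, sub_self])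
    simpa using W.add_mem this hw.1

theorem exists_generators_family {F V Q I : Type*} [Field F] [Group Q] [AddCommGroup V]
    [Module F V] [FiniteDimensional F V] [Fintype I] [MulAction Q I] (ρ : Representation F Q V)
    (D : I → Submodule F V) (hD : ∀ g i v, v ∈ D i → ρ g v ∈ D (g • i)) (hbot : ⨅ i, D i = ⊥)
    {ω : ℝ}
    (H : ∀ M, InvSub ρ M → ∀ i, ¬ M ≤ D i → ∃ φ : V →ₗ[F] F, (∃ m ∈ M, φ m ≠ 0) ∧
      (∀ m ∈ M, m ∈ D i → φ m = 0) ∧ ∃ S : Finset V, (∀ v ∈ S, v ∈ M) ∧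
        (S.card : ℝ) ≤ ω * Nat.card (MulAction.orbit Q i) ∧
        ∀ W, InvSub ρ W → (∀ v ∈ S, v ∈ W) → (∀ m ∈ M, (∀ g, φ (ρ g m) = 0) → m ∈ W) → M ≤ W)
    (hω : 0 ≤ ω) :
    ∀ (d : ℕ) (M : Submodule F V), InvSub ρ M → finrank F M ≤ d →
      ∃ S : Finset V, (∀ v ∈ S, v ∈ M) ∧
        (S.card : ℝ) ≤ ω * (∑ i, (finrank F M - finrank F (M ⊓ D i : Submodule F V)) : ℕ) ∧
        ∀ W, InvSub ρ W → (∀ v ∈ S, v ∈ W) → M ≤ W := by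
  classical
  intro d
  induction d with
  | zero =>
    intro M hM hd
    have : M = ⊥ := Submodule.finrank_eq_zero.1 (Nat.le_zero.1 hd)
    subst this
    exact ⟨∅, by simp, by simp, fun _ _ _ => bot_le⟩
  | succ d ih =>
    intro M hM hd
    by_cases hall : ∀ i, M ≤ D i
    · have : M = ⊥ := le_bot_iff.1 (hbot ▸ le_iInf hall)
      subst this
      exact ⟨∅, by simp, by simp, fun _ _ _ => bot_le⟩
    push Not at hall
    obtain ⟨i, hi⟩ := hall
    obtain ⟨φ, ⟨m₀, hm₀, hφm⟩, hφD, S₁, hS₁M, hS₁c, hS₁⟩ := H M hM i hi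
    let N : Submodule F V := M ⊓ ⨅ g, LinearMap.ker (φ ∘ₗ ρ g)
    have hNmem : ∀ m, m ∈ N ↔ m ∈ M ∧ ∀ g, φ (ρ g m) = 0 := by
      intro m; simp [N, Submodule.mem_iInf]
    have hN : InvSub ρ N := by
      intro g m hm
      rw [hNmem] at hm ⊢
      refine ⟨hM g m hm.1, fun h => ?_⟩
      rw [← Module.End.mul_apply, ← map_mul]
      exact hm.2 _
    have hNM : N ≤ M := inf_le_left
    have hlt : N < M := by
      refine lt_of_le_of_ne hNM fun h => hφm ?_
      have := ((hNmem m₀).1 (h ▸ hm₀)).2 1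
      simpa using this
    obtain ⟨S₂, hS₂M, hS₂c, hS₂⟩ := ih N hN (by
      have := Submodule.finrank_lt_finrank_of_lt hlt
      omega)
    have hgen : ∀ j, finrank F N + finrank F (M ⊓ D j : Submodule F V)
        = finrank F (N ⊔ (M ⊓ D j) : Submodule F V) + finrank F (N ⊓ D j : Submodule F V) := by
      intro j
      rw [← Submodule.finrank_sup_add_finrank_inf_eq, ← inf_assoc, inf_eq_left.2 hNM]
    have h1 : ∀ j, finrank F N - finrank F (N ⊓ D j : Submodule F V)
        + (if j ∈ MulAction.orbit Q i then 1 else 0)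
        ≤ finrank F M - finrank F (M ⊓ D j : Submodule F V) := by
      intro j
      have hj := hgen j
      have hle : N ⊔ (M ⊓ D j) ≤ M := sup_le hNM inf_le_left
      have e1 := Submodule.finrank_mono hle
      have e2 := Submodule.finrank_mono (inf_le_left : N ⊓ D j ≤ N)
      split_ifs with hji
      · obtain ⟨g, rfl⟩ := hji
        have hlt2 : N ⊔ (M ⊓ D (g • i)) < M := by
          refine lt_of_le_of_ne hle fun h => ?_
          have hker : N ⊔ (M ⊓ D (g • i)) ≤ LinearMap.ker (φ ∘ₗ ρ g⁻¹) := by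
            refine sup_le (fun m hm => ((hNmem m).1 hm).2 _) fun m hm => ?_
            refine hφD _ (hM _ _ hm.1) ?_
            have := hD g⁻¹ _ _ hm.2
            rwa [inv_smul_smul] at this
          have h3 : ρ g m₀ ∈ N ⊔ (M ⊓ D (g • i)) := by rw [h]; exact hM g m₀ hm₀
          have h4 : φ (ρ g⁻¹ (ρ g m₀)) = 0 := hker h3
          rw [← Module.End.mul_apply, ← map_mul, inv_mul_cancel, map_one] at h4
          exact hφm h4
        have e3 := Submodule.finrank_lt_finrank_of_lt hlt2
        beta_reduce at *
        omega
      · omega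
    have h2 := Finset.sum_le_sum fun j (_ : j ∈ Finset.univ) => h1 j
    rw [Finset.sum_add_distrib, Finset.sum_boole] at h2
    have h3 : (Finset.univ.filter fun j => j ∈ MulAction.orbit Q i).card
        = Nat.card (MulAction.orbit Q i) := by
      rw [Nat.card_eq_fintype_card, Fintype.card_subtype]
    rw [Nat.cast_id, h3] at h2
    refine ⟨S₁ ∪ S₂, ?_, ?_, ?_⟩
    · intro v hv
      rcases Finset.mem_union.1 hv with h | h
      · exact hS₁M v h
      · exact hNM (hS₂M v h)
    · have h4 : ((S₁ ∪ S₂).card : ℝ) ≤ S₁.card + S₂.card := by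
        exact_mod_cast Finset.card_union_le _ _
      refine h4.trans ((add_le_add hS₁c hS₂c).trans ?_)
      rw [← mul_add]
      refine mul_le_mul_of_nonneg_left ?_ hω
      rw [add_comm]
      exact_mod_cast h2
    · intro W hW hSW
      refine hS₁ W hW (fun v hv => hSW v (Finset.mem_union_left _ hv)) fun m hm hg => ?_
      exact hS₂ W hW (fun v hv => hSW v (Finset.mem_union_right _ hv)) ((hNmem m).2 ⟨hm, hg⟩)

theorem le_card_orbit_pow {q : ℕ} [hq : Fact q.Prime] {Q I : Type*} [Group Q] [Finite Q]
    (hQ : IsPGroup q Q) [MulAction Q I] [Finite I] {k : ℕ} {i : I}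
    (h : q ^ k ≤ Nat.card (MulAction.orbit Q i)) :
    ∃ k', k ≤ k' ∧ Nat.card (MulAction.orbit Q i) = q ^ k' := by
  obtain ⟨n, hn⟩ := hQ.card_orbit i
  refine ⟨n, ?_, hn⟩
  rw [hn] at h
  exact (Nat.pow_le_pow_iff_right hq.out.one_lt).1 h

theorem exists_top_of_family {F V Q I : Type*} [Field F] [Group Q] [AddCommGroup V]
    [Module F V] [FiniteDimensional F V] [Fintype I] [MulAction Q I] (ρ : Representation F Q V)
    (D : I → Submodule F V) (hD : ∀ g i v, v ∈ D i → ρ g v ∈ D (g • i)) (hbot : ⨅ i, D i = ⊥)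
    {ω : ℝ} (hω : 0 ≤ ω)
    (H : ∀ M, InvSub ρ M → ∀ i, ¬ M ≤ D i → ∃ φ : V →ₗ[F] F, (∃ m ∈ M, φ m ≠ 0) ∧
      (∀ m ∈ M, m ∈ D i → φ m = 0) ∧ ∃ S : Finset V, (∀ v ∈ S, v ∈ M) ∧
        (S.card : ℝ) ≤ ω * Nat.card (MulAction.orbit Q i) ∧
        ∀ W, InvSub ρ W → (∀ v ∈ S, v ∈ W) → (∀ m ∈ M, (∀ g, φ (ρ g m) = 0) → m ∈ W) → M ≤ W) :
    ∃ S : Finset V, (S.card : ℝ) ≤ ω * (∑ i, (finrank F V - finrank F (D i)) : ℕ) ∧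
        ∀ W, InvSub ρ W → (∀ v ∈ S, v ∈ W) → W = ⊤ := by
  obtain ⟨S, -, hS1, hS2⟩ := exists_generators_family ρ D hD hbot H hω _ ⊤
    (fun _ _ _ => trivial) le_rfl
  refine ⟨S, ?_, fun W hW h => top_le_iff.1 (hS2 W hW h)⟩
  have e : ∀ x, finrank F (⊤ ⊓ D x : Submodule F V) = finrank F (D x) :=
    fun x => by rw [top_inf_eq]
  simpa only [finrank_top, e] using hS1

theorem exists_generators_of_coprime {p q : ℕ} [hp : Fact p.Prime] [hq : Fact q.Prime]
    (hpq : p ≠ q) {V Q I : Type*} [Group Q] [Finite Q] (hQ : IsPGroup q Q) [AddCommGroup V]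
    [Module (ZMod p) V] [Finite V] [Fintype I] [MulAction Q I] (ρ : Representation (ZMod p) Q V)
    (D : I → Submodule (ZMod p) V) (hD : ∀ g i v, v ∈ D i → ρ g v ∈ D (g • i))
    (hbot : ⨅ i, D i = ⊥) {k : ℕ} (hk : ∀ i : I, q ^ k ≤ Nat.card (MulAction.orbit Q i)) :
    ∃ S : Finset V, (S.card : ℝ) ≤ (1 / (q ^ k : ℕ)) *
        (∑ i, (finrank (ZMod p) V - finrank (ZMod p) (D i)) : ℕ) ∧
        ∀ W, InvSub ρ W → (∀ v ∈ S, v ∈ W) → W = ⊤ := by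
  classical
  have hqk : (0 : ℝ) < (q ^ k : ℕ) := by exact_mod_cast pow_pos hq.out.pos k
  have hndvd : ¬ p ∣ Nat.card Q := by
    obtain ⟨n, hn⟩ := IsPGroup.iff_card.1 hQ
    rw [hn]
    intro h
    exact hpq ((Nat.prime_dvd_prime_iff_eq hp.out hq.out).1 (hp.out.dvd_of_dvd_pow h))
  refine exists_top_of_family ρ D hD hbot (ω := 1 / (q ^ k : ℕ)) (by positivity) ?_
  · intro M hM i hi
    have hA : (D i).comap M.subtype ≠ ⊤ := fun h => hi fun m hm => by
      have : (⟨m, hm⟩ : M) ∈ (D i).comap M.subtype := by rw [h]; trivial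
      exact this
    obtain ⟨f, hf0, hf⟩ := Submodule.exists_le_ker_of_lt_top _ (lt_top_iff_ne_top.2 hA)
    obtain ⟨φ, hφ⟩ := LinearMap.exists_extend f
    have hφ' : ∀ m (hm : m ∈ M), φ m = f ⟨m, hm⟩ := fun m hm => by rw [← hφ]; rfl
    let Φ : V →ₗ[ZMod p] (Q → ZMod p) := LinearMap.pi fun g => φ ∘ₗ ρ g⁻¹
    have hΦ : ∀ g, ∀ m ∈ M, Φ (ρ g m) = permRep p Q Q g (Φ m) := by
      intro g m _
      ext h
      change φ (ρ h⁻¹ (ρ g m)) = φ (ρ (g⁻¹ * h)⁻¹ m)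
      rw [mul_inv_rev, inv_inv, map_mul, Module.End.mul_apply]
    have hU : InvSub (permRep p Q Q) (M.map Φ) := by
      rintro g _ ⟨m, hm, rfl⟩
      exact ⟨_, hM g m hm, hΦ g m hm⟩
    obtain ⟨e, he, hgen⟩ := exists_cyclic_generator_permRep hndvd hU
    obtain ⟨T, hT1, hT2, hT3⟩ := exists_generators_of_map ρ hM Φ hΦ {e} (by simpa using he)
      (fun W hW h => hgen W hW (h e (by simp)))
    refine ⟨φ, ?_, fun m hm hd => ?_, T, hT1, ?_, fun W hW hTW hker => hT3 W hW hTW ?_⟩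
    · by_contra! h
      apply hf0
      ext ⟨m, hm⟩
      rw [← hφ' m hm, h m hm]; rfl
    · rw [hφ' m hm]
      exact hf (show (⟨m, hm⟩ : M) ∈ (D i).comap M.subtype from hd)
    · have h1 : (T.card : ℝ) ≤ 1 := by exact_mod_cast hT2
      refine h1.trans ?_
      rw [one_div, inv_mul_eq_div, le_div_iff₀ hqk, one_mul]
      exact_mod_cast hk i
    · intro m hm h0
      refine hker m hm fun g => ?_
      have := congrFun h0 g⁻¹
      change φ (ρ g⁻¹⁻¹ m) = 0 at this
      rwa [inv_inv] at this

theorem exists_generators_of_isPGroup {p : ℕ} [hp : Fact p.Prime]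
    {V Q I : Type*} [Group Q] [Finite Q] (hQ : IsPGroup p Q) [AddCommGroup V]
    [Module (ZMod p) V] [Finite V] [Fintype I] [MulAction Q I] (ρ : Representation (ZMod p) Q V)
    (D : I → Submodule (ZMod p) V) (hD : ∀ g i v, v ∈ D i → ρ g v ∈ D (g • i))
    (hbot : ⨅ i, D i = ⊥) {k : ℕ} (hk : ∀ i : I, p ^ k ≤ Nat.card (MulAction.orbit Q i)) :
    ∃ S : Finset V, (S.card : ℝ) ≤ (1 / √(k + 1 : ℝ)) *
        (∑ i, (finrank (ZMod p) V - finrank (ZMod p) (D i)) : ℕ) ∧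
        ∀ W, InvSub ρ W → (∀ v ∈ S, v ∈ W) → W = ⊤ := by
  classical
  refine exists_top_of_family ρ D hD hbot (ω := 1 / √(k + 1 : ℝ)) (by positivity) ?_
  · intro M hM i hi
    let Qi := MulAction.stabilizer Q i
    have hDi : InvSub (ρ.comp Qi.subtype) (D i) := by
      rintro ⟨g, hg⟩ v hv
      have := hD g i v hv
      rwa [show g • i = i from hg] at this
    obtain ⟨φ, hφ0, hφD, hφinv⟩ := exists_invariant_functional (hQ.to_subgroup Qi)
      (ρ.comp Qi.subtype) (M := M) (W := D i) (fun g => hM g) hDi hi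
    have hφinv' : ∀ g, g • i = i → ∀ m ∈ M, φ (ρ g m) = φ m := fun g hg => hφinv ⟨g, hg⟩
    choose s hs using fun j : MulAction.orbit Q i => j.2
    let Φ : V →ₗ[ZMod p] (MulAction.orbit Q i → ZMod p) := LinearMap.pi fun j => φ ∘ₗ ρ (s j)⁻¹
    have hΦ' : ∀ m ∈ M, ∀ g (j : MulAction.orbit Q i), g • i = (j : I) → Φ m j = φ (ρ g⁻¹ m) := by
      intro m hm g j hg
      have h1 := hφinv' ((s j)⁻¹ * g) (by
        rw [mul_smul, hg, inv_smul_eq_iff]; exact (hs j).symm) (ρ g⁻¹ m) (hM _ _ hm)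
      rw [← h1, ← Module.End.mul_apply, ← map_mul, mul_assoc, mul_inv_cancel, mul_one]
      rfl
    have hΦ : ∀ g, ∀ m ∈ M, Φ (ρ g m) = permRep p Q (MulAction.orbit Q i) g (Φ m) := by
      intro g m hm
      ext j
      change φ (ρ (s j)⁻¹ (ρ g m)) = Φ m (g⁻¹ • j)
      rw [hΦ' m hm (g⁻¹ * s j) (g⁻¹ • j) (by
        rw [mul_smul, show s j • i = (j : I) from hs j]; rfl), mul_inv_rev, inv_inv, map_mul,
        Module.End.mul_apply]
    have hU : InvSub (permRep p Q (MulAction.orbit Q i)) (M.map Φ) := by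
      rintro g _ ⟨m, hm, rfl⟩
      exact ⟨_, hM g m hm, hΦ g m hm⟩
    obtain ⟨k', hkk', hcard⟩ := le_card_orbit_pow hQ (hk i)
    obtain ⟨T', hT'1, hT'2, hgen⟩ := exists_generators_permRep hQ hcard hU
    obtain ⟨T, hT1, hT2, hT3⟩ := exists_generators_of_map ρ hM Φ hΦ T' hT'1 hgen
    refine ⟨φ, hφ0, hφD, T, hT1, ?_, fun W hW hTW hker => hT3 W hW hTW ?_⟩
    · rw [hcard, one_div, inv_mul_eq_div, le_div_iff₀ (by positivity)]
      have h1 : T.card ^ 2 * (k + 1) ≤ (p ^ k') ^ 2 := by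
        refine le_trans ?_ hT'2
        gcongr
      have h2 : ((T.card : ℝ)) ^ 2 * (k + 1) ≤ ((p ^ k' : ℕ) : ℝ) ^ 2 := by exact_mod_cast h1
      refine abs_le_of_sq_le_sq' ?_ (by positivity) |>.2
      rw [mul_pow, Real.sq_sqrt (by positivity)]
      exact h2
    · intro m hm h0
      refine hker m hm fun g => ?_
      have := congrFun h0 ⟨g⁻¹ • i, MulAction.mem_orbit _ _⟩
      rw [hΦ' m hm g⁻¹ _ rfl, inv_inv] at this
      exact this

theorem exists_prime_log_le_sq {m : ℕ} (hm : 1 < m) :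
    ∃ q, q.Prime ∧ q ∣ m ∧ Real.log m ≤ ((q ^ m.factorization q : ℕ) : ℝ) ^ 2 := by
  obtain ⟨q, hq, hmax⟩ := m.primeFactors.exists_max_image (fun q => q ^ m.factorization q)
    (Nat.nonempty_primeFactors.2 hm)
  have hqp := Nat.prime_of_mem_primeFactors hq
  refine ⟨q, hqp, Nat.dvd_of_mem_primeFactors hq, ?_⟩
  set X := q ^ m.factorization q with hX
  have hdvd : m ∣ X.factorial := by
    rw [Nat.dvd_iff_prime_pow_dvd_dvd]
    intro r k hr hk
    have hle : r ^ k ≤ X := by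
      rcases Nat.eq_zero_or_pos k with rfl | hk0
      · rw [pow_zero]; exact Nat.one_le_pow _ _ hqp.pos
      have hrm : r ∣ m := (dvd_pow_self r hk0.ne').trans hk
      refine le_trans (Nat.pow_le_pow_right hr.pos ?_)
        (hmax r (Nat.mem_primeFactors.2 ⟨hr, hrm, by omega⟩))
      exact (hr.pow_dvd_iff_le_factorization (by omega)).1 hk
    exact Nat.dvd_factorial (pow_pos hr.pos _) hle
  have h1 : m ≤ X ^ X := (Nat.le_of_dvd X.factorial_pos hdvd).trans (Nat.factorial_le_pow X)
  have hXpos : 0 < X := pow_pos hqp.pos _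
  have h2 : Real.log m ≤ X * Real.log X := by
    rw [← Real.log_pow]
    exact Real.log_le_log (by positivity) (by exact_mod_cast h1)
  have h3 : Real.log X ≤ X := (Real.log_le_self (by positivity))
  nlinarith [h2, h3]

/-- For each prime `p`, the integer `s` is either divisible by a large power of `p`
or exactly divisible by a large power of another prime. -/
theorem factorization_dichotomy {p s : ℕ} (hp : p.Prime) (hs : 2 ≤ s) :
    1 / √(s.factorization p + 1 : ℝ) ≤ 3 * Real.log p / √(Real.log s) ∨
    ∃ q, q.Prime ∧ p ≠ q ∧
      1 / ((q ^ s.factorization q : ℕ) : ℝ) ≤ 3 * Real.log p / √(Real.log s) := by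
  have hl2 : 0.69 < Real.log 2 := by have := Real.log_two_gt_d9; norm_num at this ⊢; linarith
  have hlp : Real.log 2 ≤ Real.log p :=
    Real.log_le_log (by norm_num) (by exact_mod_cast hp.two_le)
  have hls : 0 < Real.log s := Real.log_pos (by exact_mod_cast hs)
  have hsq : 0 < √(Real.log s) := Real.sqrt_pos.2 hls
  have hprod := Nat.ordProj_mul_ordCompl_eq_self s p
  have hproj : 0 < p ^ s.factorization p := pow_pos hp.pos _
  have hcompl : 0 < s / p ^ s.factorization p := Nat.ordCompl_pos p (by omega)
  have hlog : Real.log s = s.factorization p * Real.log p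
      + Real.log (s / p ^ s.factorization p : ℕ) := by
    conv_lhs => rw [← hprod]
    rw [Nat.cast_mul, Real.log_mul (by positivity) (by positivity), Nat.cast_pow, Real.log_pow]
  rcases le_total (Real.log s) (2 * (s.factorization p * Real.log p)) with h | h
  · left
    rw [div_le_div_iff₀ (by positivity) hsq, one_mul]
    refine Real.sqrt_le_iff.2 ⟨by positivity, ?_⟩
    rw [mul_pow, Real.sq_sqrt (by positivity)]
    have h5 : (3 * Real.log p) ^ 2 ≥ 2 * Real.log p := by nlinarith
    nlinarith [Real.log_nonneg (show (1:ℝ) ≤ p by exact_mod_cast hp.one_lt.le)]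
  · right
    have hm : Real.log s ≤ 2 * Real.log (s / p ^ s.factorization p : ℕ) := by linarith
    have hm1 : 1 < s / p ^ s.factorization p := by
      by_contra hle
      have : s / p ^ s.factorization p = 1 := by omega
      rw [this] at hm
      simp at hm
      linarith
    obtain ⟨q, hq, hqm, hqX⟩ := exists_prime_log_le_sq hm1
    have hpq : p ≠ q := by
      rintro rfl
      exact Nat.not_dvd_ordCompl hp (by omega) hqm
    refine ⟨q, hq, hpq, ?_⟩
    have hf : (s / p ^ s.factorization p).factorization q = s.factorization q := by
      rw [Nat.factorization_ordCompl, Finsupp.erase_ne hpq.symm]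
    rw [hf] at hqX
    have hX : (0 : ℝ) < (q ^ s.factorization q : ℕ) := by exact_mod_cast pow_pos hq.pos _
    rw [div_le_div_iff₀ hX hsq, one_mul]
    refine Real.sqrt_le_iff.2 ⟨by positivity, ?_⟩
    rw [mul_pow]
    have h5 : (3 * Real.log p) ^ 2 ≥ 2 := by nlinarith
    nlinarith [sq_nonneg ((q ^ s.factorization q : ℕ) : ℝ)]

/-- If `L` acts transitively on `I` then each orbit of a Sylow `q`-subgroup has length
at least the `q`-part of the cardinality of `I`. -/
theorem ordProj_le_card_orbit_sylow {L I : Type*} [Group L] [Finite L] [MulAction L I] [Finite I]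
    [MulAction.IsPretransitive L I] {q : ℕ} [hq : Fact q.Prime] (P : Sylow q L) (i : I) :
    q ^ (Nat.card I).factorization q ≤ Nat.card (MulAction.orbit P i) := by
  have : Nonempty I := ⟨i⟩
  have h1 : Nat.card L = Nat.card I * Nat.card (MulAction.stabilizer L i) := by
    rw [← MulAction.index_stabilizer_of_transitive L i, mul_comm, Subgroup.card_mul_index]
  have h2 : Nat.card P = Nat.card (MulAction.orbit P i) * Nat.card (MulAction.stabilizer P i) := by
    rw [Nat.card_coe_set_eq, ← MulAction.index_stabilizer P i, mul_comm, Subgroup.card_mul_index]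
  have h3 : Nat.card (MulAction.stabilizer P i) ∣ Nat.card (MulAction.stabilizer L i) := by
    have h4 : (MulAction.stabilizer P i).map (P : Subgroup L).subtype
        ≤ MulAction.stabilizer L i := by
      rintro _ ⟨g, hg, rfl⟩
      exact hg
    have := Subgroup.card_dvd_of_le h4
    rwa [Subgroup.card_map_of_injective (Subgroup.subtype_injective _)] at this
  obtain ⟨b, hb⟩ := IsPGroup.iff_card.1 (P.isPGroup'.to_subgroup (MulAction.stabilizer P i))
  have hl0 : Nat.card (MulAction.stabilizer L i) ≠ 0 := Nat.card_pos.ne'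
  have hI0 : Nat.card I ≠ 0 := Nat.card_pos.ne'
  rw [hb] at h3 h2
  have hbl := (hq.out.pow_dvd_iff_le_factorization hl0).1 h3
  rw [P.card_eq_multiplicity, h1, Nat.factorization_mul hI0 hl0, Finsupp.add_apply] at h2
  refine Nat.le_of_mul_le_mul_right (c := q ^ b) ?_ (pow_pos hq.out.pos b)
  rw [← h2, ← pow_add]
  exact Nat.pow_le_pow_right hq.out.pos (by omega)

/-- Every supplement of `K` can be turned into a supplement of `M` by adjoining at most `m`
elements. -/
def GenBound {G : Type*} [Group G] (K M : Subgroup G) (m : ℝ) : Prop :=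
  ∀ L : Subgroup G, L ⊔ K = ⊤ →
    ∃ S : Finset G, (S.card : ℝ) ≤ m ∧ L ⊔ Subgroup.closure (S : Set G) ⊔ M = ⊤

namespace GenBound

variable {G : Type*} [Group G] {K M N : Subgroup G} {m m' : ℝ}

theorem mono (h : GenBound K M m) (hm : m ≤ m') : GenBound K M m' := fun L hL => by
  obtain ⟨S, h1, h2⟩ := h L hL
  exact ⟨S, h1.trans hm, h2⟩

theorem trans (h : GenBound K M m) (h' : GenBound M N m') : GenBound K N (m + m') := by
  classical
  intro L hL
  obtain ⟨S, h1, h2⟩ := h L hL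
  obtain ⟨T, h3, h4⟩ := h' _ h2
  refine ⟨S ∪ T, ?_, ?_⟩
  · have : ((S ∪ T).card : ℝ) ≤ S.card + T.card := by exact_mod_cast Finset.card_union_le _ _
    linarith
  · rw [Finset.coe_union, Subgroup.closure_union, ← sup_assoc]
    exact h4

theorem of_le (h : K ≤ M) (hm : 0 ≤ m) : GenBound K M m := fun L hL =>
  ⟨∅, by simpa using hm, by
    rw [Finset.coe_empty, Subgroup.closure_empty, sup_bot_eq]
    exact top_le_iff.1 (hL ▸ sup_le_sup_left h L)⟩

theorem of_quotient [N.Normal] (h : GenBound (K.map (QuotientGroup.mk' N)) ⊥ m) :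
    GenBound K N m := by
  classical
  intro L hL
  obtain ⟨S, h1, h2⟩ := h (L.map (QuotientGroup.mk' N)) (by
    rw [← Subgroup.map_sup, hL]
    exact Subgroup.map_top_of_surjective _ (QuotientGroup.mk'_surjective N))
  choose f hf using QuotientGroup.mk'_surjective N
  refine ⟨S.image f, (by exact_mod_cast Finset.card_image_le : ((S.image f).card : ℝ) ≤ S.card).trans h1, ?_⟩
  have h3 : (L ⊔ Subgroup.closure ((S.image f : Finset G) : Set G)).map (QuotientGroup.mk' N) = ⊤ := by
    rw [← h2, sup_bot_eq, Subgroup.map_sup, MonoidHom.map_closure]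
    congr 2
    have hf' : ∀ b : G ⧸ N, (f b : G ⧸ N) = b := hf
    ext x
    simp [hf']
  have h4 := congrArg (Subgroup.comap (QuotientGroup.mk' N)) h3
  rw [Subgroup.comap_map_eq, QuotientGroup.ker_mk', Subgroup.comap_top] at h4
  exact h4

end GenBound

theorem genBound_module_core_bot {G : Type*} [Group G] [Finite G] {p : ℕ}
    [hp : Fact p.Prime] (M D St : Subgroup G) [M.Normal] {V : Type*} [AddCommGroup V]
    [Module (ZMod p) V] (e : V ≃ M) (he : ∀ v w, e (v + w) = e v * e w)
    (hDSt : ∀ g ∈ St, ∀ x ∈ D, g * x * g⁻¹ ∈ D) (hcore : D.normalCore = ⊥) (hMSt : M ≤ St)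
    (hs : 2 ≤ St.index) {a : ℕ} (hidx : D.relIndex M ≤ p ^ a) :
    GenBound M ⊥ (3 * a * Real.log p * St.index / √(Real.log St.index)) := by
  classical
  intro L hL
  have := Fintype.ofFinite (G ⧸ St)
  have : Finite V := Finite.of_equiv _ e.symm
  have he0 : e 0 = 1 := by
    have := he 0 0
    rwa [add_zero, left_eq_mul] at this
  have hneg : ∀ v, e (-v) = (e v)⁻¹ := fun v => by
    rw [eq_inv_iff_mul_eq_one, ← he, neg_add_cancel, he0]
  let c : G → V →+ V := fun g => AddMonoidHom.mk' (fun v => e.symm (MulAut.conjNormal g (e v)))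
    (fun v w => e.injective (by rw [he, e.apply_symm_apply, he, map_mul,
      e.apply_symm_apply, e.apply_symm_apply]))
  have hc : ∀ g (v : V), ((e (c g v) : M) : G) = g * (e v : M) * g⁻¹ := fun g v => by
    rw [← MulAut.conjNormal_apply]
    exact congrArg Subtype.val (e.apply_symm_apply _)
  let DD : G → Submodule (ZMod p) V := fun g => AddSubgroup.toZModSubmodule p
    { carrier := {v | g⁻¹ * ((e v : M) : G) * g ∈ D}
      zero_mem' := by simp [he0, D.one_mem]
      add_mem' := by
        intro v w hv hw
        have := D.mul_mem hv hw
        simp only [Set.mem_ofPred_eq, he, Subgroup.coe_mul]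
        convert this using 1
        group
      neg_mem' := by
        intro v hv
        have := D.inv_mem hv
        simp only [Set.mem_ofPred_eq, hneg, Subgroup.coe_inv]
        convert this using 1
        group }
  have hDD : ∀ (g : G) (v : V), v ∈ DD g ↔ g⁻¹ * ((e v : M) : G) * g ∈ D := fun g v => Iff.rfl
  have hDD' : ∀ g h : G, (g : G ⧸ St) = (h : G ⧸ St) → DD g = DD h := by
    have key : ∀ g h : G, (g : G ⧸ St) = (h : G ⧸ St) → DD g ≤ DD h := by
      intro g h hgh v hv
      rw [hDD] at hv ⊢
      have h1 := hDSt _ (QuotientGroup.eq.1 hgh.symm) _ hv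
      convert h1 using 1
      group
    exact fun g h e => le_antisymm (key g h e) (key h g e.symm)
  let Di : G ⧸ St → Submodule (ZMod p) V := fun i => DD i.out
  have hDi : ∀ g : G, Di g = DD g := fun g => hDD' _ _ (QuotientGroup.out_eq' _)
  have hbot : ⨅ i, Di i = ⊥ := by
    rw [eq_bot_iff]
    intro v hv
    rw [Submodule.mem_iInf] at hv
    have h1 : ((e v : M) : G) ∈ D.normalCore := by
      intro b
      have h2 := hv (b⁻¹ : G)
      rw [hDi, hDD, inv_inv] at h2
      exact h2
    rw [hcore, Subgroup.mem_bot] at h1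
    refine e.injective (Subtype.ext ?_)
    rw [h1, he0]; rfl
  have hcodim : ∀ i, finrank (ZMod p) V - finrank (ZMod p) (Di i) ≤ a := by
    intro i
    have h1 := Module.natCard_eq_pow_finrank (K := ZMod p) (V := V)
    have h2 := Module.natCard_eq_pow_finrank (K := ZMod p) (V := Di i)
    rw [Nat.card_zmod] at h1 h2
    have hle := Submodule.finrank_le (Di i)
    have h3 : Nat.card (Di i) = Nat.card (D.subgroupOf M) := by
      refine Nat.card_congr ⟨fun x => ⟨e (c i.out⁻¹ x.1), ?_⟩,
        fun x => ⟨c i.out (e.symm x.1), ?_⟩, ?_, ?_⟩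
      · rw [Subgroup.mem_subgroupOf, hc, inv_inv]
        exact x.2
      · rw [hDD, hc, e.apply_symm_apply]
        have := x.2
        rw [Subgroup.mem_subgroupOf] at this
        convert this using 1
        group
      · intro x
        refine Subtype.ext (e.injective (Subtype.ext ?_))
        dsimp only
        rw [hc, e.apply_symm_apply, hc]; group
      · intro x
        refine Subtype.ext (Subtype.ext ?_)
        dsimp only
        rw [hc, hc, e.apply_symm_apply]; group
    have h4 : Nat.card M = Nat.card (D.subgroupOf M) * D.relIndex M :=
      (Subgroup.card_mul_index (D.subgroupOf M)).symm
    have h5 : Nat.card V = Nat.card M := Nat.card_congr e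
    rw [h5, h4, ← h3, h2] at h1
    have h6 : p ^ finrank (ZMod p) V ≤ p ^ (finrank (ZMod p) (Di i) + a) := by
      rw [← h1, pow_add]
      exact Nat.mul_le_mul_left _ hidx
    have := (Nat.pow_le_pow_iff_right hp.out.one_lt).1 h6
    omega
  have hcard : Nat.card (G ⧸ St) = St.index := rfl
  have hsum : (∑ i, (finrank (ZMod p) V - finrank (ZMod p) (Di i))) ≤ St.index * a := by
    refine (Finset.sum_le_sum fun i _ => hcodim i).trans ?_
    rw [Finset.sum_const, Finset.card_univ, ← Nat.card_eq_fintype_card, hcard, smul_eq_mul]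
  have htrans : MulAction.IsPretransitive L (G ⧸ St) := by
    have key : ∀ i : G ⧸ St, ∃ l : L, l • ((1 : G) : G ⧸ St) = i := by
      intro i
      obtain ⟨g, rfl⟩ := QuotientGroup.mk_surjective i
      have hg : g ∈ L ⊔ M := hL ▸ Subgroup.mem_top g
      obtain ⟨l, hl, m, hm, rfl⟩ := Subgroup.mem_sup_of_normal_right.1 hg
      refine ⟨⟨l, hl⟩, ?_⟩
      change ((l * 1 : G) : G ⧸ St) = ((l * m : G) : G ⧸ St)
      rw [QuotientGroup.eq]
      simpa using hMSt hm
    refine ⟨fun i j => ?_⟩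
    obtain ⟨l, rfl⟩ := key i
    obtain ⟨l', rfl⟩ := key j
    exact ⟨l' * l⁻¹, by rw [mul_smul, inv_smul_smul]⟩
  have main : ∀ (q : ℕ) (hq : Fact q.Prime) (ω : ℝ), 0 ≤ ω →
      ω ≤ 3 * Real.log p / √(Real.log St.index) →
      (∀ (P : Sylow q L) (ρ : Representation (ZMod p) P V),
        (∀ (g : P) (i : G ⧸ St) (v : V), v ∈ Di i → ρ g v ∈ Di (g • i)) →
        (∀ i : G ⧸ St, q ^ St.index.factorization q ≤ Nat.card (MulAction.orbit P i)) →
        ∃ S : Finset V, (S.card : ℝ) ≤ ω *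
          (∑ i, (finrank (ZMod p) V - finrank (ZMod p) (Di i)) : ℕ) ∧
          ∀ W, InvSub ρ W → (∀ v ∈ S, v ∈ W) → W = ⊤) →
      ∃ S : Finset G, (S.card : ℝ) ≤ 3 * a * Real.log p * St.index / √(Real.log St.index) ∧
        L ⊔ Subgroup.closure (S : Set G) ⊔ ⊥ = ⊤ := by
    intro q hq ω hω0 hω H
    obtain ⟨P⟩ : Nonempty (Sylow q L) := inferInstance
    let ρ : Representation (ZMod p) P V :=
      { toFun := fun x => (c ((x : L) : G)).toZModLinearMap p
        map_one' := by
          ext v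
          refine e.injective (Subtype.ext ?_)
          refine (hc _ _).trans ?_
          simp
        map_mul' := fun g h => by
          apply LinearMap.ext
          intro v
          refine e.injective (Subtype.ext ?_)
          refine (hc _ _).trans ?_
          change _ = ((e (c ((g : L) : G) (c ((h : L) : G) v)) : M) : G)
          rw [hc, hc]
          simp only [Subgroup.coe_mul]
          group }
    have hρ : ∀ (g : P) (v : V), ((e (ρ g v) : M) : G)
        = ((g : L) : G) * (e v : M) * ((g : L) : G)⁻¹ := fun g v => hc _ _
    obtain ⟨S, hS1, hS2⟩ := H P ρ (by
      intro g i v hv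
      obtain ⟨x, rfl⟩ := QuotientGroup.mk_surjective i
      have e : g • (x : G ⧸ St) = ((((g : L) : G) * x : G) : G ⧸ St) := rfl
      rw [e, hDi, hDD, hρ]
      rw [hDi, hDD] at hv
      convert hv using 1
      group) (fun i => by rw [← hcard]; exact ordProj_le_card_orbit_sylow P i)
    let S' : Finset G := S.image fun v => ((e v : M) : G)
    refine ⟨S', ?_, ?_⟩
    · have h1 : (S'.card : ℝ) ≤ S.card := by exact_mod_cast Finset.card_image_le
      refine h1.trans (hS1.trans ?_)
      calc ω * ((∑ i, (finrank (ZMod p) V - finrank (ZMod p) (Di i)) : ℕ) : ℝ)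
          ≤ (3 * Real.log p / √(Real.log St.index)) * ((St.index * a : ℕ) : ℝ) := by
            gcongr
        _ = _ := by push_cast; ring
    · rw [sup_bot_eq]
      set L' := L ⊔ Subgroup.closure (S' : Set G) with hL'
      let W : Submodule (ZMod p) V :=
        AddSubgroup.toZModSubmodule p
          { carrier := {v | ((e v : M) : G) ∈ L'}
            zero_mem' := by simp [he0, L'.one_mem]
            add_mem' := by
              intro v w hv hw
              simpa only [Set.mem_ofPred_eq, he, Subgroup.coe_mul] using L'.mul_mem hv hw
            neg_mem' := by
              intro v hv
              simpa only [Set.mem_ofPred_eq, hneg, Subgroup.coe_inv] using L'.inv_mem hv }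
      have hW : ∀ v : V, v ∈ W ↔ ((e v : M) : G) ∈ L' := fun v => Iff.rfl
      have hLL' : L ≤ L' := le_sup_left
      have hWt := hS2 W (by
        intro g v hv
        rw [hW] at hv ⊢
        rw [hρ]
        have hg : ((g : L) : G) ∈ L' := hLL' (g : L).2
        exact L'.mul_mem (L'.mul_mem hg hv) (L'.inv_mem hg)) (by
        intro v hv
        rw [hW]
        exact (le_sup_right : _ ≤ L') (Subgroup.subset_closure
          (Finset.mem_coe.2 (Finset.mem_image_of_mem _ hv))))
      have hML' : M ≤ L' := fun x hx => by
        have : e.symm ⟨x, hx⟩ ∈ W := by rw [hWt]; trivial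
        rwa [hW, e.apply_symm_apply] at this
      exact top_le_iff.1 (hL ▸ sup_le hLL' hML')
  rcases factorization_dichotomy hp.out hs with h | ⟨q, hq, hpq, h⟩
  · exact main p hp _ (by positivity) h fun P ρ h1 h2 =>
      exists_generators_of_isPGroup P.isPGroup' ρ Di h1 hbot h2
  · have hq' : Fact q.Prime := ⟨hq⟩
    exact main q hq' _ (by positivity) h fun P ρ h1 h2 =>
      exists_generators_of_coprime hpq P.isPGroup' ρ Di h1 hbot h2

theorem genBound_elementary_core_bot {G : Type*} [Group G] [Finite G] {p : ℕ}
    [hp : Fact p.Prime] (M D St : Subgroup G) [M.Normal]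
    (hcomm : ∀ x ∈ M, ∀ y ∈ M, x * y = y * x) (hpow : ∀ x ∈ M, x ^ p = 1)
    (hDSt : ∀ g ∈ St, ∀ x ∈ D, g * x * g⁻¹ ∈ D) (hcore : D.normalCore = ⊥) (hMSt : M ≤ St)
    (hs : 2 ≤ St.index) {a : ℕ} (hidx : D.relIndex M ≤ p ^ a) :
    GenBound M ⊥ (3 * a * Real.log p * St.index / √(Real.log St.index)) := by
  let i1 : CommGroup M :=
    { (inferInstance : Group M) with
      mul_comm := fun x y => Subtype.ext (hcomm x x.2 y y.2) }
  let i2 : AddCommGroup (Additive M) := Additive.addCommGroup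
  let i3 : Module (ZMod p) (Additive M) := AddCommGroup.zmodModule fun x => by
    apply Additive.toMul.injective
    rw [toMul_nsmul]
    exact Subtype.ext (hpow _ (Additive.toMul x).2)
  exact genBound_module_core_bot M D St (V := Additive M) Additive.toMul (fun _ _ => rfl) hDSt
    hcore hMSt hs hidx

/-- The map to the quotient by a normal subgroup contained in `H` preserves the trivial
normal core. -/
theorem normalCore_map_mk'_normalCore {G : Type*} [Group G] (D : Subgroup G) :
    (D.map (QuotientGroup.mk' D.normalCore)).normalCore = ⊥ := by
  rw [eq_bot_iff]
  intro x hx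
  obtain ⟨x, rfl⟩ := QuotientGroup.mk'_surjective _ x
  rw [Subgroup.mem_bot, QuotientGroup.mk'_apply, QuotientGroup.eq_one_iff]
  intro g
  obtain ⟨d, hd, h⟩ := hx (QuotientGroup.mk' _ g)
  rw [← map_inv, ← map_mul, ← map_mul] at h
  have h2 := D.normalCore_le (QuotientGroup.eq.1 h)
  have := D.mul_mem hd h2
  rwa [mul_inv_cancel_left] at this

theorem genBound_elementary {G : Type*} [Group G] [Finite G] {p : ℕ}
    [hp : Fact p.Prime] (E D St : Subgroup G)
    (hcomm : ∀ x ∈ E, ∀ y ∈ E, ⁅x, y⁆ ∈ D) (hpow : ∀ x ∈ E, x ^ p ∈ D)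
    (hDSt : ∀ g ∈ St, ∀ x ∈ D, g * x * g⁻¹ ∈ D) (hDE : D ≤ E) (hESt : E ≤ St)
    (hs : 2 ≤ St.index) {a : ℕ} (hidx : D.relIndex E ≤ p ^ a) :
    GenBound E.normalCore D.normalCore
      (3 * a * Real.log p * St.index / √(Real.log St.index)) := by
  set π := QuotientGroup.mk' D.normalCore with hπ
  have hker : π.ker = D.normalCore := QuotientGroup.ker_mk' _
  have hsurj : Function.Surjective π := QuotientGroup.mk'_surjective _
  apply GenBound.of_quotient
  have hM : (E.normalCore.map π).Normal := Subgroup.Normal.map inferInstance _ hsurj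
  have hone : ∀ x ∈ D.normalCore, π x = 1 := fun x hx => by
    rwa [← MonoidHom.mem_ker, hker]
  have hidx' : (St.map π).index = St.index := by
    apply Subgroup.index_map_eq _ hsurj
    rw [hker]
    exact D.normalCore_le.trans (hDE.trans hESt)
  rw [← hidx']
  refine genBound_elementary_core_bot _ (D.map π) (St.map π) ?_ ?_ ?_
    (normalCore_map_mk'_normalCore D) (Subgroup.map_mono (E.normalCore_le.trans hESt))
    (hidx'.symm ▸ hs) ?_
  · rintro _ ⟨x, hx, rfl⟩ _ ⟨y, hy, rfl⟩
    rw [← commutatorElement_eq_one_iff_mul_comm, ← map_commutatorElement]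
    refine hone _ fun g => ?_
    have := hcomm _ (hx g) _ (hy g)
    rwa [← conjugate_commutatorElement] at this
  · rintro _ ⟨x, hx, rfl⟩
    rw [← map_pow]
    refine hone _ fun g => ?_
    rw [← conj_pow]
    exact hpow _ (hx g)
  · rintro _ ⟨g, hg, rfl⟩ _ ⟨x, hx, rfl⟩
    exact ⟨g * x * g⁻¹, hDSt g hg x hx, by simp⟩
  · rw [← Subgroup.relIndex_comap, Subgroup.comap_map_eq, hker, sup_of_le_left D.normalCore_le]
    refine le_trans ?_ hidx
    refine Subgroup.relIndex_le_of_le_right E.normalCore_le ?_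
    exact Subgroup.index_ne_zero_of_finite

/-- `H` is normalized by `M`. -/
def NormBy {G : Type*} [Group G] (M H : Subgroup G) : Prop :=
  ∀ m ∈ M, ∀ x ∈ H, m * x * m⁻¹ ∈ H

/-- The conjugate `g H g⁻¹`. -/
def conjSub {G : Type*} [Group G] (g : G) (H : Subgroup G) : Subgroup G :=
  H.map (MulAut.conj g).toMonoidHom

section

variable {G : Type*} [Group G] {M H K D : Subgroup G}

theorem mem_conjSub {g x : G} : x ∈ conjSub g H ↔ g⁻¹ * x * g ∈ H := by
  constructor
  · rintro ⟨y, hy, rfl⟩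
    simpa [MulAut.conj_apply, mul_assoc] using hy
  · intro h
    exact ⟨_, h, by simp [MulAut.conj_apply, mul_assoc]⟩

theorem conjSub_mono {g : G} (h : H ≤ K) : conjSub g H ≤ conjSub g K := Subgroup.map_mono h

theorem conjSub_conjSub (g h : G) : conjSub g (conjSub h H) = conjSub (g * h) H := by
  ext x
  simp [mem_conjSub, mul_assoc]

theorem conjSub_one : conjSub 1 H = H := by
  ext x
  simp [mem_conjSub]

theorem conjSub_inv_conjSub (g : G) : conjSub g⁻¹ (conjSub g H) = H := by
  rw [conjSub_conjSub, inv_mul_cancel, conjSub_one]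

theorem conjSub_conjSub_inv (g : G) : conjSub g (conjSub g⁻¹ H) = H := by
  rw [conjSub_conjSub, mul_inv_cancel, conjSub_one]

theorem conjSub_of_normal [M.Normal] (g : G) : conjSub g M = M := by
  ext x
  rw [mem_conjSub]
  constructor
  · intro h
    have := ‹M.Normal›.conj_mem _ h g
    simpa [mul_assoc] using this
  · intro h
    simpa using ‹M.Normal›.conj_mem _ h g⁻¹

theorem conjSub_bot (g : G) : conjSub g (⊥ : Subgroup G) = ⊥ := Subgroup.map_bot _

theorem NormBy.conjSub (h : NormBy M H) [M.Normal] (g : G) : NormBy M (conjSub g H) := by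
  intro m hm x hx
  rw [mem_conjSub] at hx ⊢
  have hm' : g⁻¹ * m * g ∈ M := by simpa using ‹M.Normal›.conj_mem _ hm g⁻¹
  have := h _ hm' _ hx
  convert this using 1
  group

theorem NormBy.inf (h : NormBy M H) (h' : NormBy M K) : NormBy M (H ⊓ K) := fun m hm x hx =>
  ⟨h m hm x hx.1, h' m hm x hx.2⟩

theorem NormBy.of_normal [H.Normal] : NormBy M H := fun m _ x hx =>
  ‹H.Normal›.conj_mem x hx m

theorem NormBy.mono (h : NormBy M H) (hK : K ≤ M) : NormBy K H := fun m hm => h m (hK hm)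

theorem NormBy.conj_inv (h : NormBy M H) {m x : G} (hm : m ∈ M) (hx : x ∈ H) :
    m⁻¹ * x * m ∈ H := by
  simpa using h _ (M.inv_mem hm) x hx

theorem NormBy.commute (h : NormBy M H) (h' : NormBy M K) (hH : H ≤ M) (hK : K ≤ M)
    (hHK : H ⊓ K = ⊥) {x y : G} (hx : x ∈ H) (hy : y ∈ K) : x * y = y * x := by
  rw [← commutatorElement_eq_one_iff_mul_comm, ← Subgroup.mem_bot, ← hHK,
    commutatorElement_def]
  refine ⟨?_, ?_⟩
  · have := H.mul_mem hx (h _ (hK hy) _ (H.inv_mem hx))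
    simpa [mul_assoc] using this
  · exact K.mul_mem (h' _ (hH hx) _ hy) (K.inv_mem hy)

/-- Elements of a join with a normalized subgroup decompose as products. -/
theorem NormBy.mem_sup (h : NormBy H D) {x : G} (hx : x ∈ H ⊔ D) :
    ∃ a ∈ H, ∃ d ∈ D, x = a * d := by
  let P : Subgroup G :=
    { carrier := {x | ∃ a ∈ H, ∃ d ∈ D, x = a * d}
      one_mem' := ⟨1, H.one_mem, 1, D.one_mem, by simp⟩
      mul_mem' := by
        rintro _ _ ⟨a, ha, d, hd, rfl⟩ ⟨b, hb, e, he, rfl⟩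
        exact ⟨a * b, H.mul_mem ha hb, b⁻¹ * d * b * e, D.mul_mem (h.conj_inv hb hd) he, by group⟩
      inv_mem' := by
        rintro _ ⟨a, ha, d, hd, rfl⟩
        exact ⟨a⁻¹, H.inv_mem ha, a * d⁻¹ * a⁻¹, h a ha _ (D.inv_mem hd), by group⟩ }
  have h1 : H ⊔ D ≤ P := sup_le (fun a ha => ⟨a, ha, 1, D.one_mem, by simp⟩)
    fun d hd => ⟨1, H.one_mem, d, hd, by simp⟩
  exact h1 hx

/-- `T` is minimal among the nontrivial subgroups normalized by `M`. -/
def MinNormBy (M T : Subgroup G) : Prop :=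
  T ≤ M ∧ T ≠ ⊥ ∧ NormBy M T ∧ ∀ T' ≤ T, NormBy M T' → T' ≠ ⊥ → T' = T

theorem exists_minNormBy [Finite G] (hM : M ≠ ⊥) : ∃ T, MinNormBy M T := by
  obtain ⟨T, hT⟩ := (Set.toFinite {T : Subgroup G | T ≤ M ∧ T ≠ ⊥ ∧ NormBy M T}).exists_minimal
    ⟨M, le_rfl, hM, fun m hm x hx => M.mul_mem (M.mul_mem hm hx) (M.inv_mem hm)⟩
  refine ⟨T, hT.1.1, hT.1.2.1, hT.1.2.2, fun T' h1 h2 h3 => ?_⟩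
  exact le_antisymm h1 (hT.2 ⟨h1.trans hT.1.1, h3, h2⟩ h1)

theorem MinNormBy.conjSub [M.Normal] {T : Subgroup G} (h : MinNormBy M T) (g : G) :
    MinNormBy M (conjSub g T) := by
  obtain ⟨h1, h2, h3, h4⟩ := h
  refine ⟨?_, ?_, h3.conjSub g, fun T' h5 h6 h7 => ?_⟩
  · rw [← conjSub_of_normal (M := M) g]
    exact conjSub_mono h1
  · intro h
    apply h2
    rw [← conjSub_inv_conjSub (H := T) g, h, conjSub_bot]
  · have := h4 (_root_.conjSub g⁻¹ T') (by
      rw [← conjSub_inv_conjSub (H := T) g]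
      exact conjSub_mono h5) (h6.conjSub _) (by
      intro h
      apply h7
      rw [← conjSub_conjSub_inv (H := T') g, h, conjSub_bot])
    rw [← this, conjSub_conjSub_inv]

theorem MinNormBy.commute {T T' : Subgroup G} (h : MinNormBy M T) (h' : MinNormBy M T')
    (hne : T ≠ T') {x y : G} (hx : x ∈ T) (hy : y ∈ T') : x * y = y * x := by
  refine h.2.2.1.commute h'.2.2.1 h.1 h'.1 ?_ hx hy
  by_contra hb
  have h1 := h.2.2.2 _ inf_le_left (h.2.2.1.inf h'.2.2.1) hb
  have h2 := h'.2.2.2 _ inf_le_right (h.2.2.1.inf h'.2.2.1) hb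
  exact hne (h1.symm.trans h2)

theorem MinNormBy.exists_conjSub_inf_eq_bot {T : Subgroup G} (h : MinNormBy M T) [M.Normal]
    (hD : NormBy M D) (hcore : D.normalCore = ⊥) : ∃ g : G, T ⊓ _root_.conjSub g D = ⊥ := by
  by_contra! hne
  apply h.2.1
  rw [eq_bot_iff, ← hcore]
  intro x hx g
  have h1 := h.2.2.2 _ inf_le_left (h.2.2.1.inf (hD.conjSub g⁻¹)) (hne g⁻¹)
  rw [← h1] at hx
  have := mem_conjSub.1 hx.2
  rwa [inv_inv] at this

theorem NormBy.commutator_mem (hD : NormBy M D) {c n d d' : G} (hc : c ∈ M) (hn : n ∈ M)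
    (hd : d ∈ D) (hd' : d' ∈ D) (h : ⁅c, n⁆ ∈ D) : ⁅c * d, n * d'⁆ ∈ D := by
  have hkey : ⁅c * d, n * d'⁆ = (c * n) * (n⁻¹ * d * n * d' * d⁻¹ * (c⁻¹ * d'⁻¹ * c))
      * (c * n)⁻¹ * ⁅c, n⁆ := by
    rw [commutatorElement_def, commutatorElement_def]
    group
  rw [hkey]
  refine D.mul_mem (hD _ (M.mul_mem hc hn) _ ?_) h
  exact D.mul_mem (D.mul_mem (D.mul_mem (hD.conj_inv hn hd) hd') (D.inv_mem hd))
    (hD.conj_inv hc (D.inv_mem hd'))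

/-- If each nontrivial normal subgroup below `M` supplements `D` in `M`, and `D` does not contain
the commutator subgroup of `M`, then centralizers of normal subgroups in `M` are trivial. -/
theorem eq_one_of_commute_normal [M.Normal] (hD : NormBy M D)
    (hmin : ∀ N : Subgroup G, N.Normal → N ≤ M → N ≠ ⊥ → N ⊔ D = M)
    (hnc : ∃ x ∈ M, ∃ y ∈ M, ⁅x, y⁆ ∉ D)
    (N : Subgroup G) [N.Normal] (hN : N ≤ M) (hN1 : N ≠ ⊥) {z : G} (hz : z ∈ M)
    (hcomm : ∀ n ∈ N, z * n = n * z) : z = 1 := by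
  by_contra hz1
  let C : Subgroup G := Subgroup.centralizer (N : Set G) ⊓ M
  have hC : C ⊔ D = M := hmin C inferInstance inf_le_right fun h => by
    have : z ∈ C := ⟨Subgroup.mem_centralizer_iff.2 fun n hn => (hcomm n hn).symm, hz⟩
    rw [h, Subgroup.mem_bot] at this
    exact hz1 this
  have hN2 := hmin N inferInstance hN hN1
  obtain ⟨x, hx, y, hy, hxy⟩ := hnc
  apply hxy
  rw [← hC] at hx
  rw [← hN2] at hy
  obtain ⟨c, hc, d, hd, rfl⟩ := (hD.mono (inf_le_right : C ≤ M)).mem_sup hx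
  obtain ⟨n, hn, d', hd', rfl⟩ := (hD.mono hN).mem_sup hy
  refine hD.commutator_mem hc.2 (hN hn) hd hd' ?_
  rw [commutatorElement_eq_one_iff_mul_comm.2 (Subgroup.mem_centralizer_iff.1 hc.1 n hn).symm]
  exact D.one_mem

theorem exists_minNormBy_supplement [Finite G] [M.Normal] (hDM : D ≤ M) (hD : NormBy M D)
    (hcore : D.normalCore = ⊥)
    (hmin : ∀ N : Subgroup G, N.Normal → N ≤ M → N ≠ ⊥ → N ⊔ D = M)
    (hnc : ∃ x ∈ M, ∃ y ∈ M, ⁅x, y⁆ ∉ D) :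
    ∃ T ≤ M, NormBy M T ∧ T ⊓ D = ⊥ ∧ ∀ L, L ⊔ M = ⊤ → T ≤ L → L = ⊤ := by
  have hM : M ≠ ⊥ := by
    rintro rfl
    obtain ⟨x, hx, y, hy, h⟩ := hnc
    rw [Subgroup.mem_bot] at hx hy
    subst hx hy
    exact h (by simp)
  obtain ⟨T, hT, hTD⟩ : ∃ T, MinNormBy M T ∧ T ⊓ D = ⊥ := by
    obtain ⟨T, hT⟩ := exists_minNormBy hM
    obtain ⟨g, hg⟩ := hT.exists_conjSub_inf_eq_bot hD hcore
    refine ⟨conjSub g⁻¹ T, hT.conjSub _, ?_⟩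
    rw [eq_bot_iff]
    rintro x ⟨hx, hx'⟩
    replace hx : x ∈ conjSub g⁻¹ T := hx
    rw [mem_conjSub, inv_inv] at hx
    have : g * x * g⁻¹ ∈ T ⊓ conjSub g D := ⟨hx,
      mem_conjSub.2 (by simpa [mul_assoc] using hx')⟩
    rw [hg, Subgroup.mem_bot] at this
    simpa using this
  refine ⟨T, hT.1, hT.2.2.1, hTD, fun L hL hTL => ?_⟩
  set N := Subgroup.normalClosure (T : Set G) with hN
  have hTN : T ≤ N := Subgroup.le_normalClosure
  have hNM : N ≤ M := Subgroup.normalClosure_le_normal hT.1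
  have hN1 : N ≠ ⊥ := fun h => hT.2.1 (le_bot_iff.1 (h ▸ hTN))
  have hmemN : ∀ g, conjSub g T ≤ N := fun g => by
    rw [← conjSub_of_normal (M := N) g]
    exact conjSub_mono hTN
  have hNle : ∀ K : Subgroup G, (∀ g, conjSub g T ≤ K) → N ≤ K := by
    intro K hK
    rw [hN, Subgroup.normalClosure, Subgroup.closure_le]
    intro x hx
    rw [Group.mem_conjugatesOfSet_iff] at hx
    obtain ⟨t, ht, hx⟩ := hx
    obtain ⟨c, rfl⟩ := isConj_iff.1 hx
    exact hK c (mem_conjSub.2 (by simpa [mul_assoc] using ht))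
  -- `M` acts on each conjugate of `T` by inner automorphisms
  have hinner : ∀ g, M ≤ conjSub g T ⊔ Subgroup.centralizer (conjSub g T : Set G) := by
    intro g
    have hTg := hT.conjSub g
    obtain ⟨k, hk⟩ := hTg.exists_conjSub_inf_eq_bot hD hcore
    have hDk : conjSub k D ≤ M := by
      rw [← conjSub_of_normal (M := M) k]
      exact conjSub_mono hDM
    have h1 : N ⊔ conjSub k D = M := by
      have := congrArg (conjSub k) (hmin N inferInstance hNM hN1)
      rw [conjSub, Subgroup.map_sup] at this
      change conjSub k N ⊔ conjSub k D = conjSub k M at this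
      rwa [conjSub_of_normal (M := N), conjSub_of_normal (M := M)] at this
    rw [← h1]
    refine sup_le (hNle _ fun j => ?_) ?_
    · by_cases hj : conjSub j T = conjSub g T
      · rw [hj]; exact le_sup_left
      · refine le_trans (fun x hx => ?_) le_sup_right
        exact Subgroup.mem_centralizer_iff.2 fun y hy =>
          ((hT.conjSub j).commute hTg hj hx hy).symm
    · refine le_trans (fun x hx => ?_) le_sup_right
      exact Subgroup.mem_centralizer_iff.2 fun y hy =>
        hTg.2.2.1.commute (hD.conjSub k) hTg.1 hDk hk hy hx
  have hfin : ∀ F : Set (Subgroup G), F ⊆ Set.range (fun g => conjSub g T) → ∀ x ∈ M,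
      ∃ y ∈ N, ∀ R ∈ F, ∀ r ∈ R, (y⁻¹ * x) * r = r * (y⁻¹ * x) := by
    intro F
    induction F, Set.toFinite F using Set.Finite.induction_on with
    | empty => exact fun _ x _ => ⟨1, N.one_mem, fun R hR => absurd hR (Set.notMem_empty R)⟩
    | @insert R F hRF _ ih =>
      intro hF x hx
      obtain ⟨y, hy, hyF⟩ := ih (fun Q hQ => hF (Set.mem_insert_of_mem _ hQ)) x hx
      obtain ⟨g, rfl⟩ := hF (Set.mem_insert _ _)
      have h1 : y⁻¹ * x ∈ M := M.mul_mem (M.inv_mem (hNM hy)) hx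
      have hn : NormBy (Subgroup.centralizer (conjSub g T : Set G)) (conjSub g T) := by
        intro c hc t ht
        have := Subgroup.mem_centralizer_iff.1 hc t ht
        rw [← this, mul_inv_cancel_right]
        exact ht
      have h2 := hinner g h1
      rw [sup_comm] at h2
      obtain ⟨c, hc, t, ht, hct⟩ := hn.mem_sup h2
      have hct' : y⁻¹ * x = t * c := by
        rw [hct]
        exact (Subgroup.mem_centralizer_iff.1 hc t ht).symm
      have h3 : (y * t)⁻¹ * x = t⁻¹ * (y⁻¹ * x) := by group
      refine ⟨y * t, N.mul_mem hy (hmemN g ht), fun Q hQ q hq => ?_⟩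
      rw [h3]
      rcases hQ with rfl | hQ
      · rw [hct', inv_mul_cancel_left]
        exact (Subgroup.mem_centralizer_iff.1 hc q hq).symm
      · obtain ⟨j, hj⟩ := hF (Set.mem_insert_of_mem _ hQ)
        have hne : conjSub g T ≠ conjSub j T := by
          intro h
          apply hRF
          change conjSub g T ∈ F
          rw [h]
          rw [show conjSub j T = Q from hj]
          exact hQ
        have h4 : t⁻¹ * q = q * t⁻¹ := (hT.conjSub g).commute (hT.conjSub j) hne
          (Subgroup.inv_mem _ ht) (by rw [← hj] at hq; exact hq)
        rw [mul_assoc, hyF Q hQ q hq, ← mul_assoc, h4, mul_assoc]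
  have hMN : M ≤ N := by
    intro x hx
    obtain ⟨y, hy, h⟩ := hfin _ le_rfl x hx
    have h1 : y⁻¹ * x ∈ M := M.mul_mem (M.inv_mem (hNM hy)) hx
    have h2 := eq_one_of_commute_normal hD hmin hnc N hNM hN1 h1 fun n hn => by
      have h3 : N ≤ Subgroup.centralizer {y⁻¹ * x} := hNle _ fun g t ht =>
        Subgroup.mem_centralizer_iff.2 fun z hz => by
          rw [Set.mem_singleton_iff.1 hz]
          exact h _ ⟨g, rfl⟩ t ht
      exact Subgroup.mem_centralizer_iff.1 (h3 hn) _ rfl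
    rw [inv_mul_eq_one] at h2
    exact h2 ▸ hy
  have hNL : N ≤ L := hNle _ fun g x hx => by
    obtain ⟨l, hl, m, hm, rfl⟩ := Subgroup.mem_sup_of_normal_right.1
      (hL ▸ Subgroup.mem_top g : g ∈ L ⊔ M)
    rw [mem_conjSub] at hx
    have h1 := hT.2.2.1 m hm _ hx
    have h2 : x = l * (m * ((l * m)⁻¹ * x * (l * m)) * m⁻¹) * l⁻¹ := by group
    rw [h2]
    exact L.mul_mem (L.mul_mem hl (hTL h1)) (L.inv_mem hl)
  exact top_le_iff.1 (hL ▸ sup_le le_rfl (hMN.trans hNL))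

theorem NormBy.sup {L : Subgroup G} (h : NormBy L H) (h' : NormBy L K) : NormBy L (H ⊔ K) := by
  intro m hm x hx
  have : H ⊔ K ≤ _root_.conjSub m⁻¹ (H ⊔ K) := by
    refine sup_le (fun y hy => ?_) (fun y hy => ?_)
    · exact mem_conjSub.2 (Subgroup.mem_sup_left (by simpa using h m hm y hy))
    · exact mem_conjSub.2 (Subgroup.mem_sup_right (by simpa using h' m hm y hy))
  simpa using mem_conjSub.1 (this hx)

theorem NormBy.self : NormBy M M := fun _ hm _ hx =>
  M.mul_mem (M.mul_mem hm hx) (M.inv_mem hm)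

/-- A nonabelian chief section `E / D` of `St` contributes boundedly many generators. -/
theorem genBound_nonabelian [Finite G] {E St : Subgroup G} (hDE : D ≤ E) (hES : E ≤ St)
    (hD : NormBy St D)
    (hchief : ∀ F, D ≤ F → F ≤ E → NormBy St F → F = D ∨ F = E)
    (hnc : ∃ x ∈ E, ∃ y ∈ E, ⁅x, y⁆ ∉ D) {m : ℕ}
    (hrank : ∀ F, D ≤ F → F ≤ E → NormBy E F →
      ∃ S : Finset G, S.card ≤ m ∧ (S : Set G) ⊆ F ∧ F ≤ Subgroup.closure (S : Set G) ⊔ D) :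
    GenBound E.normalCore D.normalCore m := by
  classical
  have hM0M : D.normalCore ≤ E.normalCore := Subgroup.normalCore_mono hDE
  have hME : E.normalCore ≤ E := E.normalCore_le
  by_cases hne : E.normalCore ≤ D
  · exact GenBound.of_le (Subgroup.normal_le_normalCore.2 hne) (Nat.cast_nonneg m)
  have hsup : ∀ N : Subgroup G, N.Normal → N ≤ E.normalCore → ¬ N ≤ D → N ⊔ D = E := by
    intro N hN1 hN2 hN3
    rcases hchief (N ⊔ D) le_sup_right (sup_le (hN2.trans hME) hDE)
      (NormBy.of_normal.sup hD) with h | h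
    · exact absurd (h ▸ le_sup_left) hN3
    · exact h
  have hDE' : NormBy E D := hD.mono hES
  have hMD := hsup _ inferInstance le_rfl hne
  set M := E.normalCore with hM
  set π := QuotientGroup.mk' D.normalCore with hπ
  have hker : π.ker = D.normalCore := QuotientGroup.ker_mk' _
  have hsurj : Function.Surjective π := QuotientGroup.mk'_surjective _
  have hDM : NormBy M (D ⊓ M) := (hDE'.mono hME).inf NormBy.self
  have hM' : (M.map π).Normal := Subgroup.Normal.map inferInstance _ hsurj
  have hcomapM : (M.map π).comap π = M := by
    rw [Subgroup.comap_map_eq, hker, sup_of_le_left hM0M]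
  have hcomapD : ((D ⊓ M).map π).comap π = D ⊓ M := by
    rw [Subgroup.comap_map_eq, hker, sup_of_le_left (le_inf D.normalCore_le hM0M)]
  obtain ⟨T, hT1, hT2, hT3, hT4⟩ : ∃ T ≤ M.map π, NormBy (M.map π) T ∧ T ⊓ (D ⊓ M).map π = ⊥ ∧
      ∀ L, L ⊔ M.map π = ⊤ → T ≤ L → L = ⊤ := by
    refine exists_minNormBy_supplement (Subgroup.map_mono inf_le_right) ?_ ?_ ?_ ?_
    · rintro _ ⟨a, ha, rfl⟩ _ ⟨x, hx, rfl⟩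
      exact ⟨a * x * a⁻¹, hDM a ha x hx, by simp⟩
    · rw [eq_bot_iff, ← normalCore_map_mk'_normalCore D]
      exact Subgroup.normalCore_mono (Subgroup.map_mono inf_le_left)
    · intro N' hN1 hN2 hN3
      have h1 : N'.comap π ≤ M := hcomapM ▸ Subgroup.comap_mono hN2
      have h2 := hsup (N'.comap π) inferInstance h1 fun h => by
        apply hN3
        have h3 : N'.comap π ≤ D.normalCore := Subgroup.normal_le_normalCore.2 h
        rw [eq_bot_iff, ← Subgroup.map_comap_eq_self_of_surjective hsurj N', Subgroup.map_le_iff_le_comap]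
        exact h3.trans hker.ge
      refine le_antisymm (sup_le hN2 (Subgroup.map_mono inf_le_right)) ?_
      rintro _ ⟨x, hx, rfl⟩
      have h3 : x ∈ N'.comap π ⊔ D := by rw [h2]; exact hME hx
      obtain ⟨n, hn, d, hd, rfl⟩ := (hDE'.mono (h1.trans hME)).mem_sup h3
      have hdM : d ∈ M := by
        have := M.mul_mem (M.inv_mem (h1 hn)) hx
        rwa [inv_mul_cancel_left] at this
      rw [map_mul]
      exact Subgroup.mul_mem_sup hn ⟨d, ⟨hd, hdM⟩, rfl⟩
    · by_contra! hab
      obtain ⟨x, hx, y, hy, hxy⟩ := hnc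
      apply hxy
      rw [← hMD] at hx hy
      obtain ⟨c, hc, d, hd, rfl⟩ := (hDE'.mono hME).mem_sup hx
      obtain ⟨n, hn, d', hd', rfl⟩ := (hDE'.mono hME).mem_sup hy
      refine hDE'.commutator_mem (hME hc) (hME hn) hd hd' ?_
      have := hab _ ⟨c, hc, rfl⟩ _ ⟨n, hn, rfl⟩
      rw [← map_commutatorElement, ← Subgroup.mem_comap, hcomapD] at this
      exact this.1
  have hTM : T.comap π ≤ M := hcomapM ▸ Subgroup.comap_mono hT1
  have hM0T : D.normalCore ≤ T.comap π := 
    hker.ge.trans (Subgroup.comap_mono bot_le)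
  have hTD : T.comap π ⊓ D ≤ D.normalCore := by
    rintro x ⟨hx, hxD⟩
    rw [← hker, MonoidHom.mem_ker, ← Subgroup.mem_bot, ← hT3]
    exact ⟨hx, x, ⟨hxD, hTM hx⟩, rfl⟩
  have hTn : NormBy M (T.comap π) := fun a ha x hx => by
    have := hT2 _ ⟨a, ha, rfl⟩ _ hx
    rwa [← map_inv, ← map_mul, ← map_mul] at this
  have hFn : NormBy E (T.comap π ⊔ D) := by
    have h1 : NormBy M (T.comap π ⊔ D) := hTn.sup (hDE'.mono hME)
    intro a ha x hx
    rw [← hMD] at ha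
    obtain ⟨c, hc, d, hd, rfl⟩ := (hDE'.mono hME).mem_sup ha
    have hd' : d ∈ T.comap π ⊔ D := Subgroup.mem_sup_right hd
    have h2 := h1 c hc _ (Subgroup.mul_mem _ (Subgroup.mul_mem _ hd' hx) (Subgroup.inv_mem _ hd'))
    convert h2 using 1
    group
  obtain ⟨S, hS1, hS2, hS3⟩ := hrank _ le_sup_right (sup_le (hTM.trans hME) hDE) hFn
  have hTE : NormBy (T.comap π) D := hDE'.mono (hTM.trans hME)
  have hdec : ∀ s : S, ∃ t ∈ T.comap π, ∃ d ∈ D, (s : G) = t * d := fun s =>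
    hTE.mem_sup (hS2 s.2)
  choose f hf1 g hg1 hfg using hdec
  let R : Finset G := Finset.univ.image f
  have hR : R.card ≤ m := (Finset.card_image_le.trans (by simp)).trans hS1
  have hRT : Subgroup.closure (R : Set G) ≤ T.comap π := by
    rw [Subgroup.closure_le]
    intro x hx
    obtain ⟨s, -, rfl⟩ := Finset.mem_image.1 (Finset.mem_coe.1 hx)
    exact hf1 s
  have hTR : T.comap π ≤ Subgroup.closure (R : Set G) ⊔ D.normalCore := by
    intro t ht
    have h1 : t ∈ Subgroup.closure (R : Set G) ⊔ D := by
      refine (hS3.trans (sup_le ?_ le_sup_right)) (Subgroup.mem_sup_left ht)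
      rw [Subgroup.closure_le]
      intro s hs
      have := hfg ⟨s, hs⟩
      change s = _ at this
      rw [this]
      exact Subgroup.mul_mem_sup (Subgroup.subset_closure
        (Finset.mem_coe.2 (Finset.mem_image_of_mem _ (Finset.mem_univ _)))) (hg1 _)
    obtain ⟨x, hx, d, hd, rfl⟩ := (hTE.mono hRT).mem_sup h1
    refine Subgroup.mul_mem_sup hx (hTD ⟨?_, hd⟩)
    have := Subgroup.mul_mem _ (Subgroup.inv_mem _ (hRT hx)) ht
    rwa [inv_mul_cancel_left] at this
  intro L hL
  refine ⟨R, by exact_mod_cast hR, ?_⟩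
  have h1 := hT4 ((L ⊔ Subgroup.closure (R : Set G) ⊔ D.normalCore).map π) (by
    rw [← Subgroup.map_sup, sup_right_comm, sup_right_comm L, hL, top_sup_eq, top_sup_eq]
    exact Subgroup.map_top_of_surjective _ hsurj) (by
    rw [← Subgroup.map_comap_eq_self_of_surjective hsurj T]
    refine Subgroup.map_mono (hTR.trans (sup_le_sup_right le_sup_right _)))
  have h2 := congrArg (Subgroup.comap π) h1
  rwa [Subgroup.comap_map_eq, hker, sup_assoc, sup_idem, Subgroup.comap_top] at h2

end

/-- A greedy choice of points meeting every member of a family of large sets. -/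
theorem exists_hitting_of_card {U ι : Type*} [Fintype U] [DecidableEq U] [Fintype ι]
    (A : ι → Finset U) {d : ℕ} (hd : 0 < d) (hA : ∀ i, d ≤ (A i).card) (k : ℕ) :
    ∃ Z : Finset U, Z.card ≤ k ∧
      ((Finset.univ.filter fun i => Disjoint (A i) Z).card : ℝ) ≤
        Fintype.card ι * (1 - d / Fintype.card U) ^ k := by
  classical
  induction k with
  | zero =>
    refine ⟨∅, by simp, ?_⟩
    simp
  | succ k ih =>
    obtain ⟨Z, hZ, h⟩ := ih
    rcases isEmpty_or_nonempty ι with hι | ⟨⟨i0⟩⟩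
    · exact ⟨∅, by simp, by simp⟩
    have hU : 0 < Fintype.card U := by
      obtain ⟨x, hx⟩ := Finset.card_pos.1 (hd.trans_le (hA i0))
      exact Fintype.card_pos_iff.2 ⟨x⟩
    set F := Finset.univ.filter fun i => Disjoint (A i) Z with hF
    have hcount : ∑ u : U, (F.filter fun i => u ∈ A i).card = ∑ i ∈ F, (A i).card := by
      simp_rw [Finset.card_filter]
      rw [Finset.sum_comm]
      refine Finset.sum_congr rfl fun i _ => ?_
      simp
    obtain ⟨u, hu⟩ : ∃ u : U, F.card * d ≤ Fintype.card U * (F.filter fun i => u ∈ A i).card := by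
      by_contra! hcon
      have h1 : ∑ u : U, Fintype.card U * (F.filter fun i => u ∈ A i).card
          < ∑ u : U, F.card * d :=
        Finset.sum_lt_sum_of_nonempty ((Finset.univ_nonempty_iff).2
          (Fintype.card_pos_iff.1 hU)) fun u _ => hcon u
      rw [← Finset.mul_sum, hcount, Finset.sum_const, Finset.card_univ, smul_eq_mul] at h1
      have h2 : F.card * d ≤ ∑ i ∈ F, (A i).card := by
        rw [← smul_eq_mul, ← Finset.sum_const]
        exact Finset.sum_le_sum fun i _ => hA i
      exact absurd (Nat.mul_le_mul_left (Fintype.card U) h2) (not_le.2 h1)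
    refine ⟨insert u Z, (Finset.card_insert_le _ _).trans (by omega), ?_⟩
    have h1 : (Finset.univ.filter fun i => Disjoint (A i) (insert u Z))
        ⊆ F.filter fun i => ¬ u ∈ A i := by
      intro i hi
      simp only [hF, Finset.mem_filter, Finset.mem_univ, true_and,
        Finset.disjoint_insert_right] at hi ⊢
      exact ⟨hi.2, hi.1⟩
    have h2 := Finset.card_filter_add_card_filter_not (s := F) (fun i => u ∈ A i)
    have h3 : ((Finset.univ.filter fun i => Disjoint (A i) (insert u Z)).card : ℝ)
        ≤ F.card - (F.filter fun i => u ∈ A i).card := by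
      have := Finset.card_le_card h1
      rw [le_sub_iff_add_le]
      exact_mod_cast (by omega : _ + (F.filter fun i => u ∈ A i).card ≤ F.card)
    have hU' : (0 : ℝ) < Fintype.card U := by exact_mod_cast hU
    have h4 : (F.card : ℝ) * (d / Fintype.card U) ≤ (F.filter fun i => u ∈ A i).card := by
      rw [← mul_div_assoc, div_le_iff₀ hU', mul_comm _ (Fintype.card U : ℝ)]
      exact_mod_cast hu
    have h5 : (d : ℝ) / Fintype.card U ≤ 1 := by
      rw [div_le_one hU']
      exact_mod_cast (hA i0).trans (Finset.card_le_univ _)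
    calc _ ≤ (F.card : ℝ) * (1 - d / Fintype.card U) := by linarith
      _ ≤ (Fintype.card ι * (1 - d / Fintype.card U) ^ k) * (1 - d / Fintype.card U) :=
        mul_le_mul_of_nonneg_right h (by linarith)
      _ = _ := by ring

theorem exists_hitting {U ι : Type*} [Fintype U] [DecidableEq U] [Fintype ι]
    (A : ι → Finset U) {d : ℕ} (hd : 0 < d) (hA : ∀ i, d ≤ (A i).card) :
    ∃ Z : Finset U, (Z.card : ℝ) ≤ Fintype.card U / d * Real.log (Fintype.card ι) + 1 ∧
      ∀ i, ∃ z ∈ Z, z ∈ A i := by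
  classical
  rcases isEmpty_or_nonempty ι with hι | ⟨⟨i0⟩⟩
  · exact ⟨∅, by simp, fun i => isEmptyElim i⟩
  have hd' : (0 : ℝ) < d := by exact_mod_cast hd
  have hU : (d : ℝ) ≤ Fintype.card U := by
    exact_mod_cast (hA i0).trans (Finset.card_le_univ _)
  have hι : (1 : ℝ) ≤ Fintype.card ι := by
    exact_mod_cast Fintype.card_pos_iff.2 ⟨i0⟩
  set k := ⌊(Fintype.card U / d * Real.log (Fintype.card ι) : ℝ)⌋₊ + 1 with hk
  obtain ⟨Z, hZ, h⟩ := exists_hitting_of_card A hd hA k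
  refine ⟨Z, ?_, fun i => ?_⟩
  · have h0 : (0 : ℝ) ≤ Fintype.card U / d * Real.log (Fintype.card ι) :=
      mul_nonneg (by positivity) (Real.log_nonneg hι)
    have h1 : (Z.card : ℝ) ≤ k := by exact_mod_cast hZ
    have h2 := Nat.floor_le h0
    rw [hk] at h1
    push_cast at h1
    linarith
  · have h1 : (1 - d / Fintype.card U : ℝ) ^ k < 1 / Fintype.card ι := by
      have hpos : (0 : ℝ) < d / Fintype.card U := div_pos hd' (hd'.trans_le hU)
      have h2 : (1 - d / Fintype.card U : ℝ) ^ k ≤ Real.exp (-(d / Fintype.card U) * k) := by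
        rw [mul_comm, Real.exp_nat_mul]
        refine pow_le_pow_left₀ ?_ ?_ _
        · rw [sub_nonneg, div_le_one (hd'.trans_le hU)]
          exact hU
        · have := Real.add_one_le_exp (-(d / Fintype.card U : ℝ))
          linarith
      refine h2.trans_lt ?_
      have hexp : (1 : ℝ) / Fintype.card ι = Real.exp (-Real.log (Fintype.card ι)) := by
        rw [Real.exp_neg, Real.exp_log (by linarith), one_div]
      rw [hexp, Real.exp_lt_exp, neg_mul, neg_lt_neg_iff]
      have h3 : (Fintype.card U / d * Real.log (Fintype.card ι) : ℝ) < k := by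
        rw [hk]
        push_cast
        exact Nat.lt_floor_add_one _
      have hne : (Fintype.card U : ℝ) ≠ 0 := (hd'.trans_le hU).ne'
      calc Real.log (Fintype.card ι)
          = d / Fintype.card U * (Fintype.card U / d * Real.log (Fintype.card ι)) := by
            field_simp
        _ < _ := mul_lt_mul_of_pos_left h3 hpos
    have h2 : ((Finset.univ.filter fun i => Disjoint (A i) Z).card : ℝ) < 1 := by
      refine h.trans_lt ?_
      rw [lt_div_iff₀ (by linarith)] at h1
      linarith
    have h3 : (Finset.univ.filter fun i => Disjoint (A i) Z).card = 0 := by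
      have : (Finset.univ.filter fun i => Disjoint (A i) Z).card < 1 := by exact_mod_cast h2
      omega
    rw [Finset.card_eq_zero, Finset.filter_eq_empty_iff] at h3
    obtain ⟨z, hz1, hz2⟩ := Finset.not_disjoint_iff.1 (h3 (Finset.mem_univ i))
    exact ⟨z, hz2, hz1⟩

/-- A finset is a base for an action if its pointwise stabilizer acts trivially. -/
def IsActionBase (G : Type*) {Ω : Type*} [Group G] [MulAction G Ω] (Z : Finset Ω) : Prop :=
  ∀ g : G, (∀ z ∈ Z, g • z = z) → ∀ x : Ω, g • x = x

theorem IsActionBase.card_le {G Ω : Type*} [Group G] [MulAction G Ω] [FaithfulSMul G Ω]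
    [Fintype Ω] {Z : Finset Ω} (hZ : IsActionBase G Z) :
    Nat.card G ≤ Fintype.card Ω ^ Z.card := by
  classical
  have h : Function.Injective (fun (g : G) (z : Z) => g • (z : Ω)) := by
    intro g h hgh
    have h1 := hZ (g⁻¹ * h) fun z hz => by
      have := congrFun hgh ⟨z, hz⟩
      simp only at this
      rw [mul_smul, ← this, inv_smul_smul]
    have h2 : g⁻¹ * h = 1 := FaithfulSMul.eq_of_smul_eq_smul (α := Ω) fun x => by
      rw [h1, one_smul]
    rwa [inv_mul_eq_one] at h2
  have := Nat.card_le_card_of_injective _ h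
  rwa [Nat.card_fun, Nat.card_eq_fintype_card (α := Ω), Nat.card_eq_fintype_card (α := Z),
    Fintype.card_coe] at this

section Uniprimitive

variable {G Ω : Type*} [Group G] [MulAction G Ω]

variable (G) in
/-- Two pairs of points lie in the same orbital. -/
def SameOrbital (a b c d : Ω) : Prop := ∃ g : G, g • a = c ∧ g • b = d

theorem SameOrbital.refl (a b : Ω) : SameOrbital G a b a b := ⟨1, by simp, by simp⟩

theorem SameOrbital.symm {a b c d : Ω} (h : SameOrbital G a b c d) : SameOrbital G c d a b := by
  obtain ⟨g, rfl, rfl⟩ := h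
  exact ⟨g⁻¹, by simp, by simp⟩

theorem SameOrbital.trans {a b c d e f : Ω} (h : SameOrbital G a b c d)
    (h' : SameOrbital G c d e f) : SameOrbital G a b e f := by
  obtain ⟨g, rfl, rfl⟩ := h
  obtain ⟨k, rfl, rfl⟩ := h'
  exact ⟨k * g, by simp [mul_smul], by simp [mul_smul]⟩

theorem SameOrbital.smul (g : G) (a b : Ω) : SameOrbital G a b (g • a) (g • b) := ⟨g, rfl, rfl⟩

theorem sameOrbital_smul_iff (g : G) {a b c d : Ω} :
    SameOrbital G (g • a) (g • b) c d ↔ SameOrbital G a b c d :=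
  ⟨fun h => (SameOrbital.smul g a b).trans h, fun h => (SameOrbital.smul g a b).symm.trans h⟩

theorem sameOrbital_smul_iff' (g : G) {a b c d : Ω} :
    SameOrbital G c d (g • a) (g • b) ↔ SameOrbital G c d a b :=
  ⟨fun h => h.trans (SameOrbital.smul g a b).symm, fun h => h.trans (SameOrbital.smul g a b)⟩

variable [Fintype Ω]

open Classical in
variable (G) in
/-- The points distinguishing `x` from `y`. -/
noncomputable def distinguishing (x y : Ω) : Finset Ω :=
  Finset.univ.filter fun z => ¬ SameOrbital G x z y z

theorem mem_distinguishing {x y z : Ω} :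
    z ∈ distinguishing G x y ↔ ¬ SameOrbital G x z y z := by
  simp [distinguishing]

theorem distinguishing_comm (x y : Ω) : distinguishing G x y = distinguishing G y x := by
  ext z
  rw [mem_distinguishing, mem_distinguishing]
  exact not_congr ⟨SameOrbital.symm, SameOrbital.symm⟩

theorem distinguishing_self (x : Ω) : distinguishing G x x = ∅ := by
  ext z
  simp [mem_distinguishing, SameOrbital.refl]

theorem card_distinguishing_smul (g : G) (x y : Ω) :
    (distinguishing G (g • x) (g • y)).card = (distinguishing G x y).card := by
  refine (Finset.card_bij (fun z _ => g • z) ?_ ?_ ?_).symm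
  · intro z hz
    rw [mem_distinguishing] at hz ⊢
    rwa [sameOrbital_smul_iff, sameOrbital_smul_iff']
  · intro a _ b _ h
    exact smul_left_cancel g h
  · intro z hz
    refine ⟨g⁻¹ • z, ?_, smul_inv_smul g z⟩
    rw [mem_distinguishing] at hz ⊢
    rwa [← sameOrbital_smul_iff g, ← sameOrbital_smul_iff' g, smul_inv_smul]

theorem card_distinguishing_triangle (x y w : Ω) :
    (distinguishing G x w).card ≤ (distinguishing G x y).card + (distinguishing G y w).card := by
  classical
  refine (Finset.card_le_card ?_).trans (Finset.card_union_le _ _)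
  intro z hz
  rw [Finset.mem_union]
  simp only [mem_distinguishing] at hz ⊢
  by_contra! h
  exact hz (h.1.trans h.2)

theorem isActionBase_of_distinguishing {Z : Finset Ω}
    (hZ : ∀ x y : Ω, x ≠ y → ∃ z ∈ Z, z ∈ distinguishing G x y) : IsActionBase G Z := by
  intro g hg x
  by_contra hne
  obtain ⟨z, hz, h⟩ := hZ _ _ (Ne.symm hne)
  exact mem_distinguishing.1 h ⟨g, rfl, hg z hz⟩

variable (G) in
/-- The undirected orbital graph of the pair `(x, y)`. -/
def orbitalGraph (x y : Ω) : SimpleGraph Ω :=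
  SimpleGraph.fromRel fun u v => SameOrbital G x y u v

theorem orbitalGraph_adj {x y u v : Ω} : (orbitalGraph G x y).Adj u v ↔
    u ≠ v ∧ (SameOrbital G x y u v ∨ SameOrbital G x y v u) := SimpleGraph.fromRel_adj _ _ _

theorem orbitalGraph_adj_smul {x y u v : Ω} (g : G) (h : (orbitalGraph G x y).Adj u v) :
    (orbitalGraph G x y).Adj (g • u) (g • v) := by
  rw [orbitalGraph_adj] at h ⊢
  rw [sameOrbital_smul_iff', sameOrbital_smul_iff']
  exact ⟨fun e => h.1 (smul_left_cancel g e), h.2⟩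

/-- The action by graph homomorphisms. -/
def orbitalGraphHom (x y : Ω) (g : G) : orbitalGraph G x y →g orbitalGraph G x y where
  toFun := fun u => g • u
  map_rel' := fun h => orbitalGraph_adj_smul g h

theorem orbitalGraph_connected [MulAction.IsPreprimitive G Ω] {x y : Ω} (hxy : x ≠ y) :
    (orbitalGraph G x y).Connected := by
  set Γ := orbitalGraph G x y with hΓ
  have hre : ∀ (g : G) u v, Γ.Reachable u v → Γ.Reachable (g • u) (g • v) := fun g u v h =>
    h.map (orbitalGraphHom x y g)
  have hadj : Γ.Adj x y := orbitalGraph_adj.2 ⟨hxy, Or.inl (SameOrbital.refl x y)⟩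
  have hB : MulAction.IsBlock G {v | Γ.Reachable x v} := by
    rw [MulAction.isBlock_iff_smul_eq_of_nonempty]
    rintro g ⟨w, ⟨v, hv, rfl⟩, hw⟩
    have h1 : Γ.Reachable x (g • x) := hw.trans (hre g _ _ hv).symm
    ext u
    rw [Set.mem_smul_set_iff_inv_smul_mem]
    constructor
    · intro h
      have := hre g _ _ h
      rw [smul_inv_smul] at this
      exact h1.trans this
    · intro h
      have := hre g⁻¹ _ _ (h1.symm.trans h)
      rwa [inv_smul_smul] at this
  rcases MulAction.IsPreprimitive.isTrivialBlock_of_isBlock hB with h | h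
  · exact absurd (h (SimpleGraph.Reachable.refl x) hadj.reachable) hxy
  · have : Nonempty Ω := ⟨x⟩
    refine ⟨fun u v => ?_⟩
    have hu : u ∈ {v | Γ.Reachable x v} := h ▸ Set.mem_univ u
    have hv : v ∈ {v | Γ.Reachable x v} := h ▸ Set.mem_univ v
    exact hu.symm.trans hv

theorem card_distinguishing_le_dist_mul [MulAction.IsPreprimitive G Ω] {x y : Ω} (hxy : x ≠ y)
    (u v : Ω) : (distinguishing G u v).card ≤
      (orbitalGraph G x y).dist u v * (distinguishing G x y).card := by
  obtain ⟨p, hp⟩ := (orbitalGraph_connected (G := G) hxy).exists_walk_length_eq_dist u v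
  rw [← hp]
  clear hp
  induction p with
  | nil => simp [distinguishing_self]
  | @cons a b c h p ih =>
    have h1 : (distinguishing G a b).card = (distinguishing G x y).card := by
      rcases (orbitalGraph_adj.1 h).2 with ⟨g, rfl, rfl⟩ | ⟨g, rfl, rfl⟩
      · exact card_distinguishing_smul g x y
      · rw [distinguishing_comm]
        exact card_distinguishing_smul g x y
    have := card_distinguishing_triangle (G := G) a b c
    rw [SimpleGraph.Walk.length_cons, add_mul, one_mul]
    omega

theorem dist_le_card_distinguishing [MulAction.IsPreprimitive G Ω] {x y : Ω} (hxy : x ≠ y)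
    (u v : Ω) : (orbitalGraph G x y).dist u v ≤ (distinguishing G x y).card := by
  set Γ := orbitalGraph G x y with hΓ
  have hconn : Γ.Connected := orbitalGraph_connected hxy
  have hdist : ∀ (g : G) a b, Γ.dist (g • a) (g • b) = Γ.dist a b := by
    have key : ∀ (g : G) a b, Γ.dist (g • a) (g • b) ≤ Γ.dist a b := by
      intro g a b
      obtain ⟨p, hp⟩ := hconn.exists_walk_length_eq_dist a b
      rw [← hp, ← SimpleGraph.Walk.length_map (orbitalGraphHom x y g) p]
      exact SimpleGraph.dist_le _
    refine fun g a b => le_antisymm (key g a b) ?_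
    have := key g⁻¹ (g • a) (g • b)
    rwa [inv_smul_smul, inv_smul_smul] at this
  obtain ⟨p, hp⟩ := hconn.exists_walk_length_eq_dist u v
  rcases p with _ | @⟨_, w, _, h, p⟩
  · simp
  rw [SimpleGraph.Walk.length_cons] at hp
  have h1 : (distinguishing G u w).card = (distinguishing G x y).card := by
    rcases (orbitalGraph_adj.1 h).2 with ⟨g, rfl, rfl⟩ | ⟨g, rfl, rfl⟩
    · exact card_distinguishing_smul g x y
    · rw [distinguishing_comm]
      exact card_distinguishing_smul g x y
  rw [← h1, ← hp]
  have hpu : ∀ i ≤ p.length, Γ.dist u (p.getVert i) = i + 1 ∧ Γ.dist w (p.getVert i) ≤ i := by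
    intro i hi
    have ha : Γ.dist w (p.getVert i) ≤ i := by
      refine (SimpleGraph.dist_le (p.take i)).trans ?_
      rw [SimpleGraph.Walk.take_length]
      exact min_le_left _ _
    have hb : Γ.dist (p.getVert i) v ≤ p.length - i := by
      refine (SimpleGraph.dist_le (p.drop i)).trans ?_
      rw [SimpleGraph.Walk.drop_length]
    have hc : Γ.dist u w = 1 := SimpleGraph.dist_eq_one_iff_adj.2 h
    have hd := hconn.dist_triangle (u := u) (v := w) (w := p.getVert i)
    have he := hconn.dist_triangle (u := u) (v := p.getVert i) (w := v)
    omega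
  have hinj : Set.InjOn p.getVert (Finset.range (p.length + 1) : Set ℕ) := by
    intro i hi j hj hij
    have h2 := (hpu i (by simpa [Nat.lt_succ_iff] using hi)).1
    have h3 := (hpu j (by simpa [Nat.lt_succ_iff] using hj)).1
    rw [hij] at h2
    omega
  classical
  rw [← Finset.card_range (p.length + 1), ← Finset.card_image_of_injOn hinj]
  refine Finset.card_le_card fun z hz => ?_
  obtain ⟨i, hi, rfl⟩ := Finset.mem_image.1 hz
  obtain ⟨h2, h3⟩ := hpu i (by simpa [Nat.lt_succ_iff] using hi)
  rw [mem_distinguishing]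
  rintro ⟨g, hg1, hg2⟩
  have := hdist g u (p.getVert i)
  rw [hg1, hg2] at this
  omega

theorem exists_card_distinguishing_sq [MulAction.IsPreprimitive G Ω] [Nontrivial Ω]
    (h2 : ¬ ∀ a b c d : Ω, a ≠ b → c ≠ d → SameOrbital G a b c d) :
    ∃ u v : Ω, Fintype.card Ω ≤ 2 * (distinguishing G u v).card ^ 2 := by
  classical
  obtain ⟨a0, b0, hab0⟩ := exists_pair_ne Ω
  -- an orbital of maximal valency
  let f : Ω × Ω → ℕ := fun q => (Finset.univ.filter fun w => SameOrbital G q.1 q.2 q.1 w).card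
  obtain ⟨⟨z0, w0⟩, hq, hmax⟩ := Finset.exists_max_image
    (Finset.univ.filter fun q : Ω × Ω => q.1 ≠ q.2) f
    ⟨(a0, b0), by simpa using hab0⟩
  simp only [Finset.mem_filter, Finset.mem_univ, true_and] at hq
  have hfpos : 1 ≤ f (z0, w0) := Finset.card_pos.2 ⟨w0, by simp [SameOrbital.refl]⟩
  have hmax' : ∀ z w, f (z, w) ≤ f (z0, w0) := by
    intro z w
    by_cases hzw : z = w
    · refine le_trans ?_ hfpos
      refine Finset.card_le_one.2 fun a ha b hb => ?_
      simp only [Finset.mem_filter, Finset.mem_univ, true_and] at ha hb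
      subst hzw
      obtain ⟨g, h1, rfl⟩ := ha
      obtain ⟨k, h3, rfl⟩ := hb
      rw [h1, h3]
    · exact hmax (z, w) (by simpa using hzw)
  let R : Ω → Finset Ω := fun z => Finset.univ.filter fun w => ¬ SameOrbital G z0 w0 z w
  have hR : ∀ z w, w ∈ R z ↔ ¬ SameOrbital G z0 w0 z w := fun z w => by simp [R]
  have hRg : ∀ (g : G) z w, g • w ∈ R (g • z) ↔ w ∈ R z := fun g z w => by
    rw [hR, hR, sameOrbital_smul_iff']
  have hzR : ∀ z, z ∈ R z := by
    intro z
    rw [hR]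
    rintro ⟨g, h1, h3⟩
    exact hq (smul_left_cancel g (h1.trans h3.symm))
  have htr : MulAction.IsPretransitive G Ω := inferInstance
  have hRcard : ∀ z, (R z).card = (R z0).card := by
    intro z
    obtain ⟨g, rfl⟩ := htr.exists_smul_eq z0 z
    refine (Finset.card_bij (fun w _ => g • w) ?_ ?_ ?_).symm
    · exact fun w hw => (hRg g _ _).2 hw
    · exact fun a _ b _ h => smul_left_cancel g h
    · exact fun w hw => ⟨g⁻¹ • w, by rwa [← hRg g, smul_inv_smul], smul_inv_smul g w⟩
  have hfR : f (z0, w0) + (R z0).card = Fintype.card Ω :=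
    Finset.card_filter_add_card_filter_not _
  -- some pair is distinguished by at least `|R|` points
  obtain ⟨⟨u, v⟩, -, huv⟩ : ∃ q ∈ (Finset.univ : Finset (Ω × Ω)),
      (R z0).card ≤ (distinguishing G q.1 q.2).card := by
    by_contra! hcon
    have h3 : ∑ q : Ω × Ω, (distinguishing G q.1 q.2).card < ∑ q : Ω × Ω, (R z0).card :=
      Finset.sum_lt_sum_of_nonempty ⟨(z0, w0), Finset.mem_univ _⟩ hcon
    rw [Finset.sum_const, Finset.card_univ, Fintype.card_prod, smul_eq_mul] at h3
    have h4 : ∑ q : Ω × Ω, (distinguishing G q.1 q.2).card =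
        ∑ z : Ω, ∑ u : Ω, (Finset.univ.filter fun v => ¬ SameOrbital G u z v z).card := by
      rw [Fintype.sum_prod_type]
      simp only [distinguishing, Finset.card_filter]
      exact (Finset.sum_congr rfl fun u _ => Finset.sum_comm).trans Finset.sum_comm
    have h5 : ∀ z u : Ω, (R z0).card ≤
        (Finset.univ.filter fun v => ¬ SameOrbital G u z v z).card := by
      intro z u
      have h6 : (Finset.univ.filter fun v => SameOrbital G u z v z).card +
        (Finset.univ.filter fun v => ¬ SameOrbital G u z v z).card = Fintype.card Ω :=
        Finset.card_filter_add_card_filter_not _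
      have h7 := hmax' z u
      have h8 : f (z, u) = (Finset.univ.filter fun v => SameOrbital G u z v z).card := by
        refine congrArg Finset.card (Finset.filter_congr fun w _ => ?_)
        exact ⟨fun ⟨g, a, b⟩ => ⟨g, b, a⟩, fun ⟨g, a, b⟩ => ⟨g, b, a⟩⟩
      omega
    rw [h4] at h3
    have h9 : ∑ z : Ω, ∑ u : Ω, (R z0).card ≤
        ∑ z : Ω, ∑ u : Ω, (Finset.univ.filter fun v => ¬ SameOrbital G u z v z).card :=
      Finset.sum_le_sum fun z _ => Finset.sum_le_sum fun u _ => h5 z u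
    simp only [Finset.sum_const, Finset.card_univ, smul_eq_mul] at h9
    rw [← mul_assoc] at h9
    omega
  refine ⟨u, v, ?_⟩
  refine le_trans ?_ (Nat.mul_le_mul_left 2 (Nat.pow_le_pow_left huv 2))
  -- the complement of the maximal orbital is not transitive
  have hnb : ∃ z, ∃ u ∈ R z, ¬ R u ⊆ R z := by
    by_contra! hcon
    have heq : ∀ z, ∀ u ∈ R z, R u = R z := fun z u hu =>
      Finset.eq_of_subset_of_card_le (hcon z u hu) (by rw [hRcard z, hRcard u])
    have hB : MulAction.IsBlock G (R z0 : Set Ω) := by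
      rw [MulAction.isBlock_iff_smul_eq_of_nonempty]
      rintro g ⟨x, ⟨y, hy, rfl⟩, hx⟩
      have h3 : R (g • z0) = R z0 := (heq (g • z0) (g • y) ((hRg g _ _).2 hy)).symm.trans
        (heq _ _ hx)
      ext w
      rw [Set.mem_smul_set_iff_inv_smul_mem, Finset.mem_coe, Finset.mem_coe, ← hRg g,
        smul_inv_smul, h3]
    rcases MulAction.IsPreprimitive.isTrivialBlock_of_isBlock hB with h | h
    · apply h2
      have h3 : ∀ z w, z ≠ w → SameOrbital G z0 w0 z w := by
        intro z w hzw
        by_contra hcon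
        obtain ⟨g, rfl⟩ := htr.exists_smul_eq z0 z
        have h4 : g⁻¹ • w ∈ R z0 := by
          rw [← hRg g, smul_inv_smul, hR]
          exact hcon
        have h5 := h (Finset.mem_coe.2 (hzR z0)) (Finset.mem_coe.2 h4)
        exact hzw (by rw [h5, smul_inv_smul])
      exact fun a b c d hab hcd => (h3 a b hab).symm.trans (h3 c d hcd)
    · have h3 : w0 ∈ (R z0 : Set Ω) := h ▸ Set.mem_univ _
      exact (hR _ _).1 h3 (SameOrbital.refl _ _)
  obtain ⟨z, u, hu, hnot⟩ := hnb
  obtain ⟨w, hw, hwz⟩ := Finset.not_subset.1 hnot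
  rw [hR, not_not] at hwz
  have hcov : (Finset.univ.filter fun w => SameOrbital G z0 w0 z w) ⊆ (R z).biUnion R := by
    intro w' hw'
    simp only [Finset.mem_filter, Finset.mem_univ, true_and] at hw'
    obtain ⟨g, hg1, rfl⟩ := hwz.symm.trans hw'
    refine Finset.mem_biUnion.2 ⟨g • u, ?_, (hRg g _ _).2 hw⟩
    have h3 := (hRg g z u).2 hu
    rwa [hg1] at h3
  have h3 : (Finset.univ.filter fun w => SameOrbital G z0 w0 z w).card + (R z).card
      = Fintype.card Ω := Finset.card_filter_add_card_filter_not _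
  have h4 := (Finset.card_le_card hcov).trans (Finset.card_biUnion_le_card_mul _ _ _
    fun x _ => (hRcard x).le)
  rw [hRcard z] at h3 h4
  have h5 : 1 ≤ (R z0).card := Finset.card_pos.2 ⟨z0, hzR z0⟩
  nlinarith

theorem card_le_card_distinguishing_pow [MulAction.IsPreprimitive G Ω]
    (h2 : ¬ ∀ a b c d : Ω, a ≠ b → c ≠ d → SameOrbital G a b c d) {x y : Ω} (hxy : x ≠ y) :
    Fintype.card Ω ≤ 2 * (distinguishing G x y).card ^ 4 := by
  have : Nontrivial Ω := ⟨x, y, hxy⟩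
  obtain ⟨u, v, h⟩ := exists_card_distinguishing_sq h2
  have h1 := card_distinguishing_le_dist_mul (G := G) hxy u v
  have h3 := dist_le_card_distinguishing (G := G) hxy u v
  have h4 : (distinguishing G u v).card ≤ (distinguishing G x y).card ^ 2 := by
    rw [pow_two]
    exact h1.trans (Nat.mul_le_mul_right _ h3)
  calc _ ≤ _ := h
    _ ≤ 2 * ((distinguishing G x y).card ^ 2) ^ 2 :=
      Nat.mul_le_mul_left 2 (Nat.pow_le_pow_left h4 2)
    _ = _ := by rw [← pow_mul]

/-- A primitive group that is not doubly transitive has a small base. -/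
theorem exists_base_of_uniprimitive [MulAction.IsPreprimitive G Ω] [Nontrivial Ω]
    (h2 : ¬ ∀ a b c d : Ω, a ≠ b → c ≠ d → SameOrbital G a b c d) :
    ∃ Z : Finset Ω, IsActionBase G Z ∧
      (Z.card : ℝ) ≤ 6 * (Fintype.card Ω : ℝ) ^ (3 / 4 : ℝ) * Real.log (Fintype.card Ω) := by
  classical
  set n := Fintype.card Ω with hn
  have hn2 : 2 ≤ n := Fintype.one_lt_card
  have hn0 : (0 : ℝ) < n := by positivity
  set d := ⌈((n : ℝ) / 2) ^ (1 / 4 : ℝ)⌉₊ with hd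
  have hdpos : 0 < d := Nat.ceil_pos.2 (by positivity)
  obtain ⟨Z, hZ, hZA⟩ := exists_hitting (U := Ω) (ι := {q : Ω × Ω // q.1 ≠ q.2})
    (fun q => distinguishing G q.1.1 q.1.2) hdpos (by
      rintro ⟨⟨x, y⟩, hxy⟩
      have h := card_le_card_distinguishing_pow h2 hxy
      refine Nat.ceil_le.2 ?_
      have h3 : (n : ℝ) / 2 ≤ ((distinguishing G x y).card : ℝ) ^ 4 := by
        have : (n : ℝ) ≤ 2 * ((distinguishing G x y).card : ℝ) ^ 4 := by exact_mod_cast h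
        linarith
      calc ((n : ℝ) / 2) ^ (1 / 4 : ℝ)
          ≤ (((distinguishing G x y).card : ℝ) ^ 4) ^ (1 / 4 : ℝ) :=
            Real.rpow_le_rpow (by positivity) h3 (by norm_num)
        _ = _ := by
          rw [← Real.rpow_natCast, ← Real.rpow_mul (by positivity)]
          norm_num)
  refine ⟨Z, isActionBase_of_distinguishing fun x y hxy => hZA ⟨(x, y), hxy⟩, hZ.trans ?_⟩
  rw [← hn]
  have hlog2 : (1 : ℝ) / 2 ≤ Real.log 2 := by linarith [Real.log_two_gt_d9]
  have hlogn : Real.log 2 ≤ Real.log n := Real.log_le_log (by norm_num) (by exact_mod_cast hn2)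
  have h3 : Real.log (Fintype.card {q : Ω × Ω // q.1 ≠ q.2}) ≤ 2 * Real.log n := by
    have h4 : Fintype.card {q : Ω × Ω // q.1 ≠ q.2} ≤ n ^ 2 := by
      refine (Fintype.card_subtype_le _).trans ?_
      rw [Fintype.card_prod, pow_two]
    have h5 : Real.log ((n : ℝ) ^ 2) = 2 * Real.log n := by
      rw [Real.log_pow]; norm_num
    rw [← h5]
    obtain ⟨x, y, hxy⟩ := exists_pair_ne Ω
    refine Real.log_le_log ?_ (by exact_mod_cast h4)
    have : 0 < Fintype.card {q : Ω × Ω // q.1 ≠ q.2} := Fintype.card_pos_iff.2 ⟨⟨(x, y), hxy⟩⟩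
    exact_mod_cast this
  have h4 : (n : ℝ) / d ≤ 2 * (n : ℝ) ^ (3 / 4 : ℝ) := by
    have h5 : ((n : ℝ) / 2) ^ (1 / 4 : ℝ) ≤ d := Nat.le_ceil _
    have h6 : (n : ℝ) ^ (1 / 4 : ℝ) / 2 ≤ ((n : ℝ) / 2) ^ (1 / 4 : ℝ) := by
      rw [Real.div_rpow hn0.le (by norm_num)]
      refine div_le_div_of_nonneg_left (by positivity) (by positivity) ?_
      calc (2 : ℝ) ^ (1 / 4 : ℝ) ≤ 2 ^ (1 : ℝ) :=
            Real.rpow_le_rpow_of_exponent_le (by norm_num) (by norm_num)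
        _ = 2 := by norm_num
    have h7 : (n : ℝ) = (n : ℝ) ^ (3 / 4 : ℝ) * (n : ℝ) ^ (1 / 4 : ℝ) := by
      rw [← Real.rpow_add hn0]
      norm_num
    rw [div_le_iff₀ (by exact_mod_cast hdpos)]
    calc (n : ℝ) = (n : ℝ) ^ (3 / 4 : ℝ) * (n : ℝ) ^ (1 / 4 : ℝ) := h7
      _ ≤ (n : ℝ) ^ (3 / 4 : ℝ) * (2 * d) :=
        mul_le_mul_of_nonneg_left (by linarith) (by positivity)
      _ = _ := by ring
  have h8 : (1 : ℝ) ≤ (n : ℝ) ^ (3 / 4 : ℝ) :=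
    Real.one_le_rpow (by exact_mod_cast (by omega : 1 ≤ n)) (by norm_num)
  have h9 : (n : ℝ) / d * Real.log (Fintype.card {q : Ω × Ω // q.1 ≠ q.2})
      ≤ 2 * (n : ℝ) ^ (3 / 4 : ℝ) * (2 * Real.log n) :=
    (mul_le_mul_of_nonneg_left h3 (by positivity)).trans
      (mul_le_mul_of_nonneg_right h4 (by linarith))
  have h10 : (1 : ℝ) ≤ 2 * (n : ℝ) ^ (3 / 4 : ℝ) * Real.log n := by nlinarith
  linarith

end Uniprimitive

section DoublyTransitive

variable {G Ω : Type*} [Group G] [MulAction G Ω]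

variable (G) in
/-- Two triples of points lie in the same orbit. -/
def SameTriple (a b c a' b' c' : Ω) : Prop := ∃ g : G, g • a = a' ∧ g • b = b' ∧ g • c = c'

namespace SameTriple

theorem refl (a b c : Ω) : SameTriple G a b c a b c := ⟨1, by simp, by simp, by simp⟩

theorem symm {a b c a' b' c' : Ω} (h : SameTriple G a b c a' b' c') :
    SameTriple G a' b' c' a b c := by
  obtain ⟨g, rfl, rfl, rfl⟩ := h
  exact ⟨g⁻¹, by simp, by simp, by simp⟩

theorem trans {a b c a' b' c' a'' b'' c'' : Ω} (h : SameTriple G a b c a' b' c')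
    (h' : SameTriple G a' b' c' a'' b'' c'') : SameTriple G a b c a'' b'' c'' := by
  obtain ⟨g, rfl, rfl, rfl⟩ := h
  obtain ⟨k, rfl, rfl, rfl⟩ := h'
  exact ⟨k * g, by simp [mul_smul], by simp [mul_smul], by simp [mul_smul]⟩

theorem smul (g : G) (a b c : Ω) : SameTriple G a b c (g • a) (g • b) (g • c) :=
  ⟨g, rfl, rfl, rfl⟩

theorem smul_right_iff (g : G) {a b c a' b' c' : Ω} :
    SameTriple G a b c (g • a') (g • b') (g • c') ↔ SameTriple G a b c a' b' c' :=
  ⟨fun h => h.trans (smul g _ _ _).symm, fun h => h.trans (smul g _ _ _)⟩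

theorem smul_left_iff (g : G) {a b c a' b' c' : Ω} :
    SameTriple G (g • a) (g • b) (g • c) a' b' c' ↔ SameTriple G a b c a' b' c' :=
  ⟨fun h => (smul g _ _ _).trans h, fun h => (smul g _ _ _).symm.trans h⟩

end SameTriple

variable [Fintype Ω]

theorem sum_sum_eq_of_offDiag {F : Ω → Ω → ℕ} {X : ℕ} (h0 : ∀ a, F a a = 0)
    (hX : ∀ a b, a ≠ b → F a b = X) :
    ∑ a, ∑ b, F a b = Fintype.card Ω * (Fintype.card Ω - 1) * X := by
  classical
  have h : ∀ a, ∑ b, F a b = (Fintype.card Ω - 1) * X := by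
    intro a
    rw [← Finset.add_sum_erase _ _ (Finset.mem_univ a), h0, zero_add,
      Finset.sum_congr rfl fun b hb => hX a b (Finset.ne_of_mem_erase hb).symm, Finset.sum_const,
      Finset.card_erase_of_mem (Finset.mem_univ a), Finset.card_univ, smul_eq_mul]
  rw [Finset.sum_congr rfl fun a _ => h a, Finset.sum_const, Finset.card_univ, smul_eq_mul,
    mul_assoc]

theorem card_filter_smul (g : G) {P P' : Ω → Prop} [DecidablePred P] [DecidablePred P']
    (h : ∀ x, P' (g • x) ↔ P x) :
    (Finset.univ.filter P').card = (Finset.univ.filter P).card := by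
  refine (Finset.card_bij (fun x _ => g • x) ?_ ?_ ?_).symm
  · simp [h]
  · exact fun _ _ _ _ e => smul_left_cancel g e
  · intro x hx
    refine ⟨g⁻¹ • x, ?_, smul_inv_smul g x⟩
    simp only [Finset.mem_filter, Finset.mem_univ, true_and] at hx ⊢
    rwa [← h, smul_inv_smul]

open Classical in
theorem card_filter_constant (h2 : ∀ a b c d : Ω, a ≠ b → c ≠ d → SameOrbital G a b c d)
    {Q : Ω → Ω → Ω → Prop} (hQ : ∀ (g : G) a b c, Q (g • a) (g • b) (g • c) ↔ Q a b c)
    {a b c d : Ω} (hab : a ≠ b) (hcd : c ≠ d) :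
    (Finset.univ.filter (Q a b)).card = (Finset.univ.filter (Q c d)).card := by
  obtain ⟨g, rfl, rfl⟩ := h2 a b c d hab hcd
  exact (card_filter_smul g fun x => hQ g a b x).symm

open Classical in
/-- For a doubly transitive group the number of completions of a pair to a triple in a given
invariant set does not depend on the positions. -/
theorem card_filter_positions (h2 : ∀ a b c d : Ω, a ≠ b → c ≠ d → SameOrbital G a b c d)
    {Q : Ω → Ω → Ω → Prop} (hQ : ∀ (g : G) a b c, Q (g • a) (g • b) (g • c) ↔ Q a b c)
    (hne : ∀ a b c, Q a b c → a ≠ b ∧ a ≠ c ∧ b ≠ c) {β : ℕ}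
    (hβ : ∀ a b, a ≠ b → (Finset.univ.filter (Q a b)).card = β) :
    (∀ b c, b ≠ c → (Finset.univ.filter fun a => Q a b c).card = β) ∧
    (∀ a c, a ≠ c → (Finset.univ.filter fun b => Q a b c).card = β) := by
  have hsum : ∑ a, ∑ b, ∑ c, (if Q a b c then 1 else 0)
      = Fintype.card Ω * (Fintype.card Ω - 1) * β := by
    refine sum_sum_eq_of_offDiag (F := fun a b => ∑ c, (if Q a b c then 1 else 0)) ?_ ?_
    · intro a
      exact Finset.sum_eq_zero fun c _ => if_neg fun h => (hne _ _ _ h).1 rfl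
    · intro a b hab
      rw [← hβ a b hab, Finset.card_filter]
  constructor
  · intro b c hbc
    have hpos : 0 < Fintype.card Ω * (Fintype.card Ω - 1) := by
      have : 1 < Fintype.card Ω := Fintype.one_lt_card_iff.2 ⟨b, c, hbc⟩
      exact Nat.mul_pos (by omega) (by omega)
    refine Nat.eq_of_mul_eq_mul_left hpos ?_
    rw [← hsum, Finset.sum_comm, Finset.sum_congr rfl fun b _ => Finset.sum_comm]
    refine (sum_sum_eq_of_offDiag (F := fun b c => ∑ a, (if Q a b c then 1 else 0)) ?_ ?_).symm
    · intro a
      exact Finset.sum_eq_zero fun c _ => if_neg fun h => (hne _ _ _ h).2.2 rfl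
    · intro b' c' hbc'
      rw [← Finset.card_filter]
      exact card_filter_constant h2 (Q := fun b c a => Q a b c) (fun g a b c => hQ g c a b)
        hbc' hbc
  · intro a c hac
    have hpos : 0 < Fintype.card Ω * (Fintype.card Ω - 1) := by
      have : 1 < Fintype.card Ω := Fintype.one_lt_card_iff.2 ⟨a, c, hac⟩
      exact Nat.mul_pos (by omega) (by omega)
    refine Nat.eq_of_mul_eq_mul_left hpos ?_
    rw [← hsum, Finset.sum_congr rfl fun b _ => Finset.sum_comm]
    refine (sum_sum_eq_of_offDiag (F := fun a c => ∑ b, (if Q a b c then 1 else 0)) ?_ ?_).symm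
    · intro a
      exact Finset.sum_eq_zero fun c _ => if_neg fun h => (hne _ _ _ h).2.1 rfl
    · intro a' c' hac'
      rw [← Finset.card_filter]
      exact card_filter_constant h2 (Q := fun a c b => Q a b c) (fun g a b c => hQ g a c b)
        hac' hac

open Classical in
variable (G) in
/-- The pairs of points distinguishing `x` from `y`. -/
noncomputable def distinguishingPairs (x y : Ω) : Finset (Ω × Ω) :=
  Finset.univ.filter fun q => ¬ SameTriple G q.1 x q.2 q.1 y q.2

open Classical in
variable (G) in
/-- The points distinguishing `x` from `y` relative to the point `z`. -/
noncomputable def distinguishingAt (z x y : Ω) : Finset Ω :=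
  Finset.univ.filter fun w => ¬ SameTriple G z x w z y w

theorem mem_distinguishingPairs {x y : Ω} {q : Ω × Ω} :
    q ∈ distinguishingPairs G x y ↔ ¬ SameTriple G q.1 x q.2 q.1 y q.2 := by
  simp [distinguishingPairs]

theorem mem_distinguishingAt {x y z w : Ω} :
    w ∈ distinguishingAt G z x y ↔ ¬ SameTriple G z x w z y w := by
  simp [distinguishingAt]

open Classical in
/-- The basic counting data of a group that is doubly but not triply transitive. -/
theorem exists_triple_relation
    (h2 : ∀ a b c d : Ω, a ≠ b → c ≠ d → SameOrbital G a b c d)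
    (h3 : ¬ ∀ a b c a' b' c' : Ω, a ≠ b → a ≠ c → b ≠ c → a' ≠ b' → a' ≠ c' → b' ≠ c' →
      SameTriple G a b c a' b' c') :
    ∃ (Q : Ω → Ω → Ω → Prop) (β : ℕ), 1 ≤ β ∧
      (∀ (g : G) a b c, Q (g • a) (g • b) (g • c) ↔ Q a b c) ∧
      (∀ a b c, Q a b c → a ≠ b ∧ a ≠ c ∧ b ≠ c) ∧
      (∀ a b, a ≠ b → (Finset.univ.filter (Q a b)).card = β) ∧
      (∀ z x y w, z ≠ y → y ≠ w → Q z x w → SameTriple (Ω := Ω) G z x w z y w → Q z y w) ∧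
      (∀ z x w, z ≠ x → z ≠ w → x ≠ w → β ≤ (Finset.univ.filter fun y =>
        ¬ SameTriple (Ω := Ω) G z x w z y w).card) := by
  push Not at h3
  obtain ⟨a1, b1, c1, a2, b2, c2, hab1, hac1, hbc1, hab2, hac2, hbc2, h12⟩ := h3
  let f : Ω × Ω × Ω → ℕ := fun q =>
    (Finset.univ.filter fun w => SameTriple G q.1 q.2.1 q.2.2 q.1 q.2.1 w).card
  obtain ⟨⟨a0, b0, c0⟩, hq, hmax⟩ := Finset.exists_max_image
    (Finset.univ.filter fun q : Ω × Ω × Ω => q.1 ≠ q.2.1 ∧ q.1 ≠ q.2.2 ∧ q.2.1 ≠ q.2.2) f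
    ⟨(a1, b1, c1), by simp [hab1, hac1, hbc1]⟩
  simp only [Finset.mem_filter, Finset.mem_univ, true_and] at hq
  obtain ⟨hab0, hac0, hbc0⟩ := hq
  obtain ⟨Q, hQdef⟩ : ∃ Q : Ω → Ω → Ω → Prop, ∀ a b c, Q a b c ↔
      (a ≠ b ∧ a ≠ c ∧ b ≠ c) ∧ ¬ SameTriple G a0 b0 c0 a b c := ⟨_, fun _ _ _ => Iff.rfl⟩
  have hQ : ∀ (g : G) a b c, Q (g • a) (g • b) (g • c) ↔ Q a b c := by
    intro g a b c
    simp only [hQdef, SameTriple.smul_right_iff, ne_eq, smul_left_cancel_iff]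
  have hβ := fun a b (hab : a ≠ b) => card_filter_constant h2 hQ hab hab0
  refine ⟨Q, (Finset.univ.filter (Q a0 b0)).card, ?_, hQ, fun a b c h => ((hQdef _ _ _).1 h).1, hβ, ?_, ?_⟩
  · obtain ⟨a, b, c, h⟩ : ∃ a b c, Q a b c := by
      by_contra! hcon
      have ha : SameTriple G a0 b0 c0 a1 b1 c1 := by
        by_contra h; exact hcon _ _ _ ((hQdef _ _ _).2 ⟨⟨hab1, hac1, hbc1⟩, h⟩)
      have hb : SameTriple G a0 b0 c0 a2 b2 c2 := by
        by_contra h; exact hcon _ _ _ ((hQdef _ _ _).2 ⟨⟨hab2, hac2, hbc2⟩, h⟩)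
      exact h12 (ha.symm.trans hb)
    rw [← hβ a b ((hQdef _ _ _).1 h).1.1]
    exact Finset.card_pos.2 ⟨c, by simpa using h⟩
  · intro z x y w hzy hyw h hs
    rw [hQdef] at h ⊢
    exact ⟨⟨hzy, h.1.2.1, hyw⟩, fun h' => h.2 (h'.trans hs.symm)⟩
  · intro z x w hzx hzw hxw
    have e1 : (Finset.univ.filter fun y => SameTriple G z x w z y w).card +
        (Finset.univ.filter fun y => ¬ SameTriple G z x w z y w).card = Fintype.card Ω :=
      Finset.card_filter_add_card_filter_not _
    have e2 : (Finset.univ.filter fun y => SameTriple G z x w z y w).card = f (z, w, x) := by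
      refine congrArg Finset.card (Finset.filter_congr fun y _ => ?_)
      exact ⟨fun ⟨g, a, b, c⟩ => ⟨g, a, c, b⟩, fun ⟨g, a, b, c⟩ => ⟨g, a, c, b⟩⟩
    have e3 := hmax (z, w, x) (by simp [hzx, hzw, hxw.symm])
    have e4 : f (a0, b0, c0) + (Finset.univ.filter fun y =>
        ¬ SameTriple G a0 b0 c0 a0 b0 y).card = Fintype.card Ω :=
      Finset.card_filter_add_card_filter_not _
    have e5 : (Finset.univ.filter (Q a0 b0)).card ≤ (Finset.univ.filter fun y =>
        ¬ SameTriple G a0 b0 c0 a0 b0 y).card := by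
      refine Finset.card_le_card fun y hy => ?_
      simp only [Finset.mem_filter, Finset.mem_univ, true_and, hQdef] at hy ⊢
      exact hy.2
    omega

open Classical in
theorem mul_le_card_distinguishingPairs
    (h2 : ∀ a b c d : Ω, a ≠ b → c ≠ d → SameOrbital G a b c d) {β : ℕ}
    (hβ : ∀ z x w : Ω, z ≠ x → z ≠ w → x ≠ w → β ≤ (Finset.univ.filter fun y : Ω =>
      ¬ SameTriple G z x w z y w).card) {x y : Ω} (hxy : x ≠ y) :
    (Fintype.card Ω - 2) * β ≤ (distinguishingPairs G x y).card := by
  set n := Fintype.card Ω with hn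
  have hn2 : 1 < n := Fintype.one_lt_card_iff.2 ⟨x, y, hxy⟩
  have hpos : 0 < n * (n - 1) := Nat.mul_pos (by omega) (by omega)
  refine Nat.le_of_mul_le_mul_left ?_ hpos
  have e1 : ∑ a : Ω, ∑ b : Ω, (distinguishingPairs G a b).card
      = n * (n - 1) * (distinguishingPairs G x y).card := by
    refine sum_sum_eq_of_offDiag ?_ ?_
    · exact fun a => by simp [distinguishingPairs, SameTriple.refl]
    · intro a b hab
      obtain ⟨g, rfl, rfl⟩ := h2 x y a b hxy hab
      refine card_filter_smul (G := G) (Ω := Ω × Ω) g fun q => ?_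
      simp only [Prod.smul_fst, Prod.smul_snd, SameTriple.smul_right_iff,
        SameTriple.smul_left_iff]
  have e2 : ∑ a : Ω, ∑ b : Ω, (distinguishingPairs G a b).card = ∑ z : Ω, ∑ w : Ω, ∑ a : Ω,
      (Finset.univ.filter fun b => ¬ SameTriple G z a w z b w).card := by
    simp only [distinguishingPairs, Finset.card_filter, Fintype.sum_prod_type]
    calc _ = ∑ a, ∑ z, ∑ b, ∑ w, (if ¬ SameTriple G z a w z b w then 1 else 0) :=
          Finset.sum_congr rfl fun a _ => Finset.sum_comm
      _ = ∑ z, ∑ a, ∑ w, ∑ b, (if ¬ SameTriple G z a w z b w then 1 else 0) := by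
          rw [Finset.sum_comm]
          exact Finset.sum_congr rfl fun z _ => Finset.sum_congr rfl fun a _ => Finset.sum_comm
      _ = _ := Finset.sum_congr rfl fun z _ => Finset.sum_comm
  have e3 : ∑ z : Ω, ∑ w : Ω, (if z = w then 0 else (n - 2) * β)
      = n * (n - 1) * ((n - 2) * β) :=
    sum_sum_eq_of_offDiag (by simp) fun a b hab => if_neg hab
  rw [← e1, e2, ← e3]
  refine Finset.sum_le_sum fun z _ => Finset.sum_le_sum fun w _ => ?_
  split_ifs with hzw
  · exact Nat.zero_le _
  have e4 : ((Finset.univ.erase z).erase w).card = n - 2 := by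
    rw [Finset.card_erase_of_mem (Finset.mem_erase.2 ⟨Ne.symm hzw, Finset.mem_univ _⟩),
      Finset.card_erase_of_mem (Finset.mem_univ _), Finset.card_univ]
    omega
  rw [← e4, ← smul_eq_mul, ← Finset.sum_const]
  refine (Finset.sum_le_sum fun a ha => ?_).trans
    (Finset.sum_le_sum_of_subset (Finset.subset_univ _))
  simp only [Finset.mem_erase, Finset.mem_univ, and_true] at ha
  exact hβ z a w ha.2.symm hzw ha.1

open Classical in
theorem card_filter_distinguishingAt_subset_le
    (h2 : ∀ a b c d : Ω, a ≠ b → c ≠ d → SameOrbital G a b c d)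
    {Q : Ω → Ω → Ω → Prop} {β : ℕ} (hβ1 : 1 ≤ β)
    (hQ : ∀ (g : G) a b c, Q (g • a) (g • b) (g • c) ↔ Q a b c)
    (hne : ∀ a b c, Q a b c → a ≠ b ∧ a ≠ c ∧ b ≠ c)
    (hβ : ∀ a b, a ≠ b → (Finset.univ.filter (Q a b)).card = β)
    (hs : ∀ z x y w : Ω, z ≠ y → y ≠ w → Q z x w → SameTriple G z x w z y w → Q z y w)
    {x y : Ω} (hxy : x ≠ y) (W : Finset Ω) :
    (Finset.univ.filter fun z => distinguishingAt G z x y ⊆ W).card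
      ≤ 2 + W.card * β + β + β ^ 2 := by
  obtain ⟨hp1, hp2⟩ := card_filter_positions h2 hQ hne hβ
  set n := Fintype.card Ω with hn
  have hn2 : 1 < n := Fintype.one_lt_card_iff.2 ⟨x, y, hxy⟩
  have hpos : 0 < n * (n - 1) := Nat.mul_pos (by omega) (by omega)
  let M : Ω → Ω → Finset (Ω × Ω) := fun a b =>
    Finset.univ.filter fun q => a ≠ b ∧ Q q.1 a q.2 ∧ Q q.1 b q.2
  have hM : (M x y).card ≤ β ^ 2 := by
    refine Nat.le_of_mul_le_mul_left ?_ hpos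
    have e1 : ∑ a, ∑ b, (M a b).card = n * (n - 1) * (M x y).card := by
      refine sum_sum_eq_of_offDiag (by simp [M]) ?_
      intro a b hab
      obtain ⟨g, rfl, rfl⟩ := h2 x y a b hxy hab
      refine card_filter_smul (G := G) (Ω := Ω × Ω) g fun q => ?_
      simp only [Prod.smul_fst, Prod.smul_snd, hQ, ne_eq, smul_left_cancel_iff]
    have e2 : ∑ a, ∑ b, (M a b).card = ∑ z : Ω, ∑ w : Ω, ∑ a : Ω,
        (Finset.univ.filter fun b => a ≠ b ∧ Q z a w ∧ Q z b w).card := by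
      simp only [M, Finset.card_filter, Fintype.sum_prod_type]
      calc _ = ∑ a, ∑ z, ∑ b, ∑ w, (if a ≠ b ∧ Q z a w ∧ Q z b w then 1 else 0) :=
            Finset.sum_congr rfl fun a _ => Finset.sum_comm
        _ = ∑ z, ∑ a, ∑ w, ∑ b, (if a ≠ b ∧ Q z a w ∧ Q z b w then 1 else 0) := by
            rw [Finset.sum_comm]
            exact Finset.sum_congr rfl fun z _ => Finset.sum_congr rfl fun a _ =>
              Finset.sum_comm
        _ = _ := Finset.sum_congr rfl fun z _ => Finset.sum_comm
    have e3 : ∑ z : Ω, ∑ w : Ω, (if z = w then 0 else β ^ 2) = n * (n - 1) * β ^ 2 :=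
      sum_sum_eq_of_offDiag (by simp) fun a b hab => if_neg hab
    rw [← e1, e2, ← e3]
    refine Finset.sum_le_sum fun z _ => Finset.sum_le_sum fun w _ => ?_
    split_ifs with hzw
    · refine (Finset.sum_eq_zero fun a _ => ?_).le
      refine Finset.card_eq_zero.2 (Finset.filter_eq_empty_iff.2 fun b _ h => ?_)
      exact (hne _ _ _ h.2.1).2.1 hzw
    · calc _ ≤ ∑ a, (if Q z a w then β else 0) := by
            refine Finset.sum_le_sum fun a _ => ?_
            split_ifs with ha
            · rw [← hp2 z w hzw]
              exact Finset.card_le_card fun b hb => by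
                simp only [Finset.mem_filter, Finset.mem_univ, true_and] at hb ⊢
                exact hb.2.2
            · refine (Finset.card_eq_zero.2 (Finset.filter_eq_empty_iff.2 fun b _ h => ?_)).le
              exact ha h.2.1
        _ = β ^ 2 := by
            rw [← Finset.sum_filter, Finset.sum_const, hp2 z w hzw, smul_eq_mul, pow_two]
  have hcov : (Finset.univ.filter fun z => distinguishingAt G z x y ⊆ W) ⊆
      (({x, y} ∪ (W.erase x).biUnion fun w => Finset.univ.filter fun z => Q z x w) ∪
        Finset.univ.filter fun z => Q z x y) ∪ (M x y).image Prod.fst := by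
    intro z hz
    simp only [Finset.mem_filter, Finset.mem_univ, true_and] at hz
    by_cases hzx : z = x
    · simp [hzx]
    by_cases hzy : z = y
    · simp [hzy]
    obtain ⟨w, hw⟩ : ∃ w, Q z x w := by
      have : 0 < (Finset.univ.filter (Q z x)).card := by rw [hβ z x hzx]; omega
      obtain ⟨w, hw⟩ := Finset.card_pos.1 this
      exact ⟨w, by simpa using hw⟩
    by_cases hwW : w ∈ W
    · refine Finset.mem_union_left _ (Finset.mem_union_left _ (Finset.mem_union_right _ ?_))
      refine Finset.mem_biUnion.2 ⟨w, Finset.mem_erase.2 ⟨(hne _ _ _ hw).2.2.symm, hwW⟩, ?_⟩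
      simpa using hw
    by_cases hwy : w = y
    · subst hwy
      exact Finset.mem_union_left _ (Finset.mem_union_right _ (by simpa using hw))
    refine Finset.mem_union_right _ (Finset.mem_image.2 ⟨(z, w), ?_, rfl⟩)
    have hsame : SameTriple G z x w z y w := by
      by_contra h
      exact hwW (hz (mem_distinguishingAt.2 h))
    simp only [M, Finset.mem_filter, Finset.mem_univ, true_and]
    exact ⟨hxy, hw, hs z x y w hzy (Ne.symm hwy) hw hsame⟩
  refine (Finset.card_le_card hcov).trans ?_
  refine (Finset.card_union_le _ _).trans (add_le_add ?_ (Finset.card_image_le.trans hM))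
  refine (Finset.card_union_le _ _).trans (add_le_add ?_ (hp1 x y hxy).le)
  refine (Finset.card_union_le _ _).trans (add_le_add Finset.card_le_two ?_)
  refine (Finset.card_biUnion_le_card_mul _ _ β fun w hw => ?_).trans
    (Nat.mul_le_mul_right _ (Finset.card_le_card (Finset.erase_subset _ _)))
  exact (hp1 x w (Finset.ne_of_mem_erase hw).symm).le

end DoublyTransitive

section DoublyTransitiveBase

variable {G Ω : Type*} [Group G] [MulAction G Ω] [Fintype Ω]

open Classical in
theorem log_card_offDiag_le [Nontrivial Ω] :
    Real.log (Fintype.card {q : Ω × Ω // q.1 ≠ q.2}) ≤ 2 * Real.log (Fintype.card Ω) := by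
  have h4 : Fintype.card {q : Ω × Ω // q.1 ≠ q.2} ≤ Fintype.card Ω ^ 2 := by
    refine (Fintype.card_subtype_le _).trans ?_
    rw [Fintype.card_prod, pow_two]
  have h5 : Real.log ((Fintype.card Ω : ℝ) ^ 2) = 2 * Real.log (Fintype.card Ω) := by
    rw [Real.log_pow]; norm_num
  rw [← h5]
  obtain ⟨x, y, hxy⟩ := exists_pair_ne Ω
  refine Real.log_le_log ?_ (by exact_mod_cast h4)
  have : 0 < Fintype.card {q : Ω × Ω // q.1 ≠ q.2} := Fintype.card_pos_iff.2 ⟨⟨(x, y), hxy⟩⟩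
  exact_mod_cast this

open Classical in
variable (G) in
theorem exists_base_of_distinguishingPairs [Nontrivial Ω] {d : ℕ} (hd : 0 < d)
    (h : ∀ x y : Ω, x ≠ y → d ≤ (distinguishingPairs G x y).card) :
    ∃ Z : Finset Ω, IsActionBase G Z ∧ (Z.card : ℝ) ≤
      2 * ((Fintype.card Ω : ℝ) ^ 2 / d * (2 * Real.log (Fintype.card Ω)) + 1) := by
  obtain ⟨P, hP, hPA⟩ := exists_hitting (U := Ω × Ω) (ι := {q : Ω × Ω // q.1 ≠ q.2})
    (fun q => distinguishingPairs G q.1.1 q.1.2) hd fun q => h _ _ q.2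
  refine ⟨P.image Prod.fst ∪ P.image Prod.snd, ?_, ?_⟩
  · intro g hg x
    by_contra hne
    obtain ⟨q, hq, hq'⟩ := hPA ⟨(x, g • x), Ne.symm hne⟩
    refine mem_distinguishingPairs.1 hq' ⟨g, hg _ ?_, rfl, hg _ ?_⟩
    · exact Finset.mem_union_left _ (Finset.mem_image_of_mem _ hq)
    · exact Finset.mem_union_right _ (Finset.mem_image_of_mem _ hq)
  · have h1 : (P.image Prod.fst ∪ P.image Prod.snd).card ≤ 2 * P.card := by
      refine (Finset.card_union_le _ _).trans ?_
      have h2 : (P.image Prod.fst).card ≤ P.card := Finset.card_image_le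
      have h3 : (P.image Prod.snd).card ≤ P.card := Finset.card_image_le
      omega
    have h2 : ((P.image Prod.fst ∪ P.image Prod.snd).card : ℝ) ≤ 2 * P.card := by
      exact_mod_cast h1
    refine h2.trans (mul_le_mul_of_nonneg_left (hP.trans ?_) (by norm_num))
    rw [Fintype.card_prod, Nat.cast_mul, ← pow_two]
    gcongr
    exact log_card_offDiag_le

open Classical in
/-- Growing a set of points that distinguishes any two points relative to many others. -/
theorem exists_distinguishingAt_large [Nontrivial Ω] {k : ℕ}
    (h : ∀ x y : Ω, x ≠ y → ∀ W : Finset Ω, W.card < k →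
      2 * (Finset.univ.filter fun z => distinguishingAt G z x y ⊆ W).card ≤ Fintype.card Ω)
    (q : ℕ) (hq : q ≤ k) :
    ∃ Z : Finset Ω, (Z.card : ℝ) ≤ q * (4 * Real.log (Fintype.card Ω) + 1) ∧
      ∀ x y : Ω, x ≠ y → q ≤ (Z.biUnion fun z => distinguishingAt G z x y).card := by
  induction q with
  | zero => exact ⟨∅, by simp, fun x y _ => Nat.zero_le _⟩
  | succ q ih =>
    obtain ⟨Z, hZ, hZD⟩ := ih (by omega)
    set n := Fintype.card Ω with hn
    have hn2 : 1 < n := Fintype.one_lt_card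
    let W : Ω → Ω → Finset Ω := fun x y => Z.biUnion fun z => distinguishingAt G z x y
    let A : {q : Ω × Ω // q.1 ≠ q.2} → Finset Ω := fun p =>
      Finset.univ.filter fun z => q + 1 ≤ (W p.1.1 p.1.2).card ∨
        ¬ distinguishingAt G z p.1.1 p.1.2 ⊆ W p.1.1 p.1.2
    have hA : ∀ p, (n + 1) / 2 ≤ (A p).card := by
      rintro ⟨⟨x, y⟩, hxy⟩
      by_cases hc : q + 1 ≤ (W x y).card
      · have : A ⟨(x, y), hxy⟩ = Finset.univ :=
          Finset.filter_true_of_mem fun z _ => Or.inl hc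
        rw [this, Finset.card_univ]
        omega
      · have e1 := h x y hxy (W x y) (by omega)
        have e2 : (Finset.univ.filter fun z => distinguishingAt G z x y ⊆ W x y).card +
          (Finset.univ.filter fun z => ¬ distinguishingAt G z x y ⊆ W x y).card = n :=
          Finset.card_filter_add_card_filter_not _
        have e3 : (Finset.univ.filter fun z => ¬ distinguishingAt G z x y ⊆ W x y).card
            ≤ (A ⟨(x, y), hxy⟩).card := by
          refine Finset.card_le_card fun z hz => ?_
          simp only [A, Finset.mem_filter, Finset.mem_univ, true_and] at hz ⊢
          exact Or.inr hz
        omega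
    obtain ⟨Z', hZ', hZA⟩ := exists_hitting A (by omega) hA
    refine ⟨Z ∪ Z', ?_, fun x y hxy => ?_⟩
    · have e1 : ((Z ∪ Z').card : ℝ) ≤ Z.card + Z'.card := by
        exact_mod_cast Finset.card_union_le _ _
      have e2 : (n : ℝ) / ((n + 1) / 2 : ℕ) ≤ 2 := by
        have e3 : n ≤ 2 * ((n + 1) / 2) := by omega
        have e4 : (n : ℝ) ≤ 2 * ((n + 1) / 2 : ℕ) := by exact_mod_cast e3
        rw [div_le_iff₀ (by exact_mod_cast (by omega : 0 < (n + 1) / 2))]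
        exact e4
      have e5 : (n : ℝ) / ((n + 1) / 2 : ℕ) *
          Real.log (Fintype.card {q : Ω × Ω // q.1 ≠ q.2}) ≤ 2 * (2 * Real.log n) :=
        mul_le_mul e2 log_card_offDiag_le (Real.log_natCast_nonneg _) (by norm_num)
      push_cast
      linarith
    · have hsub : W x y ⊆ (Z ∪ Z').biUnion fun z => distinguishingAt G z x y :=
        Finset.biUnion_subset_biUnion_of_subset_left _ Finset.subset_union_left
      obtain ⟨z, hz, hzA⟩ := hZA ⟨(x, y), hxy⟩
      simp only [A, Finset.mem_filter, Finset.mem_univ, true_and] at hzA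
      rcases hzA with hc | hc
      · exact hc.trans (Finset.card_le_card hsub)
      · obtain ⟨w, hw, hwW⟩ := Finset.not_subset.1 hc
        have hlt : W x y ⊂ (Z ∪ Z').biUnion fun z => distinguishingAt G z x y :=
          Finset.ssubset_iff_of_subset hsub |>.2
            ⟨w, Finset.mem_biUnion.2 ⟨z, Finset.mem_union_right _ hz, hw⟩, hwW⟩
        exact (Nat.succ_le_succ (hZD x y hxy)).trans (Finset.card_lt_card hlt)

open Classical in
theorem exists_base_of_distinguishingAt [Nontrivial Ω] {k : ℕ} (hk : 0 < k)
    (h : ∀ x y : Ω, x ≠ y → ∀ W : Finset Ω, W.card < k →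
      2 * (Finset.univ.filter fun z => distinguishingAt G z x y ⊆ W).card ≤ Fintype.card Ω) :
    ∃ Z : Finset Ω, IsActionBase G Z ∧ (Z.card : ℝ) ≤
      k * (4 * Real.log (Fintype.card Ω) + 1) +
        ((Fintype.card Ω : ℝ) / k * (2 * Real.log (Fintype.card Ω)) + 1) := by
  obtain ⟨Z, hZ, hZD⟩ := exists_distinguishingAt_large h k le_rfl
  obtain ⟨P, hP, hPA⟩ := exists_hitting (ι := {q : Ω × Ω // q.1 ≠ q.2})
    (fun p => Z.biUnion fun z => distinguishingAt G z p.1.1 p.1.2) hk fun p => hZD _ _ p.2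
  refine ⟨Z ∪ P, ?_, ?_⟩
  · intro g hg x
    by_contra hne
    obtain ⟨w, hw, hw'⟩ := hPA ⟨(x, g • x), Ne.symm hne⟩
    obtain ⟨z, hz, hzw⟩ := Finset.mem_biUnion.1 hw'
    exact mem_distinguishingAt.1 hzw ⟨g, hg _ (Finset.mem_union_left _ hz), rfl,
      hg _ (Finset.mem_union_right _ hw)⟩
  · have e1 : ((Z ∪ P).card : ℝ) ≤ Z.card + P.card := by
      exact_mod_cast Finset.card_union_le _ _
    refine e1.trans (add_le_add hZ (hP.trans ?_))
    gcongr
    exact log_card_offDiag_le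

/-- A doubly but not triply transitive group has a small base. -/
theorem exists_base_of_doublyTransitive
    (h2 : ∀ a b c d : Ω, a ≠ b → c ≠ d → SameOrbital G a b c d)
    (h3 : ¬ ∀ a b c a' b' c' : Ω, a ≠ b → a ≠ c → b ≠ c → a' ≠ b' → a' ≠ c' → b' ≠ c' →
      SameTriple G a b c a' b' c') :
    ∃ Z : Finset Ω, IsActionBase G Z ∧
      (Z.card : ℝ) ≤ 66 * √(Fintype.card Ω : ℝ) * Real.log (Fintype.card Ω) := by
  classical
  obtain ⟨Q, β, hβ1, hQ, hne, hβ, hs, hlarge⟩ := exists_triple_relation h2 h3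
  set n := Fintype.card Ω with hn
  have hn3 : 3 ≤ n := by
    push Not at h3
    obtain ⟨a, b, c, -, -, -, hab, hac, hbc, -⟩ := h3
    rw [hn, ← Finset.card_univ, ← Finset.card_eq_three.2 ⟨a, b, c, hab, hac, hbc, rfl⟩]
    exact Finset.card_le_card (Finset.subset_univ _)
  have hnt : Nontrivial Ω := Fintype.one_lt_card_iff_nontrivial.1 (by omega)
  have hn3' : (3 : ℝ) ≤ n := by exact_mod_cast hn3
  have hlog : 1 ≤ Real.log n := by
    rw [Real.le_log_iff_exp_le (by linarith)]
    exact (Real.exp_one_lt_d9.le.trans (by norm_num)).trans hn3'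
  have hsq : √(n : ℝ) * √(n : ℝ) = n := Real.mul_self_sqrt (by linarith)
  have hsq1 : 1 ≤ √(n : ℝ) := Real.one_le_sqrt.2 (by linarith)
  rcases Nat.lt_or_ge n 16 with hn16 | hn16
  · refine ⟨Finset.univ, fun g hg x => hg x (Finset.mem_univ x), ?_⟩
    rw [Finset.card_univ, ← hn]
    have e1 : √(n : ℝ) ≤ 4 := by
      rw [Real.sqrt_le_left (by norm_num)]
      have : (n : ℝ) ≤ 16 := by exact_mod_cast hn16.le
      linarith
    nlinarith
  set s := Nat.sqrt n with hs'
  have hs4 : 4 ≤ s := Nat.le_sqrt.2 (by omega)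
  have hsn : s * s ≤ n := Nat.sqrt_le n
  have hs1 : (s : ℝ) ≤ √(n : ℝ) := Real.nat_sqrt_le_real_sqrt
  have hs2 : √(n : ℝ) ≤ 2 * s := by
    have e1 : √(n : ℝ) ≤ s + 1 := Real.real_sqrt_le_nat_sqrt_succ
    have e2 : (4 : ℝ) ≤ s := by exact_mod_cast hs4
    linarith
  have hs0 : (0 : ℝ) < s := by exact_mod_cast (by omega : 0 < s)
  have hprod : 1 ≤ √(n : ℝ) * Real.log n := by nlinarith
  rcases Nat.lt_or_ge (4 * β) s with hb | hb
  · obtain ⟨Z, hZ, hZc⟩ := exists_base_of_distinguishingAt (G := G) (Ω := Ω) (k := s / 4 + 1)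
      (by omega) (by
        intro x y hxy W hW
        have e1 := card_filter_distinguishingAt_subset_le h2 hβ1 hQ hne hβ hs hxy W
        have e2 : 4 * W.card ≤ s := by omega
        have e3 : 16 * (W.card * β) ≤ s * s := by nlinarith
        have e4 : 16 * β ^ 2 ≤ s * s := by nlinarith
        have e5 : 4 * s ≤ s * s := Nat.mul_le_mul_right _ hs4
        rw [← hn]
        omega)
    refine ⟨Z, hZ, hZc.trans ?_⟩
    rw [← hn]
    have e1 : (s : ℝ) / 4 ≤ ((s / 4 + 1 : ℕ) : ℝ) := by
      have : s ≤ 4 * (s / 4 + 1) := by omega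
      have : (s : ℝ) ≤ 4 * ((s / 4 + 1 : ℕ) : ℝ) := by exact_mod_cast this
      linarith
    have e2 : ((s / 4 + 1 : ℕ) : ℝ) ≤ s := by exact_mod_cast (by omega : s / 4 + 1 ≤ s)
    have e3 : (n : ℝ) / ((s / 4 + 1 : ℕ) : ℝ) ≤ 8 * √(n : ℝ) := by
      rw [div_le_iff₀ (by positivity)]
      nlinarith
    have e4 : ((s / 4 + 1 : ℕ) : ℝ) * (4 * Real.log n + 1) ≤ √(n : ℝ) * (5 * Real.log n) :=
      mul_le_mul (e2.trans hs1) (by linarith) (by linarith) (by linarith)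
    have e5 : (n : ℝ) / ((s / 4 + 1 : ℕ) : ℝ) * (2 * Real.log n) ≤
        8 * √(n : ℝ) * (2 * Real.log n) :=
      mul_le_mul_of_nonneg_right e3 (by linarith)
    linarith
  · obtain ⟨Z, hZ, hZc⟩ := exists_base_of_distinguishingPairs G (Ω := Ω) (d := (n - 2) * β)
      (Nat.mul_pos (by omega) (by omega))
      fun x y hxy => mul_le_card_distinguishingPairs h2 hlarge hxy
    refine ⟨Z, hZ, hZc.trans ?_⟩
    rw [← hn]
    have e1 : n * s ≤ 8 * ((n - 2) * β) := by
      have : n ≤ 2 * (n - 2) := by omega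
      calc n * s ≤ (2 * (n - 2)) * (4 * β) := Nat.mul_le_mul this hb
        _ = _ := by ring
    have e2 : (n : ℝ) * s ≤ 8 * ((n - 2) * β : ℕ) := by exact_mod_cast e1
    have hd0 : (0 : ℝ) < ((n - 2) * β : ℕ) := by
      exact_mod_cast Nat.mul_pos (by omega : 0 < n - 2) (by omega : 0 < β)
    have e3 : (n : ℝ) ^ 2 / ((n - 2) * β : ℕ) ≤ 16 * √(n : ℝ) := by
      rw [div_le_iff₀ hd0]
      calc (n : ℝ) ^ 2 = n * (√(n : ℝ) * √(n : ℝ)) := by rw [hsq]; ring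
        _ ≤ n * (√(n : ℝ) * (2 * s)) := by gcongr
        _ = 2 * √(n : ℝ) * (n * s) := by ring
        _ ≤ 2 * √(n : ℝ) * (8 * ((n - 2) * β : ℕ)) := by gcongr
        _ = _ := by ring
    have e5 : (n : ℝ) ^ 2 / ((n - 2) * β : ℕ) * (2 * Real.log n) ≤
        16 * √(n : ℝ) * (2 * Real.log n) :=
      mul_le_mul_of_nonneg_right e3 (by linarith)
    linarith

end DoublyTransitiveBase

section MultiplyTransitive

theorem perm_apply_inv_apply {α : Type*} (f : Equiv.Perm α) (x : α) : f (f⁻¹ x) = x :=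
  f.apply_symm_apply x

theorem isMultiplyPretransitive_three_of_sameTriple {G Ω : Type*} [Group G] [MulAction G Ω]
    (h3 : ∀ a b c a' b' c' : Ω, a ≠ b → a ≠ c → b ≠ c → a' ≠ b' → a' ≠ c' → b' ≠ c' →
      SameTriple G a b c a' b' c') : MulAction.IsMultiplyPretransitive G Ω 3 := by
  rw [MulAction.isMultiplyPretransitive_iff]
  intro x y
  obtain ⟨g, h0, h1, h2⟩ := h3 (x 0) (x 1) (x 2) (y 0) (y 1) (y 2)
    (fun h => absurd (x.injective h) (by decide)) (fun h => absurd (x.injective h) (by decide))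
    (fun h => absurd (x.injective h) (by decide)) (fun h => absurd (y.injective h) (by decide))
    (fun h => absurd (y.injective h) (by decide)) (fun h => absurd (y.injective h) (by decide))
  refine ⟨g, ?_⟩
  ext i
  fin_cases i
  · exact h0
  · exact h1
  · exact h2

/-- A multiply transitive group has a small base, in terms of its degree of transitivity. -/
theorem exists_base_of_multiplyTransitive (k : ℕ) : ∀ {G : Type*} {Ω : Type*} [Group G]
    [MulAction G Ω] [Fintype Ω], MulAction.IsMultiplyPretransitive G Ω (k + 2) →
    ¬ MulAction.IsMultiplyPretransitive G Ω (k + 3) → k + 2 ≤ Fintype.card Ω →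
    ∃ Z : Finset Ω, IsActionBase G Z ∧
      (Z.card : ℝ) ≤ 66 * √(Fintype.card Ω : ℝ) * Real.log (Fintype.card Ω) + k := by
  classical
  induction k with
  | zero =>
    intro G Ω _ _ _ h2 h3 _
    obtain ⟨Z, hZ, hZc⟩ := exists_base_of_doublyTransitive (G := G) (Ω := Ω)
      (fun a b c d hab hcd => MulAction.is_two_pretransitive_iff.1 h2 hab hcd)
      (fun h => h3 (isMultiplyPretransitive_three_of_sameTriple h))
    exact ⟨Z, hZ, by simpa using hZc⟩
  | succ k ih =>
    intro G Ω _ _ _ h2 h3 hcard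
    have htr : MulAction.IsPretransitive G Ω := by
      rw [← MulAction.is_one_pretransitive_iff]
      exact MulAction.isMultiplyPretransitive_of_le (n := k + 1 + 2) (by omega)
        (by rwa [Nat.card_eq_fintype_card])
    have : Nonempty Ω := Fintype.card_pos_iff.1 (by omega)
    obtain ⟨a⟩ := this
    have h2' := (SubMulAction.ofStabilizer.isMultiplyPretransitive (a := a) (n := k + 2)).1 h2
    have h3' := fun h => h3
      ((SubMulAction.ofStabilizer.isMultiplyPretransitive (a := a) (n := k + 3)).2 h)
    have hcard' : Fintype.card (SubMulAction.ofStabilizer G a) = Fintype.card Ω - 1 := by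
      have := SubMulAction.nat_card_ofStabilizer_eq G a
      rwa [Nat.card_eq_fintype_card, Nat.card_eq_fintype_card] at this
    obtain ⟨Z, hZ, hZc⟩ := ih h2' h3' (by omega)
    refine ⟨insert a (Z.image Subtype.val), ?_, ?_⟩
    · intro g hg x
      have hga : g • a = a := hg a (Finset.mem_insert_self _ _)
      by_cases hx : x = a
      · rw [hx, hga]
      · have := hZ ⟨g, hga⟩ (fun z hz => Subtype.ext
          (hg z (Finset.mem_insert_of_mem (Finset.mem_image_of_mem _ hz)))) ⟨x, hx⟩
        exact congrArg Subtype.val this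
    · have e1 : (insert a (Z.image Subtype.val)).card ≤ Z.card + 1 :=
        (Finset.card_insert_le _ _).trans (Nat.add_le_add_right Finset.card_image_le 1)
      have e2 : ((insert a (Z.image Subtype.val)).card : ℝ) ≤ Z.card + 1 := by exact_mod_cast e1
      have e3 : (Fintype.card (SubMulAction.ofStabilizer G a) : ℝ) ≤ Fintype.card Ω := by
        exact_mod_cast (by omega)
      have e4 : (0 : ℝ) < Fintype.card (SubMulAction.ofStabilizer G a) := by
        exact_mod_cast (by omega)
      have e5 : 66 * √(Fintype.card (SubMulAction.ofStabilizer G a) : ℝ) *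
          Real.log (Fintype.card (SubMulAction.ofStabilizer G a)) ≤
          66 * √(Fintype.card Ω : ℝ) * Real.log (Fintype.card Ω) := by
        refine mul_le_mul ?_ (Real.log_le_log e4 e3) (Real.log_natCast_nonneg _) (by positivity)
        exact mul_le_mul_of_nonneg_left (Real.sqrt_le_sqrt e3) (by norm_num)
      push_cast
      linarith

variable {Ω : Type*} [Fintype Ω]

variable [DecidableEq Ω] in
/-- A primitive group containing two permutations whose supports meet in one point contains
the alternating group. -/
theorem alternatingGroup_le_of_support_inter {G : Subgroup (Equiv.Perm Ω)}
    (hG : MulAction.IsPreprimitive G Ω) {h k : Equiv.Perm Ω} (hh : h ∈ G) (hk : k ∈ G) {a : Ω}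
    (hha : h a ≠ a) (hka : k a ≠ a) (hhk : ∀ x, h x ≠ x → k x ≠ x → x = a) :
    alternatingGroup Ω ≤ G := by
  have hinv : ∀ (f : Equiv.Perm Ω) x, f⁻¹ x ≠ x ↔ f x ≠ x := fun f x => by
    rw [ne_eq, ne_eq, Equiv.Perm.inv_eq_iff_eq, eq_comm]
  have hc : h * k * h⁻¹ * k⁻¹ ∈ G :=
    G.mul_mem (G.mul_mem (G.mul_mem hh hk) (G.inv_mem hh)) (G.inv_mem hk)
  set c := h * k * h⁻¹ * k⁻¹ with hcdef
  have hsub : c.support ⊆ {a, h a, k a} := by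
    intro x hx
    rw [Equiv.Perm.mem_support] at hx
    by_contra hcon
    simp only [Finset.mem_insert, Finset.mem_singleton, not_or] at hcon
    obtain ⟨hxa, hxh, hxk⟩ := hcon
    apply hx
    have e1 : h⁻¹ (k⁻¹ x) = k⁻¹ (h⁻¹ x) := by
      by_cases h1 : h x = x
      · have h1' : h⁻¹ x = x := by rw [Equiv.Perm.inv_eq_iff_eq, h1]
        rw [h1']
        by_cases h2 : k x = x
        · have h2' : k⁻¹ x = x := by rw [Equiv.Perm.inv_eq_iff_eq, h2]
          rw [h2', h1']
        · by_contra h3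
          refine hxk ?_
          have h4 : k (k⁻¹ x) ≠ k⁻¹ x := by
            rw [perm_apply_inv_apply]
            exact ((hinv k x).2 h2).symm
          have := hhk (k⁻¹ x) ((hinv _ _).1 h3) h4
          rw [← this, perm_apply_inv_apply]
      · have h2 : k x = x := by
          by_contra h2
          exact hxa (hhk x h1 h2)
        have h2' : k⁻¹ x = x := by rw [Equiv.Perm.inv_eq_iff_eq, h2]
        rw [h2']
        by_contra h3
        refine hxh ?_
        have h4 : h (h⁻¹ x) ≠ h⁻¹ x := by
          rw [perm_apply_inv_apply]
          exact ((hinv h x).2 h1).symm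
        have := hhk (h⁻¹ x) h4 ((hinv _ _).1 (Ne.symm h3))
        rw [← this, perm_apply_inv_apply]
    rw [hcdef, Equiv.Perm.mul_apply, Equiv.Perm.mul_apply, Equiv.Perm.mul_apply, e1,
      perm_apply_inv_apply, perm_apply_inv_apply]
  have hc1 : c ≠ 1 := by
    intro h1
    have hcomm : h * k = k * h := by
      rw [hcdef, mul_inv_eq_one, mul_inv_eq_iff_eq_mul] at h1
      exact h1
    refine hha (hhk (h a) (fun e => hha (h.injective e)) fun e => hka (h.injective ?_))
    rw [← Equiv.Perm.mul_apply, hcomm, Equiv.Perm.mul_apply, e]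
  have hle : c.support.card ≤ 3 := (Finset.card_le_card hsub).trans Finset.card_le_three
  have h2 : 2 ≤ c.support.card := Equiv.Perm.two_le_card_support_of_ne_one hc1
  rcases (by omega : c.support.card = 2 ∨ c.support.card = 3) with h | h
  · rw [Equiv.Perm.subgroup_eq_top_of_isPreprimitive_of_isSwap_mem hG c
      (Equiv.Perm.card_support_eq_two.1 h) hc]
    exact le_top
  · exact Equiv.Perm.alternatingGroup_le_of_isPreprimitive_of_isThreeCycle_mem hG
      (card_support_eq_three_iff.1 h) hc

theorem exists_smul_eq_of_isMultiplyPretransitive {G : Type*} [Group G] [MulAction G Ω] {t : ℕ}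
    (ht : MulAction.IsMultiplyPretransitive G Ω t) (htn : t ≤ Fintype.card Ω) {ι : Type*}
    [Fintype ι] (hι : Fintype.card ι ≤ t) (x y : ι ↪ Ω) : ∃ g : G, ∀ i, g • x i = y i := by
  have h1 : MulAction.IsMultiplyPretransitive G Ω (Fintype.card ι) :=
    MulAction.isMultiplyPretransitive_of_le (n := t) hι (by rwa [Nat.card_eq_fintype_card])
  let e := Fintype.equivFin ι
  obtain ⟨g, hg⟩ := h1.exists_smul_eq (e.symm.toEmbedding.trans x) (e.symm.toEmbedding.trans y)
  refine ⟨g, fun i => ?_⟩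
  have := DFunLike.congr_fun hg (e i)
  simpa using this

variable [DecidableEq Ω] in
/-- A multiply transitive group containing a permutation of small support contains the
alternating group. -/
theorem alternatingGroup_le_of_card_support_le {G : Subgroup (Equiv.Perm Ω)} {t : ℕ}
    (ht : MulAction.IsMultiplyPretransitive G Ω t) (ht2 : 2 ≤ t) (htn : t ≤ Fintype.card Ω)
    {h : Equiv.Perm Ω} (hh : h ∈ G) (h1 : h ≠ 1) (hsupp : h.support.card ≤ t)
    (hsupp' : 2 * h.support.card ≤ Fintype.card Ω) : alternatingGroup Ω ≤ G := by
  have hG : MulAction.IsPreprimitive G Ω :=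
    MulAction.isPreprimitive_of_is_two_pretransitive
      (MulAction.isMultiplyPretransitive_of_le (n := t) ht2 (by rwa [Nat.card_eq_fintype_card]))
  have hne : h.support.Nonempty := by
    rw [Finset.nonempty_iff_ne_empty, ne_eq, Equiv.Perm.support_eq_empty_iff]
    exact h1
  obtain ⟨a, ha⟩ := hne
  have hcard : Fintype.card h.support ≤ Fintype.card (h.supportᶜ : Finset Ω) := by
    rw [Fintype.card_coe, Fintype.card_coe, Finset.card_compl]
    omega
  obtain ⟨f⟩ := Function.Embedding.nonempty_of_card_le hcard
  let y : h.support ↪ Ω := ⟨fun x => if (x : Ω) = a then a else (f x : Ω), by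
    intro x x' hxx
    have hf : ∀ u, (f u : Ω) ≠ a := fun u e => by
      have := (f u).2
      rw [Finset.mem_compl, e] at this
      exact this ha
    by_cases e1 : (x : Ω) = a <;> by_cases e2 : (x' : Ω) = a
    · exact Subtype.ext (e1.trans e2.symm)
    · simp only [e1, e2, if_true, if_false] at hxx
      exact absurd hxx.symm (hf _)
    · simp only [e1, e2, if_true, if_false] at hxx
      exact absurd hxx (hf _)
    · simp only [e1, e2, if_false] at hxx
      exact f.injective (Subtype.ext hxx)⟩
  obtain ⟨k, hk⟩ := exists_smul_eq_of_isMultiplyPretransitive ht htn (by rwa [Fintype.card_coe])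
    (Function.Embedding.subtype fun x => x ∈ h.support) y
  have hka : (k : Equiv.Perm Ω) a = a := by
    exact (hk ⟨a, ha⟩).trans (if_pos rfl)
  have hkx : ∀ x ∈ h.support, x ≠ a → (k : Equiv.Perm Ω) x ∉ h.support := by
    intro x hx hxa
    have h2 : (k : Equiv.Perm Ω) x = f ⟨x, hx⟩ := (hk ⟨x, hx⟩).trans (if_neg hxa)
    rw [h2, ← Finset.mem_compl]
    exact (f ⟨x, hx⟩).2
  rw [Equiv.Perm.mem_support] at ha
  refine alternatingGroup_le_of_support_inter hG hh
    (k := k * h * (k : Equiv.Perm Ω)⁻¹) (G.mul_mem (G.mul_mem k.2 hh) (G.inv_mem k.2))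
    (a := a) ha ?_ ?_
  · intro e
    rw [Equiv.Perm.mul_apply, Equiv.Perm.mul_apply, ← Equiv.Perm.eq_inv_iff_eq] at e
    have hka' : (k : Equiv.Perm Ω)⁻¹ a = a := by rw [Equiv.Perm.inv_eq_iff_eq, hka]
    rw [hka'] at e
    exact ha e
  · intro x hx hx'
    have h2 : (k : Equiv.Perm Ω)⁻¹ x ∈ h.support := by
      rw [Equiv.Perm.mem_support]
      intro e
      apply hx'
      rw [Equiv.Perm.mul_apply, Equiv.Perm.mul_apply, e, perm_apply_inv_apply]
    by_contra hxa
    have h3 := hkx _ h2 (fun e => hxa (by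
      rw [Equiv.Perm.inv_eq_iff_eq, hka] at e
      exact e))
    rw [perm_apply_inv_apply] at h3
    exact h3 (Equiv.Perm.mem_support.2 hx)

end MultiplyTransitive

section SmallSupport

theorem sum_log_primes_dvd_le {k : ℕ} (hk : k ≠ 0) (T : Finset ℕ)
    (hT : ∀ p ∈ T, p.Prime ∧ p ∣ k) : ∑ p ∈ T, Real.log p ≤ Real.log k := by
  have h1 : T ⊆ k.primeFactors := fun p hp => Nat.mem_primeFactors.2 ⟨(hT p hp).1, (hT p hp).2, hk⟩
  have h2 : ∏ p ∈ T, p ≤ k := by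
    refine Nat.le_of_dvd (Nat.pos_of_ne_zero hk) ?_
    exact (Finset.prod_dvd_prod_of_subset _ _ _ h1).trans (Nat.prod_primeFactors_dvd k)
  have h3 : ∏ p ∈ T, p ≠ 0 := Finset.prod_ne_zero_iff.2 fun p hp => (hT p hp).1.ne_zero
  calc ∑ p ∈ T, Real.log p = Real.log ((∏ p ∈ T, p : ℕ) : ℝ) := by
        rw [Nat.cast_prod, Real.log_prod]
        intro p hp
        exact_mod_cast (hT p hp).1.ne_zero
    _ ≤ Real.log k := Real.log_le_log (by exact_mod_cast Nat.pos_of_ne_zero h3) (by exact_mod_cast h2)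

theorem period_dvd_ordCompl {Ω : Type*} (g : Equiv.Perm Ω) (w : Ω) {p : ℕ} (hp : p.Prime)
    (h : ¬ p ∣ MulAction.period g w) : MulAction.period g w ∣ ordCompl[p] (orderOf g) := by
  have h1 : MulAction.period g w ∣ ordProj[p] (orderOf g) * ordCompl[p] (orderOf g) := by
    rw [Nat.ordProj_mul_ordCompl_eq_self]
    exact MulAction.period_dvd_orderOf g w
  refine Nat.Coprime.dvd_of_dvd_mul_left ?_ h1
  exact Nat.Coprime.pow_right _ ((hp.coprime_iff_not_dvd.2 h).symm)

theorem period_le_card {Ω : Type*} [Fintype Ω] (g : Equiv.Perm Ω) (w : Ω) : MulAction.period g w ≤ Fintype.card Ω := by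
  rw [MulAction.period_eq_minimalPeriod]
  exact Function.minimalPeriod_le_card

variable {Ω : Type*} [Fintype Ω] [DecidableEq Ω]

/-- A `t`-transitive group contains a nontrivial element of small support. -/
theorem exists_card_support_mul_theta_le {G : Subgroup (Equiv.Perm Ω)} {t : ℕ}
    (ht : MulAction.IsMultiplyPretransitive G Ω t) (htn : t ≤ Fintype.card Ω) {y : ℕ} (hy : 2 ≤ y)
    (hyt : y * y ≤ t) :
    ∃ h ∈ G, h ≠ 1 ∧ (h.support.card : ℝ) * Chebyshev.theta y ≤
      Fintype.card Ω * Real.log (Fintype.card Ω) := by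
  let T := Nat.primesLE y
  have hprime : ∀ p : T, (p : ℕ).Prime := fun p => (Nat.mem_primesLE.1 p.2).2
  have hle : ∀ p : T, (p : ℕ) ≤ y := fun p => (Nat.mem_primesLE.1 p.2).1
  have : ∀ p : T, NeZero (p : ℕ) := fun p => ⟨(hprime p).ne_zero⟩
  have hcard : Fintype.card (Σ p : T, ZMod p) ≤ t := by
    rw [Fintype.card_sigma]
    simp only [ZMod.card]
    refine le_trans ?_ hyt
    refine (Finset.sum_le_card_nsmul _ _ y fun p _ => hle p).trans ?_
    rw [smul_eq_mul]
    refine Nat.mul_le_mul_right _ ?_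
    rw [Finset.card_univ, Fintype.card_coe]
    have : T ⊆ Finset.Icc 1 y := fun p hp => by
      have := Nat.mem_primesLE.1 hp
      exact Finset.mem_Icc.2 ⟨this.2.one_lt.le, this.1⟩
    simpa using Finset.card_le_card this
  obtain ⟨x⟩ := Function.Embedding.nonempty_of_card_le (hcard.trans htn)
  let σ : (Σ p : T, ZMod p) → (Σ p : T, ZMod p) := fun i => ⟨i.1, i.2 + 1⟩
  have hσ : Function.Injective σ := by
    rintro ⟨p, i⟩ ⟨q, j⟩ h
    obtain rfl : p = q := congrArg Sigma.fst h
    simp only [σ, Sigma.mk.injEq, heq_eq_eq, true_and, add_left_inj] at h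
    rw [h]
  obtain ⟨g, hg⟩ := exists_smul_eq_of_isMultiplyPretransitive ht htn hcard x ⟨fun i => x (σ i),
    fun i j h => hσ (x.injective h)⟩
  have hpow : ∀ (p : T) (k : ℕ), ((g : Equiv.Perm Ω) ^ k) (x ⟨p, 0⟩) = x ⟨p, (k : ZMod p)⟩ := by
    intro p k
    induction k with
    | zero => simp
    | succ k ih =>
      rw [pow_succ', Equiv.Perm.mul_apply, ih, Nat.cast_succ]
      exact hg ⟨p, (k : ZMod p)⟩
  let m : ℕ → ℕ := fun p => ordCompl[p] (orderOf (g : Equiv.Perm Ω))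
  let f : ℕ → Equiv.Perm Ω := fun p => (g : Equiv.Perm Ω) ^ (m p)
  have hne : ∀ p ∈ T, f p ≠ 1 := by
    intro p hp h
    have h1 := hpow ⟨p, hp⟩ (m p)
    have h2 : ((g : Equiv.Perm Ω) ^ (m p)) = 1 := h
    rw [h2, Equiv.Perm.one_apply] at h1
    have h3 := x.injective h1
    simp only [Sigma.mk.injEq, heq_eq_eq, true_and] at h3
    have h4 : p ∣ m p := (ZMod.natCast_eq_zero_iff _ _).1 h3.symm
    exact Nat.not_dvd_ordCompl (hprime ⟨p, hp⟩) (orderOf_pos _).ne' h4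
  have hmove : ∀ p ∈ T, ∀ w, f p w ≠ w → p ∣ MulAction.period (g : Equiv.Perm Ω) w := by
    intro p hp w hw
    by_contra h
    exact hw (MulAction.pow_smul_eq_iff_period_dvd.2
      (period_dvd_ordCompl (g : Equiv.Perm Ω) w (hprime ⟨p, hp⟩) h))
  have hTne : T.Nonempty := ⟨2, Nat.mem_primesLE.2 ⟨hy, Nat.prime_two⟩⟩
  obtain ⟨p, hp, hmin⟩ := Finset.exists_min_image T (fun p => (f p).support.card) hTne
  refine ⟨f p, G.pow_mem g.2 _, hne p hp, ?_⟩
  rw [Chebyshev.theta_eq_sum_primesLE_log, Finset.mul_sum]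
  calc ∑ q ∈ T, ((f p).support.card : ℝ) * Real.log q
      ≤ ∑ q ∈ T, ((f q).support.card : ℝ) * Real.log q := by
        refine Finset.sum_le_sum fun q hq => ?_
        exact mul_le_mul_of_nonneg_right (by exact_mod_cast hmin q hq) (Real.log_natCast_nonneg q)
    _ = ∑ q ∈ T, ∑ w : Ω, if f q w ≠ w then Real.log q else 0 := by
        refine Finset.sum_congr rfl fun q _ => ?_
        rw [← Finset.sum_filter, Finset.sum_const, nsmul_eq_mul]
        rfl
    _ = ∑ w : Ω, ∑ q ∈ T with f q w ≠ w, Real.log q := by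
        rw [Finset.sum_comm]
        exact Finset.sum_congr rfl fun w _ => (Finset.sum_filter _ _).symm
    _ ≤ ∑ w : Ω, Real.log (Fintype.card Ω) := by
        refine Finset.sum_le_sum fun w _ => ?_
        have hpos : 0 < MulAction.period (g : Equiv.Perm Ω) w :=
          MulAction.period_pos_of_orderOf_pos (orderOf_pos _) w
        refine (sum_log_primes_dvd_le hpos.ne' _ fun q hq => ?_).trans
          (Real.log_le_log (by exact_mod_cast hpos) (by exact_mod_cast period_le_card _ w))
        rw [Finset.mem_filter] at hq
        exact ⟨hprime ⟨q, hq.1⟩, hmove q hq.1 w hq.2⟩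
    _ = _ := by rw [Finset.sum_const, nsmul_eq_mul, Finset.card_univ]

theorem eventually_log_le_mul_rpow {c a : ℝ} (hc : 0 < c) (ha : 0 < a) :
    ∀ᶠ n : ℕ in Filter.atTop, Real.log n ≤ c * (n : ℝ) ^ a := by
  have h := ((isLittleO_log_rpow_atTop ha).comp_tendsto tendsto_natCast_atTop_atTop).def hc
  filter_upwards [h] with n hn
  simp only [Function.comp_apply, Real.norm_eq_abs] at hn
  rw [abs_of_nonneg (Real.rpow_nonneg (Nat.cast_nonneg n) a)] at hn
  exact (le_abs_self _).trans hn

theorem eventually_le_theta : ∀ᶠ n : ℕ in Filter.atTop, (n : ℝ) / 4 ≤ Chebyshev.theta n := by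
  filter_upwards [eventually_log_le_mul_rpow (c := 1 / 20) (a := 1 / 2) (by norm_num) (by norm_num),
    Filter.eventually_ge_atTop 2] with n h1 hn
  have hn' : (2 : ℝ) ≤ n := by exact_mod_cast hn
  rw [← Real.sqrt_eq_rpow] at h1
  have h2 : Real.log (n + 1) ≤ 2 * Real.log n := by
    have : Real.log ((n : ℝ) ^ 2) = 2 * Real.log n := by rw [Real.log_pow]; norm_num
    rw [← this]
    exact Real.log_le_log (by linarith) (by nlinarith)
  have hs := Real.sq_sqrt (Nat.cast_nonneg n : (0 : ℝ) ≤ n)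
  have hs0 := Real.sqrt_nonneg (n : ℝ)
  have h3 := Real.log_two_gt_d9
  have h4 := Chebyshev.theta_ge n
  have h5 : √(n : ℝ) * Real.log n ≤ √(n : ℝ) * (1 / 20 * √n) := mul_le_mul_of_nonneg_left h1 hs0
  have h6 : (1 : ℝ) ≤ √n := Real.one_le_sqrt.2 (by linarith)
  nlinarith

/-- In large degree `n`, an `n ^ (4 / 5)`-transitive group contains the alternating group. -/
theorem eventually_alternatingGroup_le : ∀ᶠ n : ℕ in Filter.atTop, ∀ (Ω : Type*) [Fintype Ω]
    [DecidableEq Ω] (G : Subgroup (Equiv.Perm Ω)) (t : ℕ), Fintype.card Ω = n → t ≤ n →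
    (n : ℝ) ^ (4 / 5 : ℝ) ≤ t → MulAction.IsMultiplyPretransitive G Ω t →
    alternatingGroup Ω ≤ G := by
  have ht : Filter.Tendsto (fun n : ℕ => ⌊(n : ℝ) ^ (2 / 5 : ℝ)⌋₊) Filter.atTop Filter.atTop :=
    tendsto_nat_floor_atTop.comp
      ((tendsto_rpow_atTop (by norm_num)).comp tendsto_natCast_atTop_atTop)
  have hy : ∀ᶠ n : ℕ in Filter.atTop, (2 : ℝ) ≤ (n : ℝ) ^ (1 / 5 : ℝ) :=
    ((tendsto_rpow_atTop (by norm_num)).comp tendsto_natCast_atTop_atTop).eventually_ge_atTop 2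
  filter_upwards [ht.eventually eventually_le_theta, ht.eventually_ge_atTop 2, hy,
    eventually_log_le_mul_rpow (c := 1 / 8) (a := 1 / 5) (by norm_num) (by norm_num),
    Filter.eventually_ge_atTop 2] with n h1 h2 h3 h4 hn
  intro Ω _ _ G t hΩ htn hnt hG
  have hn0 : (0 : ℝ) < n := by exact_mod_cast (by omega : 0 < n)
  set y := ⌊(n : ℝ) ^ (2 / 5 : ℝ)⌋₊ with hydef
  set u := (n : ℝ) ^ (1 / 5 : ℝ) with hu
  have hpow : ∀ k : ℕ, (n : ℝ) ^ ((k : ℝ) / 5) = u ^ k := by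
    intro k
    rw [hu, ← Real.rpow_natCast, ← Real.rpow_mul hn0.le]
    congr 1
    ring
  have p2 : (n : ℝ) ^ (2 / 5 : ℝ) = u ^ 2 := by simpa only [Nat.cast_ofNat] using hpow 2
  have p4 : (n : ℝ) ^ (4 / 5 : ℝ) = u ^ 4 := by simpa only [Nat.cast_ofNat] using hpow 4
  have p5 : (n : ℝ) = u ^ 5 := by
    rw [← hpow 5]
    norm_num
  have hyle : (y : ℝ) ≤ u ^ 2 := by
    rw [← p2]
    exact Nat.floor_le (by positivity)
  have hyge : u ^ 2 < y + 1 := by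
    rw [← p2]
    exact Nat.lt_floor_add_one _
  have hyt : y * y ≤ t := by
    have : (y : ℝ) * y ≤ t := by
      have : (y : ℝ) * y ≤ u ^ 2 * u ^ 2 := by gcongr
      rw [p4] at hnt
      nlinarith
    exact_mod_cast this
  have hy2 : (2 : ℝ) ≤ y := by exact_mod_cast h2
  obtain ⟨h, hh, hne, hsupp⟩ := exists_card_support_mul_theta_le hG (hΩ ▸ htn) h2 hyt
  rw [hΩ] at hsupp
  have hθ : u ^ 2 / 8 ≤ Chebyshev.theta y := by linarith
  obtain ⟨s, hs_eq⟩ : ∃ s, s = h.support.card := ⟨_, rfl⟩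
  rw [← hs_eq] at hsupp
  have hs : (s : ℝ) * (u ^ 2 / 8) ≤ u ^ 5 * (1 / 8 * u) := by
    calc (s : ℝ) * (u ^ 2 / 8) ≤ s * Chebyshev.theta y :=
          mul_le_mul_of_nonneg_left hθ (Nat.cast_nonneg s)
      _ ≤ n * Real.log n := hsupp
      _ ≤ u ^ 5 * (1 / 8 * u) := by
        rw [← p5]
        gcongr
  have hs4 : (s : ℝ) ≤ u ^ 4 := by
    have : (s : ℝ) * u ^ 2 ≤ u ^ 4 * u ^ 2 := by nlinarith
    exact le_of_mul_le_mul_right this (by positivity)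
  have hst : s ≤ t := by
    rw [p4] at hnt
    exact_mod_cast hs4.trans hnt
  have hsn : 2 * s ≤ n := by
    have : 2 * (s : ℝ) ≤ n := by
      rw [p5]
      have : u ^ 5 = u ^ 4 * u := by ring
      nlinarith [pow_nonneg (show (0 : ℝ) ≤ u by linarith) 4]
    exact_mod_cast this
  have ht2 : 2 ≤ t := by nlinarith
  exact alternatingGroup_le_of_card_support_le hG ht2 (hΩ ▸ htn) hh hne (hs_eq ▸ hst)
    (hs_eq ▸ hΩ ▸ hsn)

end SmallSupport

section Primitive

/-- The function `x / √(log x)`. -/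
noncomputable def divSqrtLog (n : ℕ) : ℝ := n / √(Real.log n)

theorem one_le_divSqrtLog {n : ℕ} (hn : 2 ≤ n) : 1 ≤ divSqrtLog n := by
  have hn' : (2 : ℝ) ≤ n := by exact_mod_cast hn
  have h0 : 0 < Real.log n := Real.log_pos (by linarith)
  rw [divSqrtLog, one_le_div (Real.sqrt_pos.2 h0)]
  refine Real.sqrt_le_iff.2 ⟨by linarith, ?_⟩
  have := Real.log_le_sub_one_of_pos (show (0 : ℝ) < n by linarith)
  nlinarith

theorem rank_perm_le_two (α : Type*) [Fintype α] [DecidableEq α] :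
    Group.rank (Equiv.Perm α) ≤ 2 := by
  rcases Nat.lt_or_ge (Fintype.card α) 2 with h | h
  · have : Subsingleton α := Fintype.card_le_one_iff_subsingleton.1 (by omega)
    refine (Group.rank_le (S := ∅) (Subsingleton.elim _ _)).trans ?_
    simp
  · obtain ⟨m, hm⟩ : ∃ m, Fintype.card α = m + 2 := ⟨_, (Nat.sub_add_cancel h).symm⟩
    rw [Group.rank_congr (Fintype.equivFinOfCardEq hm).permCongrHom]
    refine (Group.rank_le (S := {finRotate (m + 2), Equiv.swap 0 (finRotate (m + 2) 0)}) ?_).trans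
      Finset.card_le_two
    rw [Finset.coe_insert, Finset.coe_singleton]
    exact Equiv.Perm.closure_cycle_adjacent_swap isCycle_finRotate support_finRotate 0

theorem rank_alternatingGroup_le (α : Type*) [Fintype α] [DecidableEq α] [Nontrivial α] :
    Group.rank (alternatingGroup α) ≤ 4 := by
  refine (Subgroup.rank_le_index_mul_rank (alternatingGroup α)).trans ?_
  rw [alternatingGroup.index_eq_two]
  have := rank_perm_le_two α
  omega

/-- `Q` has a nonabelian simple normal subgroup of index at most two, generated by four
elements. -/
def IsGiant (Q : Type*) [Group Q] : Prop :=
  ∃ N : Subgroup Q, N.Normal ∧ N.index ≤ 2 ∧ IsSimpleGroup N ∧ (∃ x ∈ N, ∃ y ∈ N, ⁅x, y⁆ ≠ 1) ∧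
    ∃ S : Finset Q, S.card ≤ 4 ∧ Subgroup.closure (S : Set Q) = N

theorem isGiant_of_alternatingGroup_le {Q Ω : Type*} [Group Q] [Finite Q] [MulAction Q Ω]
    [FaithfulSMul Q Ω] [Fintype Ω] [DecidableEq Ω] (h5 : 5 ≤ Fintype.card Ω)
    (h : alternatingGroup Ω ≤ (MulAction.toPermHom Q Ω).range) : IsGiant Q := by
  classical
  have hnt : Nontrivial Ω := Fintype.one_lt_card_iff_nontrivial.1 (by omega)
  set φ := MulAction.toPermHom Q Ω with hφ
  have hinj : Function.Injective φ := MulAction.toPerm_injective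
  set N := (alternatingGroup Ω).comap φ with hN
  have hmap : N.map φ = alternatingGroup Ω := Subgroup.map_comap_eq_self h
  let e : N ≃* alternatingGroup Ω :=
    (N.equivMapOfInjective φ hinj).trans (MulEquiv.subgroupCongr hmap)
  have hcard : 5 ≤ Nat.card Ω := by rwa [Nat.card_eq_fintype_card]
  have hA := alternatingGroup.isSimpleGroup (α := Ω) hcard
  refine ⟨N, inferInstance, ?_, e.isSimpleGroup, ?_, ?_⟩
  · rw [Subgroup.index_comap]
    refine Nat.le_of_dvd (by norm_num) ?_
    rw [← alternatingGroup.index_eq_two (α := Ω)]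
    exact Subgroup.relIndex_dvd_index_of_normal _ _
  · by_contra hcon
    push Not at hcon
    have : IsMulCommutative (alternatingGroup Ω) := ⟨⟨fun x y => by
      have h1 := hcon _ (e.symm x).2 _ (e.symm y).2
      rw [commutatorElement_eq_one_iff_mul_comm] at h1
      have h2 : e.symm x * e.symm y = e.symm y * e.symm x := Subtype.ext h1
      rw [← map_mul, ← map_mul] at h2
      exact e.symm.injective h2⟩⟩
    have := alternatingGroup.isMulCommutative_iff_card_le_three.1 this
    omega
  · obtain ⟨S, hS, hSc⟩ := Group.rank_spec N
    refine ⟨S.image N.subtype, Finset.card_image_le.trans ?_, ?_⟩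
    · rw [hS, Group.rank_congr e]
      exact rank_alternatingGroup_le Ω
    · rw [Finset.coe_image, ← MonoidHom.map_closure, hSc, ← MonoidHom.range_eq_map,
        Subgroup.range_subtype]

theorem isMultiplyPretransitive_range {Q Ω : Type*} [Group Q] [MulAction Q Ω] {t : ℕ}
    (h : MulAction.IsMultiplyPretransitive Q Ω t) :
    MulAction.IsMultiplyPretransitive (MulAction.toPermHom Q Ω).range Ω t := by
  rw [MulAction.isMultiplyPretransitive_iff] at h ⊢
  intro x y
  obtain ⟨g, hg⟩ := h x y
  refine ⟨⟨MulAction.toPermHom Q Ω g, g, rfl⟩, ?_⟩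
  rw [← hg]
  ext i
  rfl

theorem eventually_base_bound : ∀ᶠ n : ℕ in Filter.atTop,
    (6 * (n : ℝ) ^ (3 / 4 : ℝ) * Real.log n + 66 * √n * Real.log n + (n : ℝ) ^ (4 / 5 : ℝ)) *
      Real.log n ≤ divSqrtLog n := by
  have hy : ∀ᶠ n : ℕ in Filter.atTop, (9 : ℝ) ≤ (n : ℝ) ^ (1 / 20 : ℝ) :=
    ((tendsto_rpow_atTop (by norm_num)).comp tendsto_natCast_atTop_atTop).eventually_ge_atTop 9
  filter_upwards [hy, eventually_log_le_mul_rpow (c := 1) (a := 1 / 20) (by norm_num) (by norm_num),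
    Filter.eventually_ge_atTop 2] with n h1 h2 hn
  have hn0 : (2 : ℝ) ≤ n := by exact_mod_cast hn
  rw [one_mul] at h2
  obtain ⟨v, hv⟩ : ∃ v, v = (n : ℝ) ^ (1 / 20 : ℝ) := ⟨_, rfl⟩
  rw [← hv] at h1 h2
  have hpow : ∀ k : ℕ, (n : ℝ) ^ ((k : ℝ) / 20) = v ^ k := by
    intro k
    rw [hv, ← Real.rpow_natCast, ← Real.rpow_mul (by linarith)]
    congr 1
    ring
  have p1 : (n : ℝ) ^ (3 / 4 : ℝ) = v ^ 15 := by
    rw [← hpow 15]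
    norm_num
  have p2 : √(n : ℝ) = v ^ 10 := by
    rw [Real.sqrt_eq_rpow, ← hpow 10]
    norm_num
  have p3 : (n : ℝ) ^ (4 / 5 : ℝ) = v ^ 16 := by
    rw [← hpow 16]
    norm_num
  have p4 : (n : ℝ) = v ^ 20 := by
    rw [← hpow 20]
    norm_num
  have hL : 0 < Real.log n := Real.log_pos (by linarith)
  obtain ⟨L, hLdef⟩ : ∃ L, L = Real.log n := ⟨_, rfl⟩
  rw [divSqrtLog, p1, p2, p3, ← hLdef, le_div_iff₀ (Real.sqrt_pos.2 (hLdef ▸ hL))]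
  rw [← hLdef] at hL h2
  have hs : √L ≤ v := Real.sqrt_le_iff.2 ⟨by linarith, by nlinarith⟩
  have hv0 : 0 ≤ v := by linarith
  calc (6 * v ^ 15 * L + 66 * v ^ 10 * L + v ^ 16) * L * √L
      ≤ (6 * v ^ 15 * v + 66 * v ^ 10 * v + v ^ 16) * v * v := by gcongr
    _ ≤ (6 * v ^ 15 * v + 66 * (v ^ 10 * v ^ 5) * v + v ^ 16) * v * v := by
        gcongr
        exact le_mul_of_one_le_right (by positivity) (one_le_pow₀ (by linarith))
    _ = 73 * v ^ 18 := by ring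
    _ ≤ v ^ 2 * v ^ 18 := by
        gcongr
        nlinarith
    _ = n := by rw [p4]; ring

/-- A primitive group is either giant or small. -/
theorem exists_primitive_bound : ∃ C : ℝ, 1 ≤ C ∧ ∀ (Q Ω : Type*) [Group Q] [Finite Q]
    [MulAction Q Ω] [FaithfulSMul Q Ω] [MulAction.IsPreprimitive Q Ω] [Fintype Ω],
    2 ≤ Fintype.card Ω →
    IsGiant Q ∨ Real.log (Nat.card Q) ≤ C * divSqrtLog (Fintype.card Ω) := by
  obtain ⟨N, hN⟩ := Filter.eventually_atTop.1
    (eventually_alternatingGroup_le.and (eventually_base_bound.and (Filter.eventually_ge_atTop 5)))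
  refine ⟨Real.log (N.factorial) + 1, ?_, ?_⟩
  · have := Real.log_natCast_nonneg N.factorial
    linarith
  intro Q Ω _ _ _ _ _ _ h2
  classical
  have hg1 := one_le_divSqrtLog h2
  have hlogN := Real.log_natCast_nonneg N.factorial
  have hcardpos : (0 : ℝ) < Nat.card Q := by exact_mod_cast Nat.card_pos
  have hnt : Nontrivial Ω := Fintype.one_lt_card_iff_nontrivial.1 (by omega)
  rcases Nat.lt_or_ge (Fintype.card Ω) N with hlt | hge
  · right
    have h3 : Nat.card Q ≤ N.factorial := by
      have h4 : Nat.card Q ≤ Nat.card (Equiv.Perm Ω) :=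
        Nat.card_le_card_of_injective (MulAction.toPermHom Q Ω) MulAction.toPerm_injective
      rw [Nat.card_eq_fintype_card (α := Equiv.Perm Ω), Fintype.card_perm] at h4
      exact h4.trans (Nat.factorial_le hlt.le)
    have h5 : Real.log (Nat.card Q) ≤ Real.log N.factorial :=
      Real.log_le_log hcardpos (by exact_mod_cast h3)
    nlinarith
  obtain ⟨hA, hB, h5⟩ := hN _ hge
  obtain ⟨n, hn⟩ : ∃ n, n = Fintype.card Ω := ⟨_, rfl⟩
  rw [← hn] at h2 hg1 hge hA hB h5
  have hn0 : (0 : ℝ) ≤ n := Nat.cast_nonneg n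
  have hL : 0 ≤ Real.log n := Real.log_natCast_nonneg n
  by_cases hgiant : ∃ t ≤ n, (n : ℝ) ^ (4 / 5 : ℝ) ≤ t ∧ MulAction.IsMultiplyPretransitive Q Ω t
  · left
    obtain ⟨t, ht, hnt, htr⟩ := hgiant
    exact isGiant_of_alternatingGroup_le (hn ▸ h5)
      (hA Ω _ t hn.symm ht hnt (isMultiplyPretransitive_range htr))
  right
  push Not at hgiant
  have hbase : ∃ Z : Finset Ω, IsActionBase Q Z ∧ (Z.card : ℝ) ≤
      6 * (n : ℝ) ^ (3 / 4 : ℝ) * Real.log n + 66 * √n * Real.log n + (n : ℝ) ^ (4 / 5 : ℝ) := by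
    have q1 : 0 ≤ 6 * (n : ℝ) ^ (3 / 4 : ℝ) * Real.log n := by positivity
    have q2 : 0 ≤ 66 * √n * Real.log n := by positivity
    have q3 : 0 ≤ (n : ℝ) ^ (4 / 5 : ℝ) := by positivity
    by_cases h22 : ∀ a b c d : Ω, a ≠ b → c ≠ d → SameOrbital Q a b c d
    · have h2t : MulAction.IsMultiplyPretransitive Q Ω 2 :=
        MulAction.is_two_pretransitive_iff.2 fun {a b c d} hab hcd => h22 a b c d hab hcd
      obtain ⟨t, ht⟩ : ∃ t, t = Nat.findGreatest
        (fun t => MulAction.IsMultiplyPretransitive Q Ω t) n := ⟨_, rfl⟩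
      have ht2 : 2 ≤ t := ht ▸ Nat.le_findGreatest h2 h2t
      have htt : MulAction.IsMultiplyPretransitive Q Ω t := by
        rw [ht]
        exact Nat.findGreatest_spec
          (P := fun t => MulAction.IsMultiplyPretransitive Q Ω t) h2 h2t
      have htn : t ≤ n := ht ▸ Nat.findGreatest_le n
      have htlt : (t : ℝ) < (n : ℝ) ^ (4 / 5 : ℝ) := by
        by_contra hcon
        exact hgiant t htn (not_lt.1 hcon) htt
      have htn' : t < n := by
        have : (t : ℝ) < n := htlt.trans_le (by
          conv_rhs => rw [← Real.rpow_one (n : ℝ)]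
          exact Real.rpow_le_rpow_of_exponent_le (by exact_mod_cast (by omega : 1 ≤ n))
            (by norm_num))
        exact_mod_cast this
      have hnot : ¬ MulAction.IsMultiplyPretransitive Q Ω (t + 1) :=
        Nat.findGreatest_is_greatest (P := fun t => MulAction.IsMultiplyPretransitive Q Ω t)
          (ht ▸ Nat.lt_succ_self t) htn'
      obtain ⟨k, rfl⟩ : ∃ k, t = k + 2 := ⟨_, (Nat.sub_add_cancel ht2).symm⟩
      obtain ⟨Z, hZ, hZc⟩ := exists_base_of_multiplyTransitive k htt hnot (hn ▸ htn)
      refine ⟨Z, hZ, hZc.trans ?_⟩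
      rw [← hn]
      push_cast at htlt
      linarith
    · obtain ⟨Z, hZ, hZc⟩ := exists_base_of_uniprimitive h22
      refine ⟨Z, hZ, hZc.trans ?_⟩
      rw [← hn]
      linarith
  obtain ⟨Z, hZ, hZc⟩ := hbase
  have h6 := hZ.card_le
  rw [← hn] at h6
  have h7 : Real.log (Nat.card Q) ≤ Z.card * Real.log n := by
    rw [← Real.log_pow]
    exact Real.log_le_log hcardpos (by exact_mod_cast h6)
  rw [← hn]
  have h8 := mul_le_mul_of_nonneg_right hZc hL
  nlinarith

end Primitive

section Costs

variable {G : Type*} [Group G]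

theorem exists_generators_relIndex [Finite G] (F : Subgroup G) : ∀ (k : ℕ) (D : Subgroup G),
    D ≤ F → D.relIndex F ≤ k →
    ∃ S : Finset G, (S : Set G) ⊆ F ∧ F ≤ Subgroup.closure (S : Set G) ⊔ D ∧
      2 ^ S.card ≤ D.relIndex F := by
  classical
  intro k
  induction k with
  | zero =>
    intro D _ h0
    have : D.relIndex F ≠ 0 := Subgroup.FiniteIndex.index_ne_zero
    omega
  | succ k ih =>
    intro D hDF hk
    by_cases hFD : F ≤ D
    · refine ⟨∅, by simp, hFD.trans le_sup_right, ?_⟩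
      rw [Finset.card_empty, pow_zero]
      exact Nat.one_le_iff_ne_zero.2 Subgroup.FiniteIndex.index_ne_zero
    · obtain ⟨x, hxF, hxD⟩ := SetLike.not_le_iff_exists.1 hFD
      have hle : Subgroup.closure {x} ⊔ D ≤ F :=
        sup_le ((Subgroup.closure_le _).2 (Set.singleton_subset_iff.2 hxF)) hDF
      have hmul := Subgroup.relIndex_mul_relIndex D (Subgroup.closure {x} ⊔ D) F le_sup_right hle
      have h1 : D.relIndex (Subgroup.closure {x} ⊔ D) ≠ 1 := by
        rw [Ne, Subgroup.relIndex_eq_one]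
        exact fun h => hxD (h (Subgroup.mem_sup_left (Subgroup.mem_closure_singleton_self x)))
      have h2 : D.relIndex (Subgroup.closure {x} ⊔ D) ≠ 0 := Subgroup.FiniteIndex.index_ne_zero
      have h3 : 2 ≤ D.relIndex (Subgroup.closure {x} ⊔ D) := by omega
      have h4 : (Subgroup.closure {x} ⊔ D).relIndex F ≠ 0 := Subgroup.FiniteIndex.index_ne_zero
      have h5 : 2 * (Subgroup.closure {x} ⊔ D).relIndex F ≤ D.relIndex F := by
        rw [← hmul]
        exact Nat.mul_le_mul_right _ h3
      obtain ⟨S, hS1, hS2, hS3⟩ := ih _ hle (by omega)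
      refine ⟨insert x S, ?_, ?_, ?_⟩
      · rw [Finset.coe_insert]
        exact Set.insert_subset hxF hS1
      · rw [Finset.coe_insert, Set.insert_eq, Subgroup.closure_union, sup_comm (Subgroup.closure {x}),
          sup_assoc]
        exact hS2
      · calc 2 ^ (insert x S).card ≤ 2 ^ (S.card + 1) :=
              Nat.pow_le_pow_right (by norm_num) (Finset.card_insert_le _ _)
          _ = 2 * 2 ^ S.card := by ring
          _ ≤ _ := (Nat.mul_le_mul_left 2 hS3).trans h5

theorem card_le_two_mul_log {m k : ℕ} (h : 2 ^ m ≤ k) : (m : ℝ) ≤ 2 * Real.log k := by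
  have h1 : ((2 : ℝ) ^ m) ≤ k := by exact_mod_cast h
  have h2 := Real.log_le_log (by positivity) h1
  rw [Real.log_pow] at h2
  have := Real.log_two_gt_d9
  nlinarith [(Nat.cast_nonneg m : (0 : ℝ) ≤ m)]

theorem genBound_relIndex [Finite G] {F D : Subgroup G} (h : D ≤ F) {m : ℝ}
    (hm : ∀ k : ℕ, 2 ^ k ≤ D.relIndex F → (k : ℝ) ≤ m) : GenBound F D m := by
  intro L hL
  obtain ⟨S, _, h2, h3⟩ := exists_generators_relIndex F _ D h le_rfl
  refine ⟨S, hm _ h3, ?_⟩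
  rw [sup_assoc]
  exact top_le_iff.1 (hL.ge.trans (sup_le_sup_left h2 L))

theorem card_le_relIndex_pow [Finite G] {K D St : Subgroup G} [K.Normal] (hD : NormBy St D)
    (hcore : D.normalCore = ⊥) : Nat.card K ≤ D.relIndex K ^ St.index := by
  have := Fintype.ofFinite (G ⧸ St)
  have hconj : ∀ (g : G) (k : K), g⁻¹ * k * g ∈ K := fun g k => by
    simpa using ‹K.Normal›.conj_mem _ k.2 g⁻¹
  let f : K → (G ⧸ St → K ⧸ D.subgroupOf K) := fun k i =>
    QuotientGroup.mk ⟨i.out⁻¹ * k * i.out, hconj _ _⟩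
  have hf : Function.Injective f := by
    intro k k' h
    have h1 : (k : G)⁻¹ * k' ∈ D.normalCore := by
      intro g
      have h2 := congrFun h (QuotientGroup.mk g⁻¹)
      have h3 := QuotientGroup.eq.1 h2
      rw [Subgroup.mem_subgroupOf] at h3
      set u := (QuotientGroup.mk g⁻¹ : G ⧸ St).out with hu
      have h4 : u⁻¹ * ((k : G)⁻¹ * k') * u ∈ D := by
        convert h3 using 1
        simp [mul_assoc]
      have h5 : g * u ∈ St := by
        have : u⁻¹ * g⁻¹ ∈ St := QuotientGroup.eq.1 (QuotientGroup.out_eq' _)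
        simpa using St.inv_mem this
      have h6 := hD _ h5 _ h4
      convert h6 using 1
      group
    rw [hcore, Subgroup.mem_bot, inv_mul_eq_one] at h1
    exact Subtype.ext h1
  have h1 := Nat.card_le_card_of_injective f hf
  rwa [Nat.card_fun, Nat.card_eq_fintype_card (α := G ⧸ St), ← Nat.card_eq_fintype_card,
    ← Subgroup.index_eq_card, ← Subgroup.index_eq_card] at h1

/-- An abelian chief section of `St` is elementary abelian. -/
theorem exists_prime_of_abelian_chief [Finite G] {D E St : Subgroup G} (hDE : D ≤ E) (hne : D ≠ E)
    (hES : E ≤ St) (hD : NormBy St D) (hE : NormBy St E)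
    (hchief : ∀ F, D ≤ F → F ≤ E → NormBy St F → F = D ∨ F = E)
    (hcomm : ∀ x ∈ E, ∀ y ∈ E, ⁅x, y⁆ ∈ D) :
    ∃ p a : ℕ, p.Prime ∧ (∀ x ∈ E, x ^ p ∈ D) ∧ D.relIndex E = p ^ a := by
  have hN : (D.subgroupOf E).Normal := ⟨fun x hx g => hD g (hES g.2) x hx⟩
  let i : CommGroup (E ⧸ D.subgroupOf E) :=
    { (inferInstance : Group (E ⧸ D.subgroupOf E)) with
      mul_comm := fun a b => by
        obtain ⟨x, rfl⟩ := QuotientGroup.mk_surjective a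
        obtain ⟨y, rfl⟩ := QuotientGroup.mk_surjective b
        refine QuotientGroup.eq.2 ?_
        rw [Subgroup.mem_subgroupOf]
        have := hcomm _ (E.inv_mem y.2) _ (E.inv_mem x.2)
        rw [commutatorElement_def] at this
        simpa [mul_assoc] using this }
  have hcard : Nat.card (E ⧸ D.subgroupOf E) = D.relIndex E := (Subgroup.index_eq_card _).symm
  have h1 : D.relIndex E ≠ 1 := by
    rw [Ne, Subgroup.relIndex_eq_one]
    exact fun h => hne (le_antisymm hDE h)
  obtain ⟨p, hp, hpd⟩ := Nat.exists_prime_and_dvd h1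
  have : Fact p.Prime := ⟨hp⟩
  let F : Subgroup G :=
    ((powMonoidHom p : (E ⧸ D.subgroupOf E) →* (E ⧸ D.subgroupOf E)).ker.comap
      (QuotientGroup.mk' (D.subgroupOf E))).map E.subtype
  have hF : ∀ x, x ∈ F ↔ x ∈ E ∧ x ^ p ∈ D := by
    intro x
    have key : ∀ hx : x ∈ E, (QuotientGroup.mk (s := D.subgroupOf E) ⟨x, hx⟩) ^ p = 1 ↔
        x ^ p ∈ D := fun hx => by
      rw [← QuotientGroup.mk_pow, QuotientGroup.eq_one_iff, Subgroup.mem_subgroupOf]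
      rfl
    constructor
    · rintro ⟨y, hy, rfl⟩
      exact ⟨y.2, (key y.2).1 hy⟩
    · rintro ⟨h2, h3⟩
      exact ⟨⟨x, h2⟩, (key h2).2 h3, rfl⟩
  have hDF : D ≤ F := fun x hx => (hF x).2 ⟨hDE hx, D.pow_mem hx p⟩
  have hFE : F ≤ E := fun x hx => ((hF x).1 hx).1
  have hFn : NormBy St F := by
    intro m hm x hx
    rw [hF] at hx ⊢
    refine ⟨hE m hm x hx.1, ?_⟩
    rw [conj_pow]
    exact hD m hm _ hx.2
  have hFeq : F = E := by
    refine (hchief F hDF hFE hFn).resolve_left fun h => ?_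
    have : Fintype (E ⧸ D.subgroupOf E) := Fintype.ofFinite _
    obtain ⟨x, hx⟩ := exists_prime_orderOf_dvd_card' (G := E ⧸ D.subgroupOf E) p (hcard ▸ hpd)
    obtain ⟨y, rfl⟩ := QuotientGroup.mk_surjective x
    have h2 : (y : G) ∈ F := by
      refine ⟨y, ?_, rfl⟩
      change (QuotientGroup.mk (s := D.subgroupOf E) y) ^ p = 1
      rw [← hx, pow_orderOf_eq_one]
    rw [h] at h2
    have h3 : (QuotientGroup.mk y : E ⧸ D.subgroupOf E) = 1 :=
      (QuotientGroup.eq_one_iff y).2 (Subgroup.mem_subgroupOf.2 h2)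
    rw [h3, orderOf_one] at hx
    exact hp.one_lt.ne hx
  have hpow : ∀ x ∈ E, x ^ p ∈ D := fun x hx => ((hF x).1 (hFeq ▸ hx)).2
  have hpg : IsPGroup p (E ⧸ D.subgroupOf E) := by
    intro x
    refine ⟨1, ?_⟩
    obtain ⟨y, rfl⟩ := QuotientGroup.mk_surjective x
    rw [pow_one, ← QuotientGroup.mk_pow, QuotientGroup.eq_one_iff, Subgroup.mem_subgroupOf]
    exact hpow _ y.2
  obtain ⟨a, ha⟩ := IsPGroup.iff_card.1 hpg
  exact ⟨p, a, hp, hpow, hcard ▸ ha⟩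

theorem genBound_chief [Finite G] {D E St : Subgroup G} (hDE : D ≤ E) (hne : D ≠ E)
    (hES : E ≤ St) (hD : NormBy St D) (hE : NormBy St E) (hs : 2 ≤ St.index)
    (hchief : ∀ F, D ≤ F → F ≤ E → NormBy St F → F = D ∨ F = E) :
    GenBound E.normalCore D.normalCore
      (3 * Real.log (D.relIndex E) * divSqrtLog St.index) := by
  by_cases hcomm : ∀ x ∈ E, ∀ y ∈ E, ⁅x, y⁆ ∈ D
  · obtain ⟨p, a, hp, hpow, hidx⟩ := exists_prime_of_abelian_chief hDE hne hES hD hE hchief hcomm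
    have : Fact p.Prime := ⟨hp⟩
    refine (genBound_elementary E D St hcomm hpow hD hDE hES hs hidx.le).mono (le_of_eq ?_)
    rw [hidx, divSqrtLog, Nat.cast_pow, Real.log_pow]
    ring
  · push Not at hcomm
    have hmono : ∀ F, D ≤ F → F ≤ E → D.relIndex F ≤ D.relIndex E := fun F h1 h2 =>
      Nat.le_of_dvd (Nat.pos_of_ne_zero Subgroup.FiniteIndex.index_ne_zero)
        (Dvd.intro _ (Subgroup.relIndex_mul_relIndex D F E h1 h2))
    refine (genBound_nonabelian hDE hES hD hchief hcomm (m := Nat.log 2 (D.relIndex E)) ?_).mono ?_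
    · intro F h1 h2 _
      obtain ⟨S, hS1, hS2, hS3⟩ := exists_generators_relIndex F _ D h1 le_rfl
      exact ⟨S, Nat.le_log_of_pow_le (by norm_num) (hS3.trans (hmono F h1 h2)), hS1, hS2⟩
    · have h1 : ((Nat.log 2 (D.relIndex E) : ℕ) : ℝ) ≤ 2 * Real.log (D.relIndex E) :=
        card_le_two_mul_log (Nat.pow_log_le_self 2 Subgroup.FiniteIndex.index_ne_zero)
      have h2 := one_le_divSqrtLog hs
      have h3 := Real.log_natCast_nonneg (D.relIndex E)
      nlinarith

theorem genBound_chain [Finite G] {D St : Subgroup G} (hD : NormBy St D) (hs : 2 ≤ St.index) :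
    ∀ (k : ℕ) (E : Subgroup G), D.relIndex E ≤ k → D ≤ E → E ≤ St → NormBy St E →
    GenBound E.normalCore D.normalCore
      (3 * Real.log (D.relIndex E) * divSqrtLog St.index) := by
  intro k
  induction k with
  | zero =>
    intro E h0
    have : D.relIndex E ≠ 0 := Subgroup.FiniteIndex.index_ne_zero
    omega
  | succ k ih =>
    intro E hk hDE hES hE
    by_cases hne : D = E
    · subst hne
      refine GenBound.of_le le_rfl ?_
      have h2 := one_le_divSqrtLog hs
      have h3 := Real.log_natCast_nonneg (D.relIndex D)
      positivity
    obtain ⟨M, hM⟩ := (Set.toFinite {M : Subgroup G | D ≤ M ∧ M ≤ E ∧ M ≠ E ∧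
      NormBy St M}).exists_maximal ⟨D, le_rfl, hDE, hne, hD⟩
    obtain ⟨hDM, hME, hMne, hMn⟩ := hM.1
    have hmul := Subgroup.relIndex_mul_relIndex D M E hDM hME
    have h1 : M.relIndex E ≠ 1 := by
      rw [Ne, Subgroup.relIndex_eq_one]
      exact fun h => hMne (le_antisymm hME h)
    have h2 : M.relIndex E ≠ 0 := Subgroup.FiniteIndex.index_ne_zero
    have h3 : D.relIndex M ≠ 0 := Subgroup.FiniteIndex.index_ne_zero
    have hlt : D.relIndex M ≤ k := by
      have : 2 ≤ M.relIndex E := by omega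
      nlinarith [Nat.pos_of_ne_zero h3]
    have hlog : Real.log (D.relIndex E) = Real.log (M.relIndex E) + Real.log (D.relIndex M) := by
      rw [← hmul, Nat.cast_mul, Real.log_mul (by exact_mod_cast h3) (by exact_mod_cast h2)]
      ring
    have hc := genBound_chief hME hMne hES hMn hE hs fun F hF1 hF2 hF3 => by
      by_contra hcon
      push Not at hcon
      exact hcon.1 (le_antisymm (hM.2 ⟨hDM.trans hF1, hF2, hcon.2, hF3⟩ hF1) hF1)
    refine (hc.trans (ih M hlt hDM (hME.trans hES) hMn)).mono (le_of_eq ?_)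
    rw [hlog]
    ring

end Costs

section Giant

variable {G : Type*} [Group G] {Q : Type*} [Group Q]

/-- The preimage in `K` of a subgroup of a quotient of `St`. -/
def pullSub {St : Subgroup G} (π : St →* Q) (K : Subgroup G) (X : Subgroup Q) : Subgroup G :=
  (X.comap π).map St.subtype ⊓ K

section

variable {St K : Subgroup G} {π : St →* Q} {X Y : Subgroup Q}

theorem mem_pullSub {x : G} :
    x ∈ pullSub π K X ↔ x ∈ K ∧ ∃ h : x ∈ St, π ⟨x, h⟩ ∈ X := by
  constructor
  · rintro ⟨⟨y, hy, rfl⟩, hx⟩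
    exact ⟨hx, y.2, hy⟩
  · rintro ⟨hx, h, hy⟩
    exact ⟨⟨⟨x, h⟩, hy, rfl⟩, hx⟩

theorem pullSub_le : pullSub π K X ≤ K := inf_le_right

theorem pullSub_mono (h : X ≤ Y) : pullSub π K X ≤ pullSub π K Y :=
  inf_le_inf_right _ (Subgroup.map_mono (Subgroup.comap_mono h))

theorem normBy_pullSub [K.Normal] [X.Normal] : NormBy St (pullSub π K X) := by
  intro m hm x hx
  rw [mem_pullSub] at hx ⊢
  obtain ⟨h1, h2, h3⟩ := hx
  refine ⟨‹K.Normal›.conj_mem x h1 m, St.mul_mem (St.mul_mem hm h2) (St.inv_mem hm), ?_⟩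
  have : π ⟨m * x * m⁻¹, St.mul_mem (St.mul_mem hm h2) (St.inv_mem hm)⟩ =
      π ⟨m, hm⟩ * π ⟨x, h2⟩ * (π ⟨m, hm⟩)⁻¹ := by
    rw [← map_inv, ← map_mul, ← map_mul]
    rfl
  rw [this]
  exact ‹X.Normal›.conj_mem _ h3 _

theorem relIndex_pullSub (hKS : K ≤ St) :
    (pullSub π K X).relIndex K = X.relIndex ((K.subgroupOf St).map π) := by
  have h1 : K = (K.subgroupOf St).map St.subtype := (Subgroup.map_subgroupOf_eq_of_le hKS).symm
  rw [pullSub, Subgroup.inf_relIndex_right, ← Subgroup.relIndex_comap]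
  conv_lhs => rw [h1]
  exact Subgroup.relIndex_map_map_of_injective _ _ St.subtype_injective

end

theorem commutator_mem_of_index_le_two {N : Subgroup Q} [N.Normal] [N.FiniteIndex]
    (h : N.index ≤ 2) (x y : Q) : ⁅x, y⁆ ∈ N ∧ x ^ 2 ∈ N := by
  have h0 : N.index ≠ 0 := Subgroup.FiniteIndex.index_ne_zero
  rcases (by omega : N.index = 1 ∨ N.index = 2) with h1 | h2
  · rw [Subgroup.index_eq_one.1 h1]
    exact ⟨Subgroup.mem_top _, Subgroup.mem_top _⟩
  · refine ⟨?_, Subgroup.sq_mem_of_index_two h2 x⟩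
    rw [commutatorElement_def]
    simp only [Subgroup.mul_mem_iff_of_index_two h2, inv_mem_iff]
    tauto

theorem genBound_giant [Finite G] [Finite Q] (hQ : IsGiant Q) {K St : Subgroup G} [K.Normal]
    (hKS : K ≤ St) (π : St →* Q) (hπ : Function.Surjective π) :
    GenBound K (pullSub π K ⊥).normalCore (3 * divSqrtLog St.index + 5) := by
  classical
  obtain ⟨N, hN, hidx, hsimple, ⟨x, hx, y, hy, hxy⟩, S, hScard, hSN⟩ := hQ
  have hg0 : 0 ≤ divSqrtLog St.index := by unfold divSqrtLog; positivity
  have hrel : (pullSub π K N).relIndex K ≤ 2 := by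
    rw [relIndex_pullSub hKS]
    exact (Nat.le_of_dvd (Nat.pos_of_ne_zero Subgroup.FiniteIndex.index_ne_zero)
      (Subgroup.relIndex_dvd_index_of_normal _ _)).trans hidx
  have hstep1 : GenBound K (pullSub π K N).normalCore (3 * divSqrtLog St.index + 1) := by
    have h0 : St.index ≠ 0 := Subgroup.FiniteIndex.index_ne_zero
    rcases (by omega : St.index = 1 ∨ 2 ≤ St.index) with h1 | h2
    · have hnorm : (pullSub π K N).Normal := ⟨fun x hx g =>
        normBy_pullSub g (Subgroup.index_eq_one.1 h1 ▸ Subgroup.mem_top g) x hx⟩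
      rw [Subgroup.normalCore_eq_self]
      refine genBound_relIndex pullSub_le fun k hk => ?_
      have : k ≤ 1 := by
        by_contra hcon
        have := Nat.pow_le_pow_right (show 0 < 2 by norm_num) (show 2 ≤ k by omega)
        omega
      have : (k : ℝ) ≤ 1 := by exact_mod_cast this
      linarith
    · have hp : Fact (Nat.Prime 2) := ⟨Nat.prime_two⟩
      have h3 := genBound_elementary (p := 2) (a := 1) K (pullSub π K N) St
        (fun x hx y hy => mem_pullSub.2 ⟨?_, ?_, ?_⟩) (fun x hx => mem_pullSub.2 ⟨?_, ?_, ?_⟩)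
        normBy_pullSub pullSub_le hKS h2 (by simpa using hrel)
      · rw [Subgroup.normalCore_eq_self] at h3
        refine h3.mono ?_
        have h4 : 3 * ((1 : ℕ) : ℝ) * Real.log (2 : ℕ) * St.index / √(Real.log St.index) =
            3 * Real.log 2 * divSqrtLog St.index := by
          rw [divSqrtLog]
          push_cast
          ring
        rw [h4]
        nlinarith [Real.log_two_lt_d9]
      · rw [commutatorElement_def]
        exact K.mul_mem (K.mul_mem (K.mul_mem hx hy) (K.inv_mem hx)) (K.inv_mem hy)
      · exact hKS (by
          rw [commutatorElement_def]
          exact K.mul_mem (K.mul_mem (K.mul_mem hx hy) (K.inv_mem hx)) (K.inv_mem hy))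
      · have h := (commutator_mem_of_index_le_two hidx (π ⟨x, hKS hx⟩) (π ⟨y, hKS hy⟩)).1
        rw [← map_commutatorElement] at h
        exact h
      · exact K.pow_mem hx 2
      · exact hKS (K.pow_mem hx 2)
      · have h := (commutator_mem_of_index_le_two hidx (π ⟨x, hKS hx⟩) 1).2
        rw [← map_pow] at h
        exact h
  have hstep2 : GenBound (pullSub π K N).normalCore (pullSub π K ⊥).normalCore 4 := by
    have hRn : ((K.subgroupOf St).map π).Normal :=
      Subgroup.Normal.map (inferInstance : (K.subgroupOf St).Normal) π hπ
    have hmemR : ∀ z ∈ (K.subgroupOf St).map π, ∃ k, ∃ h : k ∈ K, π ⟨k, hKS h⟩ = z := by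
      rintro _ ⟨k, hk, rfl⟩
      exact ⟨k, hk, rfl⟩
    rcases (inferInstance : (((K.subgroupOf St).map π).subgroupOf N).Normal).eq_bot_or_eq_top
      with hbot | htop
    · refine GenBound.of_le (Subgroup.normalCore_mono ?_) (by norm_num)
      intro z hz
      rw [mem_pullSub] at hz ⊢
      obtain ⟨h1, h2, h3⟩ := hz
      refine ⟨h1, h2, ?_⟩
      have h4 : (⟨_, h3⟩ : N) ∈ ((K.subgroupOf St).map π).subgroupOf N := ⟨⟨z, h2⟩, h1, rfl⟩
      rw [hbot, Subgroup.mem_bot] at h4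
      exact congrArg Subtype.val h4
    have hNR : N ≤ (K.subgroupOf St).map π := Subgroup.subgroupOf_eq_top.1 htop
    have hlift : ∀ z ∈ N, ∃ k ∈ pullSub π K N, ∃ h : k ∈ St, π ⟨k, h⟩ = z := by
      intro z hz
      obtain ⟨k, hk, rfl⟩ := hmemR z (hNR hz)
      exact ⟨k, mem_pullSub.2 ⟨hk, hKS hk, hz⟩, hKS hk, rfl⟩
    have hchief : ∀ F, pullSub π K ⊥ ≤ F → F ≤ pullSub π K N → NormBy (pullSub π K N) F →
        F = pullSub π K ⊥ ∨ F = pullSub π K N := by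
      intro F hF1 hF2 hF3
      have hFS : F ≤ St := hF2.trans (pullSub_le.trans hKS)
      have hn : (((F.subgroupOf St).map π).subgroupOf N).Normal := by
        refine ⟨fun z hz g => ?_⟩
        obtain ⟨f, hf, hfz⟩ := hz
        obtain ⟨k, hk, hkS, hkg⟩ := hlift g g.2
        refine ⟨⟨k * f * k⁻¹, hFS (hF3 k hk f hf)⟩, hF3 k hk f hf, ?_⟩
        have : (⟨k * f * k⁻¹, hFS (hF3 k hk f hf)⟩ : St) = ⟨k, hkS⟩ * f * ⟨k, hkS⟩⁻¹ := rfl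
        rw [this, map_mul, map_mul, map_inv, hkg, hfz]
        rfl
      rcases hn.eq_bot_or_eq_top with hb | ht
      · left
        refine le_antisymm (fun f hf => ?_) hF1
        obtain ⟨h1, h2, h3⟩ := mem_pullSub.1 (hF2 hf)
        refine mem_pullSub.2 ⟨h1, h2, ?_⟩
        have h4 : (⟨_, h3⟩ : N) ∈ ((F.subgroupOf St).map π).subgroupOf N := ⟨⟨f, h2⟩, hf, rfl⟩
        rw [hb, Subgroup.mem_bot] at h4
        exact congrArg Subtype.val h4
      · right
        refine le_antisymm hF2 fun k hk => ?_
        obtain ⟨h1, h2, h3⟩ := mem_pullSub.1 hk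
        obtain ⟨f, hf, hfk⟩ := Subgroup.subgroupOf_eq_top.1 ht h3
        have h4 : k * (f : G)⁻¹ ∈ pullSub π K ⊥ := by
          have hfK : (f : G) ∈ K := (mem_pullSub.1 (hF2 hf)).1
          refine mem_pullSub.2 ⟨K.mul_mem h1 (K.inv_mem hfK), St.mul_mem h2 (St.inv_mem f.2), ?_⟩
          have : (⟨k * (f : G)⁻¹, St.mul_mem h2 (St.inv_mem f.2)⟩ : St) = ⟨k, h2⟩ * f⁻¹ := rfl
          rw [this, map_mul, map_inv, hfk, mul_inv_cancel]
          exact Subgroup.mem_bot.2 rfl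
        have h5 := F.mul_mem (hF1 h4) hf
        simpa using h5
    have hD1S : pullSub π K N ≤ St := pullSub_le.trans hKS
    have := genBound_nonabelian (St := St) (m := 4) (pullSub_mono (π := π) (K := K) (bot_le : ⊥ ≤ N))
      hD1S normBy_pullSub (fun F h1 h2 h3 => hchief F h1 h2 (h3.mono hD1S)) ?_ ?_
    · exact_mod_cast this
    · obtain ⟨u, hu, huS, rfl⟩ := hlift x hx
      obtain ⟨v, hv, hvS, rfl⟩ := hlift y hy
      refine ⟨u, hu, v, hv, fun hcon => hxy ?_⟩
      obtain ⟨_, h1, h2⟩ := mem_pullSub.1 hcon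
      rw [Subgroup.mem_bot] at h2
      rw [← h2, ← map_commutatorElement]
      rfl
    · intro F hF1 hF2 hF3
      rcases hchief F hF1 hF2 hF3 with rfl | rfl
      · exact ⟨∅, by simp, by simp, le_sup_right⟩
      · have hSN' : ∀ z ∈ S, z ∈ N := fun z hz => hSN ▸ Subgroup.subset_closure hz
        have hchoose : ∀ z : Q, ∃ k, z ∈ S → k ∈ pullSub π K N ∧ ∃ h : k ∈ St, π ⟨k, h⟩ = z := by
          intro z
          by_cases hz : z ∈ S
          · obtain ⟨k, h1, h2⟩ := hlift z (hSN' z hz)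
            exact ⟨k, fun _ => ⟨h1, h2⟩⟩
          · exact ⟨1, fun h => absurd h hz⟩
        choose f hf using hchoose
        have hsub : ((S.image f : Finset G) : Set G) ⊆ pullSub π K N := by
          rw [Finset.coe_image, Set.image_subset_iff]
          exact fun z hz => (hf z hz).1
        refine ⟨S.image f, Finset.card_image_le.trans hScard, hsub, ?_⟩
        intro k hk
        obtain ⟨h1, h2, h3⟩ := mem_pullSub.1 hk
        have hclS : Subgroup.closure ((S.image f : Finset G) : Set G) ≤ pullSub π K N :=
          (Subgroup.closure_le _).2 hsub
        have hNle : N ≤ ((Subgroup.closure ((S.image f : Finset G) : Set G)).subgroupOf St).map π := by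
          rw [← hSN, Subgroup.closure_le]
          intro z hz
          obtain ⟨h4, h5⟩ := (hf z hz).2
          exact ⟨⟨f z, h4⟩, Subgroup.subset_closure (Finset.mem_coe.2
            (Finset.mem_image_of_mem f hz)), h5⟩
        obtain ⟨c, hc, hck⟩ := hNle h3
        have hcK : (c : G) ∈ K := (mem_pullSub.1 (hclS hc)).1
        have h6 : (c : G)⁻¹ * k ∈ pullSub π K ⊥ := by
          refine mem_pullSub.2 ⟨K.mul_mem (K.inv_mem hcK) h1, St.mul_mem (St.inv_mem c.2) h2, ?_⟩
          have : (⟨(c : G)⁻¹ * k, St.mul_mem (St.inv_mem c.2) h2⟩ : St) = c⁻¹ * ⟨k, h2⟩ := rfl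
          rw [this, map_mul, map_inv, hck, inv_mul_cancel]
          exact Subgroup.mem_bot.2 rfl
        have h7 := Subgroup.mul_mem_sup (show (c : G) ∈ Subgroup.closure _ from hc) h6
        simpa using h7
  have h := hstep1.trans hstep2
  refine h.mono ?_
  linarith

end Giant

section Main

theorem divSqrtLog_nonneg (n : ℕ) : 0 ≤ divSqrtLog n := by
  unfold divSqrtLog
  positivity

theorem divSqrtLog_mul_le {r s : ℕ} (hr : 2 ≤ r) (hs : r ≤ s) :
    divSqrtLog r * divSqrtLog s ≤ 2 * divSqrtLog (r * s) := by
  have hr' : (2 : ℝ) ≤ r := by exact_mod_cast hr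
  have hs' : (r : ℝ) ≤ s := by exact_mod_cast hs
  have ha : Real.log 2 ≤ Real.log r := Real.log_le_log (by norm_num) hr'
  have hb : Real.log r ≤ Real.log s := Real.log_le_log (by linarith) hs'
  have h2 := Real.log_two_gt_d9
  unfold divSqrtLog
  rw [Nat.cast_mul, Real.log_mul (by linarith) (by linarith)]
  generalize Real.log r = a at *
  generalize Real.log s = b at *
  have ha0 : 0 < √a := Real.sqrt_pos.2 (by linarith)
  have hb0 : 0 < √b := Real.sqrt_pos.2 (by linarith)
  have hab : 0 < √(a + b) := Real.sqrt_pos.2 (by linarith)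
  have hle : √(a + b) ≤ 2 * (√a * √b) := by
    refine Real.sqrt_le_iff.2 ⟨by positivity, ?_⟩
    rw [mul_pow, mul_pow, Real.sq_sqrt (by linarith), Real.sq_sqrt (by linarith)]
    nlinarith
  rw [div_mul_div_comm, ← mul_div_assoc, div_le_div_iff₀ (by positivity) hab]
  have : (0 : ℝ) ≤ r * s := by nlinarith
  nlinarith

theorem mul_divSqrtLog_le {r s : ℕ} (hs : 1 ≤ s) (hr : s < r) :
    s * divSqrtLog r ≤ 2 * divSqrtLog (r * s) := by
  have hs' : (1 : ℝ) ≤ s := by exact_mod_cast hs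
  have hr' : (s : ℝ) < r := by exact_mod_cast hr
  have ha : 0 < Real.log r := Real.log_pos (by linarith)
  have hb : Real.log s ≤ Real.log r := Real.log_le_log (by linarith) hr'.le
  have hb0 : 0 ≤ Real.log s := Real.log_nonneg hs'
  unfold divSqrtLog
  rw [Nat.cast_mul, Real.log_mul (by linarith) (by linarith)]
  generalize Real.log r = a at *
  generalize Real.log s = b at *
  have ha0 : 0 < √a := Real.sqrt_pos.2 (by linarith)
  have hab : 0 < √(a + b) := Real.sqrt_pos.2 (by linarith)
  have hle : √(a + b) ≤ 2 * √a := by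
    refine Real.sqrt_le_iff.2 ⟨by positivity, ?_⟩
    rw [mul_pow, Real.sq_sqrt (by linarith)]
    linarith
  rw [← mul_div_assoc, ← mul_div_assoc, div_le_div_iff₀ ha0 hab]
  have : (0 : ℝ) ≤ r * s := by nlinarith
  nlinarith

theorem divSqrtLog_le_of_mul {r s : ℕ} (hr : 2 ≤ r) (hs : 2 ≤ s) :
    4 * divSqrtLog s ≤ 3 * divSqrtLog (r * s) := by
  have hs' : (2 : ℝ) ≤ s := by exact_mod_cast hs
  have hr' : (2 : ℝ) ≤ r := by exact_mod_cast hr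
  have hb : Real.log 2 ≤ Real.log s := Real.log_le_log (by norm_num) hs'
  have ha : Real.log r ≤ (r - 1) * Real.log 2 := by
    obtain ⟨k, rfl⟩ : ∃ k, r = k + 1 := ⟨r - 1, by omega⟩
    have h1 : ((k + 1 : ℕ) : ℝ) ≤ (2 : ℝ) ^ k := by exact_mod_cast (Nat.lt_two_pow_self (n := k))
    have h2 := Real.log_le_log (by positivity) h1
    rw [Real.log_pow] at h2
    push_cast at h2 ⊢
    linarith
  have ha0 : 0 < Real.log r := Real.log_pos (by linarith)
  have h2 := Real.log_two_gt_d9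
  unfold divSqrtLog
  rw [Nat.cast_mul, Real.log_mul (by linarith) (by linarith)]
  generalize Real.log r = a at *
  generalize Real.log s = b at *
  have hb0 : 0 < √b := Real.sqrt_pos.2 (by linarith)
  have hab : 0 < √(a + b) := Real.sqrt_pos.2 (by linarith)
  have hle : 4 * √(a + b) ≤ 3 * r * √b := by
    have h3 : √(a + b) ≤ 3 * r * √b / 4 := by
      refine Real.sqrt_le_iff.2 ⟨by positivity, ?_⟩
      rw [div_pow, mul_pow, mul_pow, Real.sq_sqrt (by linarith)]
      have h4 : a + b ≤ r * b := by nlinarith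
      have h5 : (r : ℝ) * b ≤ 9 / 16 * r * (r * b) := by
        have : 0 ≤ (r : ℝ) * b := by nlinarith
        nlinarith
      linarith
    linarith
  rw [← mul_div_assoc, ← mul_div_assoc, div_le_div_iff₀ hb0 hab]
  nlinarith

theorem isCoatom_subgroupOf {G : Type*} [Group G] {H St : Subgroup G} (h : H ⋖ St) :
    IsCoatom (H.subgroupOf St) := by
  refine ⟨fun ht => h.lt.not_ge (Subgroup.subgroupOf_eq_top.1 ht), fun X hX => ?_⟩
  have h1 : H < X.map St.subtype := by
    refine lt_of_le_of_ne ?_ fun he => ?_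
    · rw [← Subgroup.map_subgroupOf_eq_of_le h.le]
      exact Subgroup.map_mono hX.le
    · refine hX.ne ?_
      rw [he, Subgroup.subgroupOf, Subgroup.comap_map_eq_self_of_injective St.subtype_injective]
  have h2 : X.map St.subtype = St :=
    (lt_or_eq_of_le (Subgroup.map_subtype_le X)).resolve_left (h.2 h1)
  rw [eq_top_iff]
  intro x _
  obtain ⟨y, hy, hyx⟩ := h2.ge x.2
  rwa [← Subtype.ext hyx]

theorem exists_genBound_normalCore : ∃ C : ℝ, 0 ≤ C ∧ ∀ (G : Type*) [Group G] [Finite G]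
    (H St : Subgroup G), H ⋖ St → H.normalCore = ⊥ → 2 ≤ H.index →
    GenBound St.normalCore ⊥ (C * divSqrtLog H.index) := by
  obtain ⟨C, hC1, hC⟩ := exists_primitive_bound
  refine ⟨8 + 6 * C, by linarith, ?_⟩
  intro G _ _ H St hcov hcore hn
  have := Fintype.ofFinite (St ⧸ H.subgroupOf St)
  obtain ⟨r, hr⟩ : ∃ r, r = H.relIndex St := ⟨_, rfl⟩
  obtain ⟨s, hs⟩ : ∃ s, s = St.index := ⟨_, rfl⟩
  have hrs : r * s = H.index := by
    rw [hr, hs]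
    exact Subgroup.relIndex_mul_index hcov.le
  have hcoatom := isCoatom_subgroupOf hcov
  have hcardΩ : Fintype.card (St ⧸ H.subgroupOf St) = r := by
    rw [hr, ← Nat.card_eq_fintype_card, ← Subgroup.index_eq_card]
    rfl
  have hr2 : 2 ≤ r := by
    have h0 : H.relIndex St ≠ 0 := Subgroup.FiniteIndex.index_ne_zero
    have h1 : H.relIndex St ≠ 1 := by
      rw [Ne, Subgroup.relIndex_eq_one]
      exact hcov.lt.not_ge
    omega
  have hs1 : 1 ≤ s := by
    have h0 : St.index ≠ 0 := Subgroup.FiniteIndex.index_ne_zero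
    omega
  have hnt : Nontrivial (St ⧸ H.subgroupOf St) :=
    Fintype.one_lt_card_iff_nontrivial.1 (by omega)
  have hprim : MulAction.IsPreprimitive St (St ⧸ H.subgroupOf St) := by
    rw [← MulAction.isCoatom_stabilizer_iff_preprimitive St
      ((1 : St) : St ⧸ H.subgroupOf St), MulAction.stabilizer_quotient]
    exact hcoatom
  let π := (MulAction.toPermHom St (St ⧸ H.subgroupOf St)).rangeRestrict
  have hπ : Function.Surjective π := MonoidHom.rangeRestrict_surjective _
  have hprimQ : MulAction.IsPreprimitive (MulAction.toPermHom St (St ⧸ H.subgroupOf St)).range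
      (St ⧸ H.subgroupOf St) := by
    let f : (St ⧸ H.subgroupOf St) →ₑ[π] (St ⧸ H.subgroupOf St) :=
      { toFun := id
        map_smul' := fun _ _ => rfl }
    exact MulAction.IsPreprimitive.of_surjective (f := f) Function.surjective_id
  have hD0 : pullSub π St.normalCore ⊥ ≤ H := by
    intro x hx
    obtain ⟨_, h1, h2⟩ := mem_pullSub.1 hx
    have h3 : (⟨x, h1⟩ : St) ∈ (H.subgroupOf St).normalCore := by
      rw [Subgroup.normalCore_eq_ker, MonoidHom.mem_ker]
      exact congrArg Subtype.val (Subgroup.mem_bot.1 h2)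
    exact Subgroup.mem_subgroupOf.1 ((H.subgroupOf St).normalCore_le h3)
  have hKS : St.normalCore ≤ St := Subgroup.normalCore_le _
  have hD0core : (pullSub π St.normalCore ⊥).normalCore = ⊥ :=
    le_bot_iff.1 (hcore ▸ Subgroup.normalCore_mono hD0)
  have hDn : NormBy St (pullSub π St.normalCore ⊥) := normBy_pullSub
  have hg1 := one_le_divSqrtLog hn
  rcases hC (MulAction.toPermHom St (St ⧸ H.subgroupOf St)).range (St ⧸ H.subgroupOf St)
    (hcardΩ ▸ hr2) with hgiant | hsmall
  · have h1 := genBound_giant hgiant hKS π hπ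
    rw [hD0core, ← hs] at h1
    refine h1.mono ?_
    have h2 : divSqrtLog s ≤ divSqrtLog H.index := by
      rcases (by omega : s = 1 ∨ 2 ≤ s) with h | h
      · rw [h]
        refine le_trans ?_ (zero_le_one.trans hg1)
        simp [divSqrtLog]
      · have h3 := divSqrtLog_le_of_mul hr2 h
        have h4 := divSqrtLog_nonneg s
        rw [hrs] at h3
        linarith
    nlinarith
  · have hrel : (pullSub π St.normalCore ⊥).relIndex St.normalCore ≤
        Nat.card (MulAction.toPermHom St (St ⧸ H.subgroupOf St)).range := by
      rw [relIndex_pullSub hKS, Subgroup.relIndex_bot_left]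
      exact Subgroup.card_le_card_group _
    have hpos : 0 < (pullSub π St.normalCore ⊥).relIndex St.normalCore :=
      Nat.pos_of_ne_zero Subgroup.FiniteIndex.index_ne_zero
    rw [hcardΩ] at hsmall
    have hlog : Real.log ((pullSub π St.normalCore ⊥).relIndex St.normalCore) ≤
        C * divSqrtLog r :=
      (Real.log_le_log (by exact_mod_cast hpos) (by exact_mod_cast hrel)).trans hsmall
    have hlog0 := Real.log_natCast_nonneg ((pullSub π St.normalCore ⊥).relIndex St.normalCore)
    rcases Nat.lt_or_ge s r with hlt | hge
    · refine genBound_relIndex bot_le fun k hk => (card_le_two_mul_log hk).trans ?_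
      rw [Subgroup.relIndex_bot_left]
      have h1 := card_le_relIndex_pow (K := St.normalCore) hDn hD0core
      have h2 : Real.log (Nat.card St.normalCore) ≤
          s * Real.log ((pullSub π St.normalCore ⊥).relIndex St.normalCore) := by
        rw [hs, ← Real.log_pow]
        exact Real.log_le_log (by exact_mod_cast Nat.card_pos) (by exact_mod_cast h1)
      have h3 := mul_divSqrtLog_le hs1 hlt
      rw [hrs] at h3
      have h4 : (s : ℝ) * Real.log ((pullSub π St.normalCore ⊥).relIndex St.normalCore) ≤
          s * (C * divSqrtLog r) := mul_le_mul_of_nonneg_left hlog (Nat.cast_nonneg s)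
      have h5 : C * (s * divSqrtLog r) ≤ C * (2 * divSqrtLog H.index) :=
        mul_le_mul_of_nonneg_left h3 (by linarith)
      nlinarith
    · have h1 := genBound_chain hDn (hs ▸ hr2.trans hge) _ St.normalCore le_rfl pullSub_le hKS
        NormBy.of_normal
      rw [hD0core, Subgroup.normalCore_eq_self, ← hs] at h1
      refine h1.mono ?_
      have h2 := divSqrtLog_mul_le hr2 hge
      rw [hrs] at h2
      have h3 := mul_le_mul_of_nonneg_right hlog (divSqrtLog_nonneg s)
      have h4 : C * (divSqrtLog r * divSqrtLog s) ≤ C * (2 * divSqrtLog H.index) :=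
        mul_le_mul_of_nonneg_left h2 (by linarith)
      nlinarith

theorem exists_const_generators : ∃ C : ℝ, 0 < C ∧ ∀ (n : ℕ) (G : Type*) [Group G] [Finite G]
    (H : Subgroup G), H.index = n → 2 ≤ n → H.normalCore = ⊥ →
    ∃ S : Finset G, (S.card : ℝ) ≤ C * divSqrtLog n ∧ Subgroup.closure (S : Set G) = ⊤ := by
  classical
  obtain ⟨C, hC0, hC⟩ := exists_genBound_normalCore
  refine ⟨4 * (C + 1), by linarith, ?_⟩
  intro n
  induction n using Nat.strong_induction_on with
  | _ n ih =>
  intro G _ _ H hH hn hcore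
  have hne : H < ⊤ := lt_top_iff_ne_top.2 fun h => by
    rw [h, Subgroup.index_top] at hH
    omega
  obtain ⟨St, hcov, _⟩ := exists_covBy_le_of_lt hne
  have hbound := hC G H St hcov hcore (hH ▸ hn)
  rw [hH] at hbound
  have hrs := Subgroup.relIndex_mul_index hcov.le
  have hr0 : H.relIndex St ≠ 0 := Subgroup.FiniteIndex.index_ne_zero
  have hr1 : H.relIndex St ≠ 1 := by
    rw [Ne, Subgroup.relIndex_eq_one]
    exact hcov.lt.not_ge
  have hs0 : St.index ≠ 0 := Subgroup.FiniteIndex.index_ne_zero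
  have hgn := one_le_divSqrtLog hn
  rw [hH] at hrs
  have hstep : ∃ T : Finset G, (T.card : ℝ) ≤ 3 * (C + 1) * divSqrtLog n ∧
      Subgroup.closure (T : Set G) ⊔ St.normalCore = ⊤ := by
    rcases (by omega : St.index = 1 ∨ 2 ≤ St.index) with h1 | h2
    · refine ⟨∅, ?_, ?_⟩
      · rw [Finset.card_empty, Nat.cast_zero]
        positivity
      · rw [Subgroup.index_eq_one.1 h1, Subgroup.normalCore_eq_self, sup_top_eq]
    · have hmap : (St.map (QuotientGroup.mk' St.normalCore)).index = St.index := by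
        refine Subgroup.index_map_eq _ (QuotientGroup.mk'_surjective _) ?_
        rw [QuotientGroup.ker_mk']
        exact Subgroup.normalCore_le _
      have hlt : St.index < n := by
        have : 2 ≤ H.relIndex St := by omega
        nlinarith
      obtain ⟨S, hS, hSc⟩ := ih _ hlt (G ⧸ St.normalCore) _ hmap h2
        (normalCore_map_mk'_normalCore St)
      choose f hf using QuotientGroup.mk'_surjective St.normalCore
      refine ⟨S.image f, ?_, ?_⟩
      · have h3 : ((S.image f).card : ℝ) ≤ S.card := by exact_mod_cast Finset.card_image_le
        have h4 := divSqrtLog_le_of_mul (show 2 ≤ H.relIndex St by omega) h2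
        rw [hrs] at h4
        have h5 := mul_le_mul_of_nonneg_left h4 (show 0 ≤ C + 1 by linarith)
        nlinarith
      · have h3 : (Subgroup.closure ((S.image f : Finset G) : Set G)).map
            (QuotientGroup.mk' St.normalCore) = ⊤ := by
          rw [MonoidHom.map_closure, Finset.coe_image, ← Set.image_comp, ← hSc]
          congr 1
          convert Set.image_id _
          exact funext hf
        have h4 := Subgroup.comap_map_eq (QuotientGroup.mk' St.normalCore)
          (Subgroup.closure ((S.image f : Finset G) : Set G))
        rw [h3, Subgroup.comap_top, QuotientGroup.ker_mk'] at h4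
        exact h4.symm
  obtain ⟨T, hT, hTc⟩ := hstep
  obtain ⟨U, hU, hUc⟩ := hbound _ hTc
  refine ⟨T ∪ U, ?_, ?_⟩
  · have h1 : ((T ∪ U).card : ℝ) ≤ T.card + U.card := by exact_mod_cast Finset.card_union_le _ _
    nlinarith
  · rw [Finset.coe_union, Subgroup.closure_union]
    rwa [sup_bot_eq] at hUc

theorem normalCore_stabilizer_eq_bot {G α : Type*} [Group G] [MulAction G α] [FaithfulSMul G α]
    [MulAction.IsPretransitive G α] (a : α) : (MulAction.stabilizer G a).normalCore = ⊥ := by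
  rw [eq_bot_iff]
  intro g hg
  rw [Subgroup.mem_bot]
  refine FaithfulSMul.eq_of_smul_eq_smul (α := α) fun x => ?_
  obtain ⟨h, rfl⟩ := MulAction.exists_smul_eq G a x
  have h1 : (h⁻¹ * g * h⁻¹⁻¹) • a = a := hg h⁻¹
  rw [inv_inv, mul_assoc, mul_smul, inv_smul_eq_iff, mul_smul] at h1
  rw [one_smul, h1]

end Main

end GeneratorBounds

/-- There is a constant `c > 0` such that every transitive subgroup `G ≤ Sym(n)` with
`n ≥ 2` satisfies `d(G) ≤ c·n/√(log n)`. -/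
theorem exists_const_minGenSize_transitive_le :
    ∃ c : ℝ, 0 < c ∧ ∀ n : ℕ, 2 ≤ n → ∀ G : Subgroup (Equiv.Perm (Fin n)),
      MulAction.IsPretransitive G (Fin n) →
      (minGenSize G : ℝ) ≤ c * n / Real.sqrt (Real.log n) := by
  obtain ⟨C, hC, h⟩ := exists_const_generators
  refine ⟨C, hC, fun n hn G hG => ?_⟩
  have hindex : (MulAction.stabilizer G (⟨0, by omega⟩ : Fin n)).index = n := by
    rw [MulAction.index_stabilizer_of_transitive, Nat.card_fin]
  obtain ⟨S, hS, hSG⟩ := h n G _ hindex hn (normalCore_stabilizer_eq_bot _)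
  have hle : minGenSize G ≤ S.card := Nat.sInf_le ⟨S, rfl, hSG⟩
  rw [mul_div_assoc]
  exact (Nat.cast_le.2 hle).trans hS
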